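/- The class TKR∀ of all knowledge bases whose restricted chase sequences are all finite is Π¹₁-complete. -/

import Mathlib

/-!
Common formalization framework for "Restricted Chase Termination: You Want More than Fairness"
(Carral, Gerlach, Larroque, Thomazo).

Syntax is encoded over natural numbers so that all finite objects (rules, databases, knowledge
bases, Turing machines) live in `Primcodable` types, which allows us to speak about
many-one reductions and about the arithmetical/analytical hierarchy.
-/

namespace ChaseTermination

/-! ### Terms, atoms, facts, rules, knowledge bases -/

/-- Ground terms: `Sum.inl c` is the constant `c`, `Sum.inr n` is the null `n`. -/
abbrev GroundTerm : Type := ℕ ⊕ ℕ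

/-- Terms of rules: `Sum.inl v` is the variable `v`, `Sum.inr g` a ground term. -/
abbrev RTerm : Type := ℕ ⊕ GroundTerm

/-- A fact: a predicate (coded by a natural number) applied to ground terms. -/
abbrev Fact : Type := ℕ × List GroundTerm

/-- An atom: a predicate applied to terms. -/
abbrev Atom : Type := ℕ × List RTerm

/-- An existential rule, given by its body and its head (lists of atoms);
the universally quantified variables are those occurring in the body, the existentially
quantified ones are the head variables not occurring in the body. -/
abbrev Rule : Type := List Atom × List Atom

abbrev RuleSet : Type := List Rule

abbrev Database : Type := List Fact

/-- A knowledge base: a (finite) rule set together with a database. -/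
abbrev KB : Type := RuleSet × Database

def atomHasVar (a : Atom) (v : ℕ) : Prop := (Sum.inl v : RTerm) ∈ a.2

def atomNullFree (a : Atom) : Prop := ∀ t ∈ a.2, ∀ n : ℕ, t ≠ Sum.inr (Sum.inr n)

def factNullFree (f : Fact) : Prop := ∀ t ∈ f.2, ∀ n : ℕ, t ≠ Sum.inr n

/-- A database is a finite fact set without nulls. -/
def IsDatabase (D : Database) : Prop := ∀ f ∈ D, factNullFree f

/-- Well-formed rule: non-empty head, no nulls. -/
def IsRule (r : Rule) : Prop := r.2 ≠ [] ∧ ∀ a ∈ r.1 ++ r.2, atomNullFree a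

def IsRuleSet (S : RuleSet) : Prop := ∀ r ∈ S, IsRule r

def IsKB (kb : KB) : Prop := IsRuleSet kb.1 ∧ IsDatabase kb.2

/-- `v` occurs in the body of `r` (i.e. is universally quantified). -/
def bodyVar (r : Rule) (v : ℕ) : Prop := ∃ a ∈ r.1, atomHasVar a v

/-- `v` is an existential variable of `r`. -/
def existVar (r : Rule) (v : ℕ) : Prop := (∃ a ∈ r.2, atomHasVar a v) ∧ ¬ bodyVar r v

def applyT (σ : ℕ → GroundTerm) : RTerm → GroundTerm
  | Sum.inl v => σ v
  | Sum.inr g => g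

def applyA (σ : ℕ → GroundTerm) (a : Atom) : Fact := (a.1, a.2.map (applyT σ))

/-- A trigger: a rule together with a substitution for its (universal) variables. -/
abbrev Trigger : Type := Rule × (ℕ → GroundTerm)

/-- The support of a trigger: the instantiated body. -/
def support (t : Trigger) : Set Fact := {f | ∃ a ∈ t.1.1, f = applyA t.2 a}

/-- A trigger is loaded for `F` if `F` includes its support. -/
def loaded (t : Trigger) (F : Set Fact) : Prop := ∀ a ∈ t.1.1, applyA t.2 a ∈ F

/-- `σ'` agrees with the substitution of `t` on all universally quantified (body) variables. -/
def agreesOnBody (t : Trigger) (σ' : ℕ → GroundTerm) : Prop :=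
  ∀ v, bodyVar t.1 v → σ' v = t.2 v

/-- A trigger is obsolete for `F` if some extension of its substitution to the existential
variables sends the head into `F`. -/
def obsolete (t : Trigger) (F : Set Fact) : Prop :=
  ∃ σ' : ℕ → GroundTerm, agreesOnBody t σ' ∧ ∀ a ∈ t.1.2, applyA σ' a ∈ F

/-- The (ground) terms occurring in a fact set. -/
def termsOf (F : Set Fact) : Set GroundTerm := {g | ∃ f ∈ F, g ∈ f.2}

/-- `σ'` is a proper output extension of the trigger `t` w.r.t. `F`: it agrees with the trigger
substitution on body variables and maps existential variables to pairwise distinct fresh nulls. -/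
def properExt (t : Trigger) (F : Set Fact) (σ' : ℕ → GroundTerm) : Prop :=
  agreesOnBody t σ' ∧
  (∀ v, existVar t.1 v → ∃ n : ℕ, σ' v = Sum.inr n ∧ (Sum.inr n : GroundTerm) ∉ termsOf F) ∧
  (∀ v w, existVar t.1 v → existVar t.1 w → σ' v = σ' w → v = w)

/-- The output of a trigger under an extended substitution. -/
def outputOf (t : Trigger) (σ' : ℕ → GroundTerm) : Set Fact := {f | ∃ a ∈ t.1.2, f = applyA σ' a}

/-- An active trigger of `S` for `F`: loaded and not obsolete. -/
def Active (S : RuleSet) (F : Set Fact) (t : Trigger) : Prop :=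
  t.1 ∈ S ∧ loaded t F ∧ ¬ obsolete t F

/-- One restricted chase step. -/
def ChaseStep (S : RuleSet) (F F' : Set Fact) : Prop :=
  ∃ t : Trigger, Active S F t ∧ ∃ σ', properExt t F σ' ∧ F' = F ∪ outputOf t σ'

def dbSet (D : Database) : Set Fact := {f | f ∈ D}

/-- A (possibly infinite) restricted chase derivation for `⟨S, D⟩`, of length `len ∈ ℕ∞`.
Beyond the length the fact sets stall, so that the result is always `⋃ i, fact i`. -/
structure Chase (S : RuleSet) (D : Set Fact) where
  len : ℕ∞
  fact : ℕ → Set Fact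
  trig : ℕ → Trigger
  ext : ℕ → ℕ → GroundTerm
  init : fact 0 = D
  activeAt : ∀ i : ℕ, (i : ℕ∞) < len → Active S (fact i) (trig i)
  extOk : ∀ i : ℕ, (i : ℕ∞) < len → properExt (trig i) (fact i) (ext i)
  succ : ∀ i : ℕ, (i : ℕ∞) < len → fact (i + 1) = fact i ∪ outputOf (trig i) (ext i)
  stall : ∀ i : ℕ, ¬ ((i : ℕ∞) < len) → fact (i + 1) = fact i

/-- Fairness: every trigger that becomes loaded is eventually obsolete.
A fair chase derivation is a *restricted chase sequence*; note that for a finite derivation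
fairness forces maximality (no active trigger remains at the end). -/
def Fair {S : RuleSet} {D : Set Fact} (c : Chase S D) : Prop :=
  ∀ t : Trigger, t.1 ∈ S → ∀ i : ℕ, loaded t (c.fact i) → ∃ j : ℕ, i ≤ j ∧ obsolete t (c.fact j)

/-- The result of a chase derivation. -/
def chaseResult {S : RuleSet} {D : Set Fact} (c : Chase S D) : Set Fact := ⋃ i, c.fact i

/-- The derivation is infinite (non-terminating). -/
def IsInfinite {S : RuleSet} {D : Set Fact} (c : Chase S D) : Prop := c.len = ⊤

/-- `TKR∀`: knowledge bases all of whose restricted chase sequences are finite. -/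
def TKRall (kb : KB) : Prop :=
  IsKB kb ∧ ¬ ∃ c : Chase kb.1 (dbSet kb.2), IsInfinite c ∧ Fair c

/-- `TRR∀`: rule sets universally terminating for the restricted chase on every database. -/
def TRRall (S : RuleSet) : Prop :=
  IsRuleSet S ∧ ∀ D : Database, IsDatabase D → ¬ ∃ c : Chase S (dbSet D), IsInfinite c ∧ Fair c

/-! ### Breadth-first chase -/

/-- The instance of a trigger: its rule together with its instantiated body (this determines the
substitution on all body variables). -/
def instOf (t : Trigger) : Rule × List Fact := (t.1, t.1.1.map (applyA t.2))

/-- The set of instances of active triggers (this is what "the number of triggers that are loaded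
and not obsolete" counts). -/
def activeInsts (S : RuleSet) (F : Set Fact) : Set (Rule × List Fact) :=
  {p | ∃ t : Trigger, Active S F t ∧ p = instOf t}

/-- The breadth-first condition (†): a trigger loaded at step `i` becomes obsolete within the
next `n` steps, where `n` is the number of active triggers at step `i`. -/
def BreadthFirst {S : RuleSet} {D : Set Fact} (c : Chase S D) : Prop :=
  ∀ i : ℕ, ∀ t : Trigger, t.1 ∈ S → loaded t (c.fact i) →
    ∃ j : ℕ, i ≤ j ∧ j ≤ i + (activeInsts S (c.fact i)).ncard ∧ obsolete t (c.fact j)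

/-- `TKRBF∀`: knowledge bases all of whose breadth-first chase sequences are finite. -/
def TKRBFall (kb : KB) : Prop :=
  IsKB kb ∧ ¬ ∃ c : Chase kb.1 (dbSet kb.2), IsInfinite c ∧ BreadthFirst c

/-- `TRRBF∀`: rule sets whose breadth-first chase terminates on every database. -/
def TRRBFall (S : RuleSet) : Prop :=
  IsRuleSet S ∧ ∀ D : Database, IsDatabase D →
    ¬ ∃ c : Chase S (dbSet D), IsInfinite c ∧ BreadthFirst c

/-! ### Classes of the arithmetical and analytical hierarchies -/

/-- `Π⁰₂` predicates, via the Kleene normal form `∀ m ∃ k. R`. -/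
def Pi02 {α : Type} [Primcodable α] (p : α → Prop) : Prop :=
  ∃ R : α × ℕ → ℕ → Bool, Computable₂ R ∧ ∀ a, p a ↔ ∀ m : ℕ, ∃ k : ℕ, R (a, m) k = true

/-- `Π¹₁` predicates, via the Kleene normal form: `p a` iff for every function `f : ℕ → ℕ` some
finite initial segment of `f` witnesses a computable predicate. -/
def Pi11 {α : Type} [Primcodable α] (p : α → Prop) : Prop :=
  ∃ R : α → List ℕ → Bool, Computable₂ R ∧
    ∀ a, p a ↔ ∀ f : ℕ → ℕ, ∃ k : ℕ, R a ((List.range k).map f) = true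

/-- `Π¹₁`-hardness: every `Π¹₁` problem many-one reduces to `p`. -/
def Pi11Hard {α : Type} [Primcodable α] (p : α → Prop) : Prop :=
  ∀ q : ℕ → Prop, Pi11 q → q ≤₀ p

def Pi11Complete {α : Type} [Primcodable α] (p : α → Prop) : Prop := Pi11 p ∧ Pi11Hard p

/-! ### Non-deterministic Turing machines -/

/-- A non-deterministic Turing machine `(numStates, alphaSize, table)`.
States are `0, …, numStates - 1` with initial state `0`; tape symbols `0, …, alphaSize - 1`
form `Γ` (so `{0,1} ⊆ Γ` iff `2 ≤ alphaSize`), and the blank `B` is coded by `alphaSize`.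
An entry `((q, a), (q', b, d))` means `(q', b, d) ∈ δ(q, a)`, with `d = true` for a right move
and `d = false` for a left move. -/
abbrev NTM : Type := ℕ × ℕ × List ((ℕ × ℕ) × (ℕ × ℕ × Bool))

def NTM.numStates (M : NTM) : ℕ := M.1
def NTM.blank (M : NTM) : ℕ := M.2.1
def NTM.table (M : NTM) : List ((ℕ × ℕ) × (ℕ × ℕ × Bool)) := M.2.2

/-- Well-formedness: `Γ ⊇ {0,1}`, transitions use valid states and symbols, and the machine
never writes the blank. -/
def NTM.WF (M : NTM) : Prop :=
  1 ≤ NTM.numStates M ∧ 2 ≤ NTM.blank M ∧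
    ∀ e ∈ NTM.table M, e.1.1 < NTM.numStates M ∧ e.1.2 ≤ NTM.blank M ∧
      e.2.1 < NTM.numStates M ∧ e.2.2.1 < NTM.blank M

/-- A configuration `(tape, p, q)`: tape contents (a list of symbol codes whose last cell is
blank and in which no proper symbol occurs after a blank), 0-based head position `p`,
and current state `q`. -/
abbrev Config : Type := List ℕ × ℕ × ℕ

def WFConfig (M : NTM) (ρ : Config) : Prop :=
  ρ.2.1 < ρ.1.length ∧ ρ.1.getLast? = some (NTM.blank M) ∧
    (∀ i j : ℕ, i ≤ j → j < ρ.1.length → ρ.1.getD i 0 = NTM.blank M →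
      ρ.1.getD j 0 = NTM.blank M) ∧
    (∀ a ∈ ρ.1, a ≤ NTM.blank M) ∧ ρ.2.2 < NTM.numStates M

/-- The one-step relation `Next_M` between configurations; each step extends the represented
part of the tape by one blank cell. -/
def NTM.Next (M : NTM) (ρ ρ' : Config) : Prop :=
  ∃ q' b : ℕ, ∃ d : Bool,
    ((ρ.2.2, ρ.1.getD ρ.2.1 0), (q', b, d)) ∈ NTM.table M ∧
    (d = true ∨ 1 ≤ ρ.2.1) ∧
    ρ' = (ρ.1.set ρ.2.1 b ++ [NTM.blank M], if d then ρ.2.1 + 1 else ρ.2.1 - 1, q')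

/-- The starting configuration of `M` on a word. -/
def startConfig (M : NTM) (w : List ℕ) : Config := (w ++ [NTM.blank M], 0, 0)

/-- Words are over the input alphabet `{0, 1}`. -/
def IsWord (w : List ℕ) : Prop := ∀ a ∈ w, a < 2

/-- There is a run of `M` starting in `ρ` that visits the state `qr` infinitely often.
(Such a run is necessarily infinite, and every infinite sequence of `Next_M`-successive
configurations is a run; finite runs trivially feature `qr` only finitely many times.) -/
def RecurringFrom (M : NTM) (qr : ℕ) (ρ : Config) : Prop :=
  ∃ c : ℕ → Config, c 0 = ρ ∧ (∀ i, NTM.Next M (c i) (c (i + 1))) ∧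
    ∀ N : ℕ, ∃ i : ℕ, N ≤ i ∧ (c i).2.2 = qr

/-- `M` is non-recurring through `qr` on the configuration `ρ`: every run of `M` on `ρ`
features `qr` only finitely many times. -/
def NonRecurringFrom (M : NTM) (qr : ℕ) (ρ : Config) : Prop := ¬ RecurringFrom M qr ρ

end ChaseTermination
namespace ChaseTermination

/-! ### The rule set `Σ_M` of Section 4 and the databases `D_ρ` -/

/-- Predicate codes. `pF`, `pR` are the ternary time/tape successor predicates. -/
def pF : ℕ := 0
def pR : ℕ := 1
def pCL : ℕ := 2
def pCR : ℕ := 3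
def pReal : ℕ := 4
def pBrake : ℕ := 5
def pNextBr : ℕ := 6
def pEnd : ℕ := 7
/-- The binary letter predicate for the tape symbol `a`. -/
def pLetter (a : ℕ) : ℕ := 8 + 2 * a
/-- The binary state predicate for the state `q`. -/
def pState (q : ℕ) : ℕ := 9 + 2 * q

/-- Variable codes used in the rules: `x, y, x', y', w, w'` are `0, …, 5`. -/
def tv (v : ℕ) : RTerm := Sum.inl v

def A1 (p : ℕ) (s : RTerm) : Atom := (p, [s])
def A2 (p : ℕ) (s t : RTerm) : Atom := (p, [s, t])
def A3 (p : ℕ) (s t u : RTerm) : Atom := (p, [s, t, u])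

/-- `brSet(x, w)` as atoms: `{F(x,w,w), R(x,w,w), Real(x), Brake(w)}`. -/
def brSetA (x w : RTerm) : List Atom := [A3 pF x w w, A3 pR x w w, A1 pReal x, A1 pBrake w]

/-- Tape alphabet including the blank: `Γ ∪ {B}`. -/
def letters (M : NTM) : List ℕ := List.range (NTM.blank M + 1)
def states (M : NTM) : List ℕ := List.range (NTM.numStates M)

/-- The rule `R_Brake`. -/
def ruleBrake (M : NTM) : Rule :=
  ([A1 pBrake (tv 4)],
    ((letters M).map fun a => A2 (pLetter a) (tv 4) (tv 4)) ++
    ((states M).map fun q => A2 (pState q) (tv 4) (tv 4)) ++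
    [A3 pF (tv 4) (tv 4) (tv 4), A3 pR (tv 4) (tv 4) (tv 4),
     A2 pCL (tv 4) (tv 4), A2 pCR (tv 4) (tv 4), A1 pReal (tv 4), A2 pNextBr (tv 4) (tv 4)])

/-- The rule `R_nextBr`. -/
def ruleNextBr : Rule :=
  (brSetA (tv 0) (tv 4) ++ [A2 pNextBr (tv 4) (tv 5)], brSetA (tv 0) (tv 5))

/-- Transition rule for `(q', b, →) ∈ δ(q, a)` and the letter `c`; if `q = qr` a fresh
brake `w'` is created together with a `nextBr`-atom, otherwise the brake `w` is reused. -/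
def mkTransRight (qr q a q' b c : ℕ) : Rule :=
  ([A2 (pState q) (tv 0) (tv 4), A2 (pLetter a) (tv 0) (tv 4), A3 pR (tv 0) (tv 1) (tv 4),
    A2 (pLetter c) (tv 1) (tv 4)] ++ brSetA (tv 0) (tv 4) ++ brSetA (tv 1) (tv 4),
   if q = qr then
     [A2 (pState q') (tv 3) (tv 5), A2 (pLetter c) (tv 3) (tv 5), A2 (pLetter b) (tv 2) (tv 5),
      A3 pR (tv 2) (tv 3) (tv 5), A3 pF (tv 0) (tv 2) (tv 5), A3 pF (tv 1) (tv 3) (tv 5),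
      A2 pCL (tv 2) (tv 5), A2 pCR (tv 3) (tv 5)] ++
      brSetA (tv 2) (tv 5) ++ brSetA (tv 3) (tv 5) ++ [A2 pNextBr (tv 4) (tv 5)]
   else
     [A2 (pState q') (tv 3) (tv 4), A2 (pLetter c) (tv 3) (tv 4), A2 (pLetter b) (tv 2) (tv 4),
      A3 pR (tv 2) (tv 3) (tv 4), A3 pF (tv 0) (tv 2) (tv 4), A3 pF (tv 1) (tv 3) (tv 4),
      A2 pCL (tv 2) (tv 4), A2 pCR (tv 3) (tv 4)] ++ brSetA (tv 2) (tv 4) ++ brSetA (tv 3) (tv 4))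

/-- Transition rule for `(q', b, ←) ∈ δ(q, a)` and the letter `c`. -/
def mkTransLeft (qr q a q' b c : ℕ) : Rule :=
  ([A2 (pState q) (tv 0) (tv 4), A2 (pLetter a) (tv 0) (tv 4), A3 pR (tv 1) (tv 0) (tv 4),
    A2 (pLetter c) (tv 1) (tv 4)] ++ brSetA (tv 0) (tv 4) ++ brSetA (tv 1) (tv 4),
   if q = qr then
     [A2 (pState q') (tv 3) (tv 5), A2 (pLetter c) (tv 3) (tv 5), A2 (pLetter b) (tv 2) (tv 5),
      A3 pR (tv 3) (tv 2) (tv 5), A3 pF (tv 0) (tv 2) (tv 5), A3 pF (tv 1) (tv 3) (tv 5),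
      A2 pCL (tv 3) (tv 5), A2 pCR (tv 2) (tv 5)] ++
      brSetA (tv 2) (tv 5) ++ brSetA (tv 3) (tv 5) ++ [A2 pNextBr (tv 4) (tv 5)]
   else
     [A2 (pState q') (tv 3) (tv 4), A2 (pLetter c) (tv 3) (tv 4), A2 (pLetter b) (tv 2) (tv 4),
      A3 pR (tv 3) (tv 2) (tv 4), A3 pF (tv 0) (tv 2) (tv 4), A3 pF (tv 1) (tv 3) (tv 4),
      A2 pCL (tv 3) (tv 4), A2 pCR (tv 2) (tv 4)] ++ brSetA (tv 2) (tv 4) ++ brSetA (tv 3) (tv 4))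

/-- All transition rules of `Σ_M` (one per table entry and letter `c`). -/
def transRules (M : NTM) (qr : ℕ) : List Rule :=
  (NTM.table M).foldr (fun e acc =>
    ((letters M).map fun cc =>
      if e.2.2.2 = true then mkTransRight qr e.1.1 e.1.2 e.2.1 e.2.2.1 cc
      else mkTransLeft qr e.1.1 e.1.2 e.2.1 e.2.2.1 cc) ++ acc) []

/-- The rule `R_{C_R}` for the letter `a`. -/
def mkCopyRight (a : ℕ) : Rule :=
  ([A2 pCR (tv 2) (tv 5), A3 pF (tv 0) (tv 2) (tv 5), A3 pR (tv 0) (tv 1) (tv 4),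
    A2 (pLetter a) (tv 1) (tv 4)] ++
    brSetA (tv 0) (tv 4) ++ brSetA (tv 2) (tv 5) ++ brSetA (tv 1) (tv 4),
   [A3 pF (tv 1) (tv 3) (tv 5), A3 pR (tv 2) (tv 3) (tv 5), A2 (pLetter a) (tv 3) (tv 5),
    A2 pCR (tv 3) (tv 5)] ++ brSetA (tv 3) (tv 5))

/-- The rule `R_{C_L}` for the letter `a`. -/
def mkCopyLeft (a : ℕ) : Rule :=
  ([A2 pCL (tv 2) (tv 5), A3 pF (tv 0) (tv 2) (tv 5), A3 pR (tv 1) (tv 0) (tv 4),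
    A2 (pLetter a) (tv 1) (tv 4)] ++
    brSetA (tv 0) (tv 4) ++ brSetA (tv 2) (tv 5) ++ brSetA (tv 1) (tv 4),
   [A3 pF (tv 1) (tv 3) (tv 5), A3 pR (tv 3) (tv 2) (tv 5), A2 (pLetter a) (tv 3) (tv 5),
    A2 pCL (tv 3) (tv 5)] ++ brSetA (tv 3) (tv 5))

def copyRightRules (M : NTM) : List Rule := (letters M).map mkCopyRight
def copyLeftRules (M : NTM) : List Rule := (letters M).map mkCopyLeft

/-- The tape-extension rule `R_End`. -/
def ruleEnd (M : NTM) : Rule :=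
  ([A2 pCR (tv 2) (tv 5), A3 pF (tv 0) (tv 2) (tv 5), A2 pEnd (tv 0) (tv 4)] ++
    brSetA (tv 0) (tv 4) ++ brSetA (tv 2) (tv 5),
   [A3 pR (tv 2) (tv 3) (tv 5), A2 (pLetter (NTM.blank M)) (tv 3) (tv 5),
    A2 pEnd (tv 3) (tv 5)] ++ brSetA (tv 3) (tv 5))

/-- The rule set `Σ_M` of Section 4 (simulating `M`, with the designated state `qr`). -/
def SigmaM (M : NTM) (qr : ℕ) : RuleSet :=
  [ruleBrake M, ruleNextBr] ++ transRules M qr ++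
    copyLeftRules M ++ copyRightRules M ++ [ruleEnd M]

/-- The constant `c_i` (0-based). -/
def cst (i : ℕ) : GroundTerm := Sum.inl (i + 1)
/-- The brake constant `w₁` of the database. -/
def w1 : GroundTerm := Sum.inl 0

/-- `brSet(x, w)` as facts. -/
def brSetF (x w : GroundTerm) : List Fact :=
  [(pF, [x, w, w]), (pR, [x, w, w]), (pReal, [x]), (pBrake, [w])]

/-- The database `D_ρ` encoding a configuration `ρ`. -/
def Drho (M : NTM) (ρ : Config) : Database :=
  ((List.range ρ.1.length).map fun i => ((pR, [cst i, cst (i + 1), w1]) : Fact)) ++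
  ((List.range ρ.1.length).map fun i => ((pLetter (ρ.1.getD i 0), [cst i, w1]) : Fact)) ++
  [((pState ρ.2.2, [cst ρ.2.1, w1]) : Fact),
   ((pLetter (NTM.blank M), [cst ρ.1.length, w1]) : Fact),
   ((pEnd, [cst ρ.1.length, w1]) : Fact)] ++
  (List.range (ρ.1.length + 1)).foldr (fun i acc => brSetF (cst i) w1 ++ acc) []

/-! ### Wild frontiers -/

/-- The atoms explicitly required by the wild-frontier condition ("other" atoms are those
not in this set). -/
def wfListed (M : NTM) (ρ : Config) (w : GroundTerm) (x : ℕ → GroundTerm) : Set Fact :=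
  {f | (∃ i < ρ.1.length,
          f = ((pR, [x i, x (i + 1), w]) : Fact) ∨
          f = ((pLetter (ρ.1.getD i 0), [x i, w]) : Fact)) ∨
    f = ((pState ρ.2.2, [x ρ.2.1, w]) : Fact) ∨
    f = ((pEnd, [x ρ.1.length, w]) : Fact) ∨
    f = ((pLetter (NTM.blank M), [x ρ.1.length, w]) : Fact) ∨
    (∃ i ≤ ρ.1.length, f ∈ brSetF (x i) w)}

/-- `F` has a wild frontier of the configuration `ρ` overseen by `w` (Definition 4.4). -/
def WildFrontier (M : NTM) (F : Set Fact) (ρ : Config) (w : GroundTerm) : Prop :=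
  ∃ x : ℕ → GroundTerm,
    ((pReal, [w]) : Fact) ∉ F ∧
    (∀ i < ρ.1.length, ((pR, [x i, x (i + 1), w]) : Fact) ∈ F ∧
      ((pLetter (ρ.1.getD i 0), [x i, w]) : Fact) ∈ F) ∧
    ((pState ρ.2.2, [x ρ.2.1, w]) : Fact) ∈ F ∧
    ((pEnd, [x ρ.1.length, w]) : Fact) ∈ F ∧
    ((pLetter (NTM.blank M), [x ρ.1.length, w]) : Fact) ∈ F ∧
    (∀ i ≤ ρ.1.length, ∀ f ∈ brSetF (x i) w, f ∈ F) ∧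
    (∀ f ∈ F, f ∉ wfListed M ρ w x →
      ∀ i ≤ ρ.1.length, f.2.head? = some (x i) → f.2[1]? = some w)

/-! ### State atoms, generation, bow ties -/

/-- `g` is a brake of `F`. -/
def isBrake (F : Set Fact) (g : GroundTerm) : Prop := ((pBrake, [g]) : Fact) ∈ F

/-- A state atom of `F`: an atom `q(x, w)` with `q` a state of `M` and `x` not a brake. -/
def StateAtom (M : NTM) (F : Set Fact) (f : Fact) : Prop :=
  ∃ q : ℕ, q < NTM.numStates M ∧ ∃ x wb : GroundTerm,
    f = ((pState q, [x, wb]) : Fact) ∧ f ∈ F ∧ ¬ isBrake F x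

/-- `A` precedes `A'` in the derivation `c`: some applied trigger has `A` in its support
and `A'` in its output. -/
def precedes {S : RuleSet} {D : Set Fact} (c : Chase S D) (A A' : Fact) : Prop :=
  ∃ i : ℕ, (i : ℕ∞) < c.len ∧ A ∈ support (c.trig i) ∧ A' ∈ outputOf (c.trig i) (c.ext i)

/-- The fact `f` is generated (newly produced) at step `i` of the derivation `c`. -/
def generatedAt {S : RuleSet} {D : Set Fact} (c : Chase S D) (i : ℕ) (f : Fact) : Prop :=
  (i : ℕ∞) < c.len ∧ f ∈ outputOf (c.trig i) (c.ext i) ∧ f ∉ c.fact i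

/-- The fact `f` is generated by (an application of) one of the rules in `Rs`. -/
def generatedBy {S : RuleSet} {D : Set Fact} (c : Chase S D) (Rs : List Rule) (f : Fact) : Prop :=
  ∃ i : ℕ, generatedAt c i f ∧ (c.trig i).1 ∈ Rs

/-- Semantically meaningful terms: all terms of `F` except the brakes. -/
def semterms (F : Set Fact) : Set GroundTerm := {g | g ∈ termsOf F ∧ ¬ isBrake F g}

/-- The edge relation `E_R`: `(x, y) ∈ E_R` iff `R(x, y, w) ∈ F` for some `w`. -/
def ER (F : Set Fact) (u v : GroundTerm) : Prop := ∃ w, ((pR, [u, v, w]) : Fact) ∈ F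

/-- The weakly connected component of `x` in the graph induced by `E` on the vertex set `V`. -/
def wcc {α : Type} (V : Set α) (E : α → α → Prop) (x : α) : Set α :=
  {z | z ∈ V ∧ Relation.ReflTransGen (fun u v => u ∈ V ∧ v ∈ V ∧ (E u v ∨ E v u)) x z}

/-- Directed tree rooted in `r` on the vertex set `V` with edge relation `E`. -/
def IsDirTree {α : Type} (V : Set α) (E : α → α → Prop) (r : α) : Prop :=
  r ∈ V ∧
  (∀ v ∈ V, Relation.ReflTransGen (fun u v' => u ∈ V ∧ v' ∈ V ∧ E u v') r v) ∧
  (∀ v ∈ V, v ≠ r → ∃! u, u ∈ V ∧ E u v) ∧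
  (∀ u ∈ V, ¬ E u r)

/-- A bow tie with center `(x, y)` (Definition 6.2): `V_x^{-y}` induces a directed tree on the
inverse edges rooted in `x`, `V_y^{-x}` induces a directed tree rooted in `y`, and the two
components partition `V`. -/
def IsBowTie {α : Type} (V : Set α) (E : α → α → Prop) (x y : α) : Prop :=
  x ∈ V ∧ y ∈ V ∧ E x y ∧
  IsDirTree (wcc (V \ {y}) E x) (fun u v => E v u) x ∧
  IsDirTree (wcc (V \ {x}) E y) E y ∧
  wcc (V \ {y}) E x ∩ wcc (V \ {x}) E y = ∅ ∧
  wcc (V \ {y}) E x ∪ wcc (V \ {x}) E y = V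

/-- `bowtie(A)` for a state atom `q(x, w)`: the weakly connected component of `x` in
`(semterms F, E_R)`. -/
def bowtieOf (F : Set Fact) (x : GroundTerm) : Set GroundTerm := wcc (semterms F) (ER F) x

/-- A maximal `E`-path in the vertex set `V`. -/
def IsMaxPath {α : Type} (V : Set α) (E : α → α → Prop) (l : List α) : Prop :=
  l ≠ [] ∧ (∀ z ∈ l, z ∈ V) ∧ List.Chain' E l ∧
  (∀ z ∈ V, ∀ a, l.head? = some a → ¬ E z a) ∧
  (∀ z ∈ V, ∀ a, l.getLast? = some a → ¬ E a z)

/-- `configs(A)` (Definition 6.4): one candidate configuration per maximal path of `bowtie(A)`. -/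
def configsOf (M : NTM) (F : Set Fact) (A : Fact) : Set (Set Fact) :=
  {S | ∃ q : ℕ, ∃ x w : GroundTerm, A = ((pState q, [x, w]) : Fact) ∧
    ∃ l : List GroundTerm, IsMaxPath (bowtieOf F x) (ER F) l ∧
      S = insert A
        ({f | ∃ z ∈ l, f ∈ brSetF z w} ∪
         {f | f ∈ F ∧ (f.1 = pR ∨ f.1 = pEnd ∨ ∃ a ∈ letters M, f.1 = pLetter a) ∧
           f.2 ≠ [] ∧ f.2.getLast? = some w ∧ ∀ z ∈ f.2.dropLast, z ∈ l})}

/-- Homomorphic embedding of fact sets: a map on nulls (fixing all constants) sending `S`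
into `T`. -/
def mapG (h : ℕ → GroundTerm) : GroundTerm → GroundTerm
  | Sum.inl cc => Sum.inl cc
  | Sum.inr n => h n

def mapFact (h : ℕ → GroundTerm) (f : Fact) : Fact := (f.1, f.2.map (mapG h))

def HomEmbeds (S T : Set Fact) : Prop := ∃ h : ℕ → GroundTerm, ∀ f ∈ S, mapFact h f ∈ T

end ChaseTermination
namespace ChaseTermination

/-! ### The machine `M_Σ` (Definition 4.1), modelled by its canonical runs

A run of `M_Σ` on the encoding of a database corresponds exactly to a restricted chase
derivation of `⟨Σ, D⟩` (step 4 of the procedure) together with the counter `j`; the machine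
visits its designated state `q_r` once each time `j` is incremented (step 5), so a run visits
`q_r` infinitely often iff the derivation is infinite and `jseq` is unbounded. -/

open scoped Classical in
/-- The value of the counter `j` of `M_Σ` after `i` iterations of its main loop, when its
non-deterministic choices build the chase derivation `c`. -/
noncomputable def jseq {S : RuleSet} {D : Set Fact} (c : Chase S D) : ℕ → ℕ
  | 0 => 0
  | i + 1 =>
      if ∀ t : Trigger, Active S (c.fact (jseq c i)) t → obsolete t (c.fact i) then
        jseq c i + 1
      else jseq c i

/-! ### Oblivious and core chase variants -/

/-- A (possibly infinite) oblivious chase derivation: triggers need only be loaded, but no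
trigger (instance) is ever applied twice. -/
structure OblChase (S : RuleSet) (D : Set Fact) where
  len : ℕ∞
  fact : ℕ → Set Fact
  trig : ℕ → Trigger
  ext : ℕ → ℕ → GroundTerm
  init : fact 0 = D
  memAt : ∀ i : ℕ, (i : ℕ∞) < len → (trig i).1 ∈ S
  loadAt : ∀ i : ℕ, (i : ℕ∞) < len → loaded (trig i) (fact i)
  noRepeat : ∀ i j : ℕ, (i : ℕ∞) < len → (j : ℕ∞) < len →
    instOf (trig i) = instOf (trig j) → i = j
  extOk : ∀ i : ℕ, (i : ℕ∞) < len → properExt (trig i) (fact i) (ext i)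
  succ : ∀ i : ℕ, (i : ℕ∞) < len → fact (i + 1) = fact i ∪ outputOf (trig i) (ext i)
  stall : ∀ i : ℕ, ¬ ((i : ℕ∞) < len) → fact (i + 1) = fact i

/-- Fairness for the oblivious chase: every trigger that becomes loaded is eventually applied. -/
def OblFair {S : RuleSet} {D : Set Fact} (c : OblChase S D) : Prop :=
  ∀ t : Trigger, t.1 ∈ S → ∀ i : ℕ, loaded t (c.fact i) →
    ∃ j : ℕ, (j : ℕ∞) < c.len ∧ instOf (c.trig j) = instOf t

/-- `H` is a retract of `G`: `H ⊆ G` and some homomorphism (fixing constants) maps `G` into `H`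
leaving `H` pointwise fixed. -/
def RetractOf (G H : Set Fact) : Prop :=
  H ⊆ G ∧ ∃ h : ℕ → GroundTerm, (∀ f ∈ G, mapFact h f ∈ H) ∧ ∀ f ∈ H, mapFact h f = f

/-- `H` is a core of `G`: a retract of `G` without proper retracts. -/
def IsCoreOf (H G : Set Fact) : Prop := RetractOf G H ∧ ∀ H', RetractOf H H' → H' = H

/-- `G` is obtained from `F` by applying all active triggers in parallel, each with fresh
pairwise distinct nulls (distinct trigger instances use disjoint fresh nulls). -/
def IsParallelStep (S : RuleSet) (F G : Set Fact) : Prop :=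
  ∃ pe : Trigger → (ℕ → GroundTerm),
    (∀ t : Trigger, Active S F t → properExt t F (pe t)) ∧
    (∀ t t' : Trigger, Active S F t → Active S F t' → instOf t = instOf t' →
      outputOf t (pe t) = outputOf t' (pe t')) ∧
    (∀ t t' : Trigger, Active S F t → Active S F t' → instOf t ≠ instOf t' →
      ∀ n : ℕ, (Sum.inr n : GroundTerm) ∉ termsOf F →
        (Sum.inr n : GroundTerm) ∈ termsOf (outputOf t (pe t)) →
        (Sum.inr n : GroundTerm) ∉ termsOf (outputOf t' (pe t'))) ∧
    G = F ∪ ⋃ t ∈ {t : Trigger | Active S F t}, outputOf t (pe t)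

/-- A (possibly infinite) core chase sequence: `F_{i+1}` is a core of the parallel application
of all active triggers to `F_i`, and the sequence stops exactly when this is a fixpoint. -/
structure CoreChase (S : RuleSet) (D : Set Fact) where
  len : ℕ∞
  fact : ℕ → Set Fact
  init : fact 0 = D
  step : ∀ i : ℕ, (i : ℕ∞) < len →
    ∃ G, IsParallelStep S (fact i) G ∧ IsCoreOf (fact (i + 1)) G ∧ fact (i + 1) ≠ fact i
  halt : ∀ i : ℕ, ¬ ((i : ℕ∞) < len) → ∃ G, IsParallelStep S (fact i) G ∧ IsCoreOf (fact i) G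
  stall : ∀ i : ℕ, ¬ ((i : ℕ∞) < len) → fact (i + 1) = fact i

/-- The three chase variants. -/
inductive Variant : Type | obl | rest | core

/-- `qExists` ("sometimes") and `qForall` ("always") termination. -/
inductive Quant : Type | qExists | qForall

/-- `Terminates v q S D`: the knowledge base `⟨S, D⟩` `q`-terminates for the chase variant `v`
(`qExists`: some chase sequence is finite; `qForall`: all chase sequences are finite). -/
def Terminates (v : Variant) (q : Quant) (S : RuleSet) (D : Set Fact) : Prop :=
  match v, q with
  | .rest, .qExists => ∃ c : Chase S D, Fair c ∧ c.len ≠ ⊤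
  | .rest, .qForall => ∀ c : Chase S D, Fair c → c.len ≠ ⊤
  | .obl, .qExists => ∃ c : OblChase S D, OblFair c ∧ c.len ≠ ⊤
  | .obl, .qForall => ∀ c : OblChase S D, OblFair c → c.len ≠ ⊤
  | .core, .qExists => ∃ c : CoreChase S D, c.len ≠ ⊤
  | .core, .qForall => ∀ c : CoreChase S D, c.len ≠ ⊤

end ChaseTermination

namespace ChaseTermination

/-! ### Closure properties of primitive recursive predicates -/

section PrimrecHelpers

variable {α β : Type} [Primcodable α] [Primcodable β]

theorem primrecPred_ball {l : α → List β} {p : α → β → Prop} (hl : Primrec l)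
    (hp : PrimrecPred fun x : α × β => p x.1 x.2) : PrimrecPred fun a => ∀ b ∈ l a, p a b :=
  (PrimrecRel.forall_mem_list (R := fun b a => p a b)
    (hp.comp (Primrec.pair Primrec.snd Primrec.fst))).comp hl Primrec.id

theorem primrecPred_bex {l : α → List β} {p : α → β → Prop} (hl : Primrec l)
    (hp : PrimrecPred fun x : α × β => p x.1 x.2) : PrimrecPred fun a => ∃ b ∈ l a, p a b :=
  (PrimrecRel.exists_mem_list (R := fun b a => p a b)
    (hp.comp (Primrec.pair Primrec.snd Primrec.fst))).comp hl Primrec.id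

theorem primrecPred_mem {f : α → β} {l : α → List β} (hf : Primrec f) (hl : Primrec l) :
    PrimrecPred fun a => f a ∈ l a :=
  (primrecPred_bex (p := fun a b => b = f a) hl
    (Primrec.eq.comp Primrec.snd (hf.comp Primrec.fst))).of_eq (by simp)

theorem primrecPred_imp {p q : α → Prop} (hp : PrimrecPred p) (hq : PrimrecPred q) :
    PrimrecPred fun a => p a → q a :=
  (hp.not.or hq).of_eq fun a => by tauto

end PrimrecHelpers

/-! ### Substitutions given by finite lists -/

/-- The substitution given by a finite list of terms. -/
def listSubst (l : List GroundTerm) (v : ℕ) : GroundTerm := l.getD v (Sum.inl 0)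

theorem applyT_listSubst_primrec :
    Primrec₂ fun (l : List GroundTerm) (t : RTerm) => applyT (listSubst l) t := by
  have : Primrec fun x : List GroundTerm × RTerm =>
      Sum.casesOn (motive := fun _ => GroundTerm) x.2
        (fun v => x.1.getD v (Sum.inl 0)) (fun g => g) :=
    Primrec.sumCasesOn Primrec.snd
      ((Primrec.list_getD (Sum.inl 0)).comp (Primrec.fst.comp Primrec.fst) Primrec.snd)
      Primrec.snd.to₂
  refine this.of_eq ?_
  rintro ⟨l, v | g⟩ <;> rfl

theorem applyA_listSubst_primrec :
    Primrec₂ fun (l : List GroundTerm) (a : Atom) => applyA (listSubst l) a :=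
  (Primrec.pair (Primrec.fst.comp Primrec.snd)
    (Primrec.list_map (Primrec.snd.comp Primrec.snd)
      (applyT_listSubst_primrec.comp (Primrec.fst.comp Primrec.fst) Primrec.snd).to₂)).of_eq
    fun _ => rfl

/-- The instantiation of a list of atoms under a finitely given substitution. -/
def instAtoms (l : List GroundTerm) (as : List Atom) : List Fact := as.map (applyA (listSubst l))

theorem instAtoms_primrec : Primrec₂ instAtoms :=
  Primrec.list_map Primrec.snd
    (applyA_listSubst_primrec.comp (Primrec.fst.comp Primrec.fst) Primrec.snd).to₂

theorem applyA_congr_iff {σ τ : ℕ → GroundTerm} {a : Atom} :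
    applyA σ a = applyA τ a ↔ ∀ v, atomHasVar a v → σ v = τ v := by
  unfold applyA atomHasVar
  simp only [Prod.mk.injEq, true_and, List.map_inj_left]
  constructor
  · intro h v hv
    exact h _ hv
  · rintro h (v | g) ht
    · exact h v ht
    · rfl

theorem map_applyA_congr_iff {σ τ : ℕ → GroundTerm} {as : List Atom} :
    as.map (applyA σ) = as.map (applyA τ) ↔ ∀ v, (∃ a ∈ as, atomHasVar a v) → σ v = τ v := by
  simp only [List.map_inj_left, applyA_congr_iff]
  grind

theorem exists_var_bound (as : List Atom) :
    ∃ N, ∀ a ∈ as, ∀ v, atomHasVar a v → v < N := by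
  have h : (⋃ a ∈ {a | a ∈ as}, {v | atomHasVar a v}).Finite := by
    refine Set.Finite.biUnion (List.finite_toSet as) fun a _ => ?_
    exact Set.Finite.preimage Sum.inl_injective.injOn (List.finite_toSet a.2)
  obtain ⟨N, hN⟩ := h.bddAbove
  refine ⟨N + 1, fun a ha v hv => Nat.lt_succ_of_le (hN ?_)⟩
  simp only [Set.mem_iUnion]
  exact ⟨a, ha, hv⟩

/-- Every substitution agrees with a finitely given one on the variables of finitely many
atoms. -/
theorem exists_listSubst (as : List Atom) (σ : ℕ → GroundTerm) :
    ∃ l, ∀ a ∈ as, ∀ v, atomHasVar a v → listSubst l v = σ v := by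
  obtain ⟨N, hN⟩ := exists_var_bound as
  refine ⟨(List.range N).map σ, fun a ha v hv => ?_⟩
  simp [listSubst, List.getD_eq_getElem?_getD, hN a ha v hv]

/-! ### Deciding well-formedness of knowledge bases -/

theorem forall_ne_inr_primrec : PrimrecPred fun t : GroundTerm => ∀ n : ℕ, t ≠ Sum.inr n := by
  have : Primrec fun g : GroundTerm =>
      (Sum.casesOn (motive := fun _ => Bool) g (fun _ => true) (fun _ => false)) :=
    Primrec.sumCasesOn Primrec.id (Primrec.const true).to₂ (Primrec.const false).to₂
  refine (Primrec.eq.comp this (Primrec.const true)).of_eq ?_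
  rintro (g | n) <;> simp

theorem isKB_primrec : PrimrecPred IsKB := by
  have h1 : PrimrecPred fun t : RTerm => ∀ n : ℕ, t ≠ Sum.inr (Sum.inr n) := by
    have : Primrec fun t : RTerm => Sum.casesOn (motive := fun _ => Bool) t (fun _ => true)
        (fun g => Sum.casesOn (motive := fun _ => Bool) g (fun _ => true) (fun _ => false)) :=
      Primrec.sumCasesOn Primrec.id (Primrec.const true).to₂
        (Primrec.sumCasesOn Primrec.snd (Primrec.const true).to₂ (Primrec.const false).to₂).to₂
    refine (Primrec.eq.comp this (Primrec.const true)).of_eq ?_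
    rintro (v | g | n) <;> simp
  have h3 : PrimrecPred IsRule := by
    refine ((Primrec.eq.comp Primrec.snd (Primrec.const [])).not).and ?_
    refine primrecPred_ball (Primrec.list_append.comp Primrec.fst Primrec.snd) ?_
    exact primrecPred_ball (Primrec.snd.comp Primrec.snd) (h1.comp Primrec.snd)
  refine (primrecPred_ball Primrec.fst (h3.comp Primrec.snd)).and
    (primrecPred_ball Primrec.snd ?_)
  exact primrecPred_ball (Primrec.snd.comp Primrec.snd) (forall_ne_inr_primrec.comp Primrec.snd)

theorem existVar_primrec : PrimrecRel existVar := by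
  have h : PrimrecPred fun x : Atom × ℕ => atomHasVar x.1 x.2 :=
    primrecPred_mem (Primrec.sumInl.comp Primrec.snd) (Primrec.snd.comp Primrec.fst)
  refine PrimrecPred.and ?_ (PrimrecPred.not ?_)
  · exact primrecPred_bex (p := fun (x : Rule × ℕ) a => atomHasVar a x.2)
      (Primrec.snd.comp Primrec.fst)
      (h.comp (Primrec.pair Primrec.snd (Primrec.snd.comp Primrec.fst)))
  · exact primrecPred_bex (p := fun (x : Rule × ℕ) a => atomHasVar a x.2)
      (Primrec.fst.comp Primrec.fst)
      (h.comp (Primrec.pair Primrec.snd (Primrec.snd.comp Primrec.fst)))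

/-! ### Arithmetical description of infinite fair derivations -/

/-- A stage of a coded derivation: the current facts, the applied rule, its substitution, its
extended substitution, and a witness for one instance of the fairness condition. -/
abbrev Stage : Type :=
  List Fact × Rule × List GroundTerm × List GroundTerm × ℕ × List GroundTerm

/-- Local correctness of a coded derivation step. The parameters `τ`, `v`, `w` are universally
quantified later on. -/
def StepCond (S : RuleSet) (A B : Stage) (τ : List GroundTerm) (v w : ℕ) : Prop :=
  B.1 = A.1 ++ instAtoms A.2.2.2.1 A.2.1.2 ∧
  A.2.1 ∈ S ∧
  (∀ f ∈ instAtoms A.2.2.1 A.2.1.1, f ∈ A.1) ∧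
  (instAtoms τ A.2.1.1 = instAtoms A.2.2.1 A.2.1.1 → ¬ ∀ f ∈ instAtoms τ A.2.1.2, f ∈ A.1) ∧
  instAtoms A.2.2.2.1 A.2.1.1 = instAtoms A.2.2.1 A.2.1.1 ∧
  (existVar A.2.1 v → (¬ ∀ n, listSubst A.2.2.2.1 v ≠ Sum.inr n) ∧
    ∀ f ∈ A.1, listSubst A.2.2.2.1 v ∉ f.2) ∧
  (existVar A.2.1 v → existVar A.2.1 w →
    listSubst A.2.2.2.1 v = listSubst A.2.2.2.1 w → v = w)

/-- The witness `(j, τ')` shows that the trigger `⟨r, τ⟩`, if loaded at stage `i`, is obsolete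
at stage `j` with facts `G`. -/
def FairCond (S : RuleSet) (F G : List Fact) (r : Rule) (τ : List GroundTerm) (i j : ℕ)
    (τ' : List GroundTerm) : Prop :=
  r ∈ S → (∀ f ∈ instAtoms τ r.1, f ∈ F) →
    i ≤ j ∧ instAtoms τ' r.1 = instAtoms τ r.1 ∧ ∀ f ∈ instAtoms τ' r.2, f ∈ G

/-- A sequence of stages codes an infinite fair derivation. -/
def CodesChase (kb : KB) (X : ℕ → Stage) : Prop :=
  (X 0).1 = kb.2 ∧ (∀ i τ v w, StepCond kb.1 (X i) (X (i + 1)) τ v w) ∧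
  ∀ i r τ, FairCond kb.1 (X i).1 (X (X (Encodable.encode (i, r, τ))).2.2.2.2.1).1 r τ i
    (X (Encodable.encode (i, r, τ))).2.2.2.2.1 (X (Encodable.encode (i, r, τ))).2.2.2.2.2

theorem listSubst_primrec : Primrec₂ listSubst := Primrec.list_getD _

theorem stepCond_primrec {α : Type} [Primcodable α] {S : α → RuleSet} {A B : α → Stage}
    {τ : α → List GroundTerm} {v w : α → ℕ} (hS : Primrec S) (hA : Primrec A) (hB : Primrec B)
    (hτ : Primrec τ) (hv : Primrec v) (hw : Primrec w) :
    PrimrecPred fun a => StepCond (S a) (A a) (B a) (τ a) (v a) (w a) := by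
  have hF : Primrec fun a => (A a).1 := Primrec.fst.comp hA
  have hr : Primrec fun a => (A a).2.1 := Primrec.fst.comp (Primrec.snd.comp hA)
  have h2 := Primrec.snd.comp (Primrec.snd.comp hA)
  have hσ : Primrec fun a => (A a).2.2.1 := Primrec.fst.comp h2
  have hσ' : Primrec fun a => (A a).2.2.2.1 := Primrec.fst.comp (Primrec.snd.comp h2)
  have hr1 := Primrec.fst.comp hr
  have hr2 := Primrec.snd.comp hr
  have hvv := listSubst_primrec.comp hσ' hv
  have hww := listSubst_primrec.comp hσ' hw
  have hev := existVar_primrec.comp hr hv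
  have hew := existVar_primrec.comp hr hw
  have sub : ∀ {l : α → List GroundTerm} {as : α → List Atom}, Primrec l → Primrec as →
      PrimrecPred fun a => ∀ f ∈ instAtoms (l a) (as a), f ∈ (A a).1 := fun hl has =>
    primrecPred_ball (instAtoms_primrec.comp hl has)
      (primrecPred_mem Primrec.snd (hF.comp Primrec.fst))
  refine (Primrec.eq.comp (Primrec.fst.comp hB)
    (Primrec.list_append.comp hF (instAtoms_primrec.comp hσ' hr2))).and ?_
  refine (primrecPred_mem hr hS).and ?_
  refine (sub hσ hr1).and ?_
  refine (primrecPred_imp (Primrec.eq.comp (instAtoms_primrec.comp hτ hr1)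
    (instAtoms_primrec.comp hσ hr1)) (sub hτ hr2).not).and ?_
  refine (Primrec.eq.comp (instAtoms_primrec.comp hσ' hr1)
    (instAtoms_primrec.comp hσ hr1)).and ?_
  refine (primrecPred_imp hev ((forall_ne_inr_primrec.comp hvv).not.and
    (primrecPred_ball hF (primrecPred_mem (hvv.comp Primrec.fst)
      (Primrec.snd.comp Primrec.snd)).not))).and ?_
  exact primrecPred_imp hev (primrecPred_imp hew
    (primrecPred_imp (Primrec.eq.comp hvv hww) (Primrec.eq.comp hv hw)))

theorem fairCond_primrec {α : Type} [Primcodable α] {S : α → RuleSet} {F G : α → List Fact}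
    {r : α → Rule} {τ τ' : α → List GroundTerm} {i j : α → ℕ} (hS : Primrec S) (hF : Primrec F)
    (hG : Primrec G) (hr : Primrec r) (hτ : Primrec τ) (hi : Primrec i) (hj : Primrec j)
    (hτ' : Primrec τ') :
    PrimrecPred fun a => FairCond (S a) (F a) (G a) (r a) (τ a) (i a) (j a) (τ' a) := by
  have hr1 := Primrec.fst.comp hr
  have hr2 := Primrec.snd.comp hr
  have sub : ∀ {l : α → List GroundTerm} {as : α → List Atom} {H : α → List Fact},
      Primrec l → Primrec as → Primrec H →
      PrimrecPred fun a => ∀ f ∈ instAtoms (l a) (as a), f ∈ H a := fun hl has hH =>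
    primrecPred_ball (instAtoms_primrec.comp hl has)
      (primrecPred_mem Primrec.snd (hH.comp Primrec.fst))
  refine primrecPred_imp (primrecPred_mem hr hS) (primrecPred_imp (sub hτ hr1 hF) ?_)
  exact (Primrec.nat_le.comp hi hj).and ((Primrec.eq.comp (instAtoms_primrec.comp hτ' hr1)
    (instAtoms_primrec.comp hτ hr1)).and (sub hτ' hr2 hG))

/-- The sequence of stages coded by a list of numbers. -/
def stageOf (l : List ℕ) (i : ℕ) : Stage := (Encodable.decode (l.getD i 0)).getD default

/-- Parameters `(i, r, τ, v, w, d)` of the conditions to be checked, `d` being a dummy used only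
to make the code of the tuple large. -/
abbrev Params : Type := ℕ × Rule × List GroundTerm × ℕ × ℕ × ℕ

def paramsOf (l : List ℕ) : Params := (Encodable.decode l.length).getD default

/-- The instance of `CodesChase` selected by the length of a finite initial segment. -/
def SegmentCond (kb : KB) (l : List ℕ) : Prop :=
  let u := paramsOf l
  let m := Encodable.encode (u.1, u.2.1, u.2.2.1)
  let j := (stageOf l m).2.2.2.2.1
  u.1 + 1 < l.length → m < l.length → j < l.length →
    (stageOf l 0).1 = kb.2 ∧
    StepCond kb.1 (stageOf l u.1) (stageOf l (u.1 + 1)) u.2.2.1 u.2.2.2.1 u.2.2.2.2.1 ∧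
    FairCond kb.1 (stageOf l u.1).1 (stageOf l j).1 u.2.1 u.2.2.1 u.1 j
      (stageOf l m).2.2.2.2.2

theorem stageOf_primrec : Primrec₂ stageOf :=
  Primrec.option_getD.comp (Primrec.decode.comp (Primrec.list_getD 0)) (Primrec.const default)

theorem segmentCond_primrec : PrimrecRel SegmentCond := by
  have hl : Primrec fun x : KB × List ℕ => x.2 := Primrec.snd
  have hu : Primrec fun x : KB × List ℕ => paramsOf x.2 :=
    Primrec.option_getD.comp (Primrec.decode.comp (Primrec.list_length.comp hl))
      (Primrec.const default)
  have hlen := Primrec.list_length.comp hl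
  have hi := Primrec.fst.comp hu
  have hr := Primrec.fst.comp (Primrec.snd.comp hu)
  have hu2 := Primrec.snd.comp (Primrec.snd.comp hu)
  have hτ := Primrec.fst.comp hu2
  have hv := Primrec.fst.comp (Primrec.snd.comp hu2)
  have hw := Primrec.fst.comp (Primrec.snd.comp (Primrec.snd.comp hu2))
  have hm := Primrec.encode.comp (Primrec.pair hi (Primrec.pair hr hτ))
  have hX := fun {f : KB × List ℕ → ℕ} (hf : Primrec f) => stageOf_primrec.comp hl hf
  have hjt := Primrec.snd.comp (Primrec.snd.comp (Primrec.snd.comp (Primrec.snd.comp (hX hm))))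
  have hj := Primrec.fst.comp hjt
  have hS : Primrec fun x : KB × List ℕ => x.1.1 := Primrec.fst.comp Primrec.fst
  refine primrecPred_imp (Primrec.nat_lt.comp (Primrec.succ.comp hi) hlen)
    (primrecPred_imp (Primrec.nat_lt.comp hm hlen)
    (primrecPred_imp (Primrec.nat_lt.comp hj hlen) ?_))
  refine (Primrec.eq.comp (Primrec.fst.comp (hX (Primrec.const 0)))
    (Primrec.snd.comp Primrec.fst)).and ((stepCond_primrec hS (hX hi)
      (hX (Primrec.succ.comp hi)) hτ hv hw).and ?_)
  exact fairCond_primrec hS (Primrec.fst.comp (hX hi)) (Primrec.fst.comp (hX hj)) hr hτ hi hj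
    (Primrec.snd.comp hjt)

end ChaseTermination

namespace ChaseTermination

theorem agreesOnBody_iff_map_eq {r : Rule} {σ σ' : ℕ → GroundTerm} :
    agreesOnBody (r, σ) σ' ↔ r.1.map (applyA σ') = r.1.map (applyA σ) :=
  map_applyA_congr_iff.symm

theorem loaded_iff_forall_mem_map {r : Rule} {σ : ℕ → GroundTerm} {F : Set Fact} :
    loaded (r, σ) F ↔ ∀ f ∈ r.1.map (applyA σ), f ∈ F := by
  rw [List.forall_mem_map]
  rfl

theorem exists_instAtoms_eq (r : Rule) (σ : ℕ → GroundTerm) :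
    ∃ l, instAtoms l r.1 = r.1.map (applyA σ) ∧ instAtoms l r.2 = r.2.map (applyA σ) := by
  obtain ⟨l, hl⟩ := exists_listSubst (r.1 ++ r.2) σ
  refine ⟨l, map_applyA_congr_iff.2 ?_, map_applyA_congr_iff.2 ?_⟩
  · rintro v ⟨a, ha, hv⟩
    exact hl a (List.mem_append_left _ ha) v hv
  · rintro v ⟨a, ha, hv⟩
    exact hl a (List.mem_append_right _ ha) v hv

theorem obsolete_iff_exists_list {r : Rule} {σ : ℕ → GroundTerm} {F : Set Fact} :
    obsolete (r, σ) F ↔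
      ∃ l, instAtoms l r.1 = r.1.map (applyA σ) ∧ ∀ f ∈ instAtoms l r.2, f ∈ F := by
  constructor
  · rintro ⟨σ', h1, h2⟩
    obtain ⟨l, hl1, hl2⟩ := exists_instAtoms_eq r σ'
    refine ⟨l, hl1.trans (agreesOnBody_iff_map_eq.1 h1), ?_⟩
    rw [hl2, List.forall_mem_map]
    exact h2
  · rintro ⟨l, h1, h2⟩
    exact ⟨listSubst l, agreesOnBody_iff_map_eq.2 h1, List.forall_mem_map.1 h2⟩

theorem exists_chase_of_codesChase {kb : KB} {X : ℕ → Stage} (h : CodesChase kb X) :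
    ∃ c : Chase kb.1 (dbSet kb.2), IsInfinite c ∧ Fair c := by
  obtain ⟨h0, hs, hf⟩ := h
  refine ⟨{ len := ⊤
            fact := fun i => {f | f ∈ (X i).1}
            trig := fun i => ((X i).2.1, listSubst (X i).2.2.1)
            ext := fun i => listSubst (X i).2.2.2.1
            init := by rw [h0]; rfl
            activeAt := ?_
            extOk := ?_
            succ := ?_
            stall := fun i hi => (hi (ENat.natCast_lt_top i)).elim }, rfl, ?_⟩
  · intro i _
    obtain ⟨-, h2, h3, -, -⟩ := hs i [] 0 0
    refine ⟨h2, loaded_iff_forall_mem_map.2 h3, ?_⟩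
    rw [obsolete_iff_exists_list]
    rintro ⟨l, hl1, hl2⟩
    exact (hs i l 0 0).2.2.2.1 hl1 hl2
  · intro i _
    refine ⟨agreesOnBody_iff_map_eq.2 (hs i [] 0 0).2.2.2.2.1, ?_, ?_⟩
    · intro v hv
      obtain ⟨h1, h2⟩ := (hs i [] v 0).2.2.2.2.2.1 hv
      push Not at h1
      obtain ⟨n, hn⟩ := h1
      refine ⟨n, hn, ?_⟩
      rintro ⟨f, hf, hnf⟩
      exact h2 f hf (hn ▸ hnf)
    · intro v w hv hw
      exact (hs i [] v w).2.2.2.2.2.2 hv hw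
  · intro i _
    ext f
    simp only [Set.mem_ofPred_eq, (hs i [] 0 0).1, List.mem_append, outputOf, Set.mem_union,
      instAtoms, List.mem_map, eq_comm]
  · rintro ⟨r, σ⟩ hr i hl
    obtain ⟨l, hl1, -⟩ := exists_instAtoms_eq r σ
    obtain ⟨hij, h1, h2⟩ := hf i r l hr (by rw [hl1]; exact loaded_iff_forall_mem_map.1 hl)
    exact ⟨_, hij, obsolete_iff_exists_list.2 ⟨_, h1.trans hl1, h2⟩⟩

theorem exists_codesChase_of_chase {kb : KB} (c : Chase kb.1 (dbSet kb.2)) (hc : IsInfinite c)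
    (hfair : Fair c) : ∃ X, CodesChase kb X := by
  have hlt : ∀ i : ℕ, (i : ℕ∞) < c.len := fun i => by rw [hc]; exact ENat.natCast_lt_top i
  choose e he1 he2 using fun i => exists_instAtoms_eq (c.trig i).1 (c.ext i)
  choose s hs1 _ using fun i => exists_instAtoms_eq (c.trig i).1 (c.trig i).2
  let F : ℕ → List Fact := fun i =>
    Nat.rec kb.2 (fun i l => l ++ instAtoms (e i) (c.trig i).1.2) i
  have hF : ∀ i, {f | f ∈ F i} = c.fact i := by
    intro i
    induction i with
    | zero => rw [c.init]; rfl
    | succ i ih =>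
      rw [c.succ i (hlt i), ← ih]
      ext f
      change f ∈ F i ++ instAtoms (e i) (c.trig i).1.2 ↔ _
      rw [he2]
      simp only [List.mem_append, outputOf, Set.mem_union, Set.mem_ofPred_eq, List.mem_map,
        eq_comm]
  have hFm : ∀ i f, f ∈ F i ↔ f ∈ c.fact i := fun i f => by rw [← hF i]; rfl
  have hw : ∀ p : ℕ × Rule × List GroundTerm, ∃ u : ℕ × List GroundTerm,
      FairCond kb.1 (F p.1) (F u.1) p.2.1 p.2.2 p.1 u.1 u.2 := by
    rintro ⟨i, r, τ⟩
    by_cases hr : r ∈ kb.1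
    swap
    · exact ⟨default, fun h => absurd h hr⟩
    rcases Classical.em (∀ f ∈ instAtoms τ r.1, f ∈ F i) with hl | hl
    swap
    · exact ⟨default, fun _ h => absurd h hl⟩
    obtain ⟨j, hij, hj⟩ := hfair (r, listSubst τ) hr i
      (loaded_iff_forall_mem_map.2 fun f hf => (hFm i f).1 (hl f hf))
    obtain ⟨l, h1, h2⟩ := obsolete_iff_exists_list.1 hj
    exact ⟨(j, l), fun _ _ => ⟨hij, h1, fun f hf => (hFm j f).2 (h2 f hf)⟩⟩
  choose u hu using hw
  let v : ℕ → ℕ × List GroundTerm := fun m => u ((Encodable.decode m).getD default)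
  refine ⟨fun i => (F i, (c.trig i).1, s i, e i, v i), rfl, ?_, ?_⟩
  · intro i τ x y
    have hag := (c.extOk i (hlt i)).1
    have hagree := (agreesOnBody_iff_map_eq (r := (c.trig i).1) (σ := (c.trig i).2)).1 hag
    obtain ⟨ha1, ha2, ha3⟩ := c.activeAt i (hlt i)
    have hex : ∀ x, existVar (c.trig i).1 x → listSubst (e i) x = c.ext i x := fun x hx =>
      map_applyA_congr_iff.1 (he2 i) x hx.1
    refine ⟨rfl, ha1, ?_, ?_, ?_, ?_, ?_⟩
    · intro f hf
      simp only [hs1] at hf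
      exact (hFm i f).2 ((loaded_iff_forall_mem_map (r := (c.trig i).1)).1 ha2 f hf)
    · intro h1 h2
      refine ha3 ((obsolete_iff_exists_list (r := (c.trig i).1)).2 ⟨τ, h1.trans (hs1 i), ?_⟩)
      exact fun f hf => (hFm i f).1 (h2 f hf)
    · simp only [he1, hs1]
      exact hagree
    · intro hx
      obtain ⟨n, hn, hn2⟩ := (c.extOk i (hlt i)).2.1 x hx
      simp only [hex x hx]
      refine ⟨fun h => h n hn, fun f hf hxf => hn2 ⟨f, (hFm i f).1 hf, hn ▸ hxf⟩⟩
    · intro hx hy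
      simp only [hex x hx, hex y hy]
      exact (c.extOk i (hlt i)).2.2 x y hx hy
  · intro i r τ
    have h : v (Encodable.encode (i, r, τ)) = u (i, r, τ) := by
      simp only [v, Encodable.encodek, Option.getD_some]
    simp only [h]
    exact hu (i, r, τ)

theorem tkrAll_iff (kb : KB) : TKRall kb ↔ IsKB kb ∧ ¬ ∃ X, CodesChase kb X := by
  unfold TKRall
  have : (∃ c : Chase kb.1 (dbSet kb.2), IsInfinite c ∧ Fair c) ↔ ∃ X, CodesChase kb X :=
    ⟨fun ⟨c, h1, h2⟩ => exists_codesChase_of_chase c h1 h2,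
      fun ⟨_, h⟩ => exists_chase_of_codesChase h⟩
  rw [this]

theorem stageOf_map_range (f : ℕ → ℕ) {k i : ℕ} (h : i < k) :
    stageOf ((List.range k).map f) i = (Encodable.decode (f i)).getD default := by
  simp [stageOf, List.getD_eq_getElem?_getD, h]

theorem segmentCond_iff {kb : KB} {l : List ℕ} {i : ℕ} {r : Rule} {τ : List GroundTerm}
    {v w d : ℕ} (hp : paramsOf l = (i, r, τ, v, w, d)) :
    SegmentCond kb l ↔ ∀ m, m = Encodable.encode (i, r, τ) → ∀ M, M = stageOf l m →
      i + 1 < l.length → m < l.length → M.2.2.2.2.1 < l.length →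
      (stageOf l 0).1 = kb.2 ∧ StepCond kb.1 (stageOf l i) (stageOf l (i + 1)) τ v w ∧
      FairCond kb.1 (stageOf l i).1 (stageOf l M.2.2.2.2.1).1 r τ i M.2.2.2.2.1 M.2.2.2.2.2 := by
  unfold SegmentCond
  simp only [hp, forall_eq]

theorem exists_codesChase_iff (kb : KB) :
    (∃ X, CodesChase kb X) ↔ ∃ f : ℕ → ℕ, ∀ k, SegmentCond kb ((List.range k).map f) := by
  constructor
  · rintro ⟨X, h0, hs, hf⟩
    refine ⟨fun i => Encodable.encode (X i), fun k => ?_⟩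
    have hlen : ((List.range k).map fun i => Encodable.encode (X i)).length = k := by simp
    have hX : ∀ i < k, stageOf ((List.range k).map fun i => Encodable.encode (X i)) i = X i :=
      fun i hi => by rw [stageOf_map_range _ hi, Encodable.encodek, Option.getD_some]
    obtain ⟨⟨i, r, τ, v, w, d⟩, hp⟩ :
      ∃ u, paramsOf ((List.range k).map fun i => Encodable.encode (X i)) = u := ⟨_, rfl⟩
    rw [segmentCond_iff hp, hlen]
    rintro m hm M hM h1 h2 h3
    rw [hX m h2] at hM
    rw [hX _ h3, hX _ h1, hX _ (Nat.lt_of_succ_lt h1), hX 0 (by omega), hM, hm]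
    exact ⟨h0, hs _ _ _ _, hf _ _ _⟩
  · rintro ⟨f, hf⟩
    obtain ⟨X, hXdef⟩ : ∃ X : ℕ → Stage, ∀ i, X i = (Encodable.decode (f i)).getD default :=
      ⟨_, fun _ => rfl⟩
    have key : ∀ i r τ v w, (X 0).1 = kb.2 ∧ StepCond kb.1 (X i) (X (i + 1)) τ v w ∧
        FairCond kb.1 (X i).1 (X (X (Encodable.encode (i, r, τ))).2.2.2.2.1).1 r τ i
          (X (Encodable.encode (i, r, τ))).2.2.2.2.1
          (X (Encodable.encode (i, r, τ))).2.2.2.2.2 := by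
      intro i r τ v w
      obtain ⟨m, hm⟩ : ∃ m, m = Encodable.encode (i, r, τ) := ⟨_, rfl⟩
      obtain ⟨j, hj⟩ : ∃ j, j = (X m).2.2.2.2.1 := ⟨_, rfl⟩
      obtain ⟨k, hk⟩ : ∃ k, k = Encodable.encode ((i, r, τ, v, w, i + 1 + m + j + 1) : Params) :=
        ⟨_, rfl⟩
      have hle : i + 1 + m + j + 1 ≤ k := by
        simp only [hk, Encodable.encode_prod_val]
        refine le_trans ?_ (Nat.right_le_pair _ _)
        refine le_trans ?_ (Nat.right_le_pair _ _)
        refine le_trans ?_ (Nat.right_le_pair _ _)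
        refine le_trans ?_ (Nat.right_le_pair _ _)
        exact Nat.right_le_pair _ _
      have hlen : ((List.range k).map f).length = k := by simp
      have hp : paramsOf ((List.range k).map f) = (i, r, τ, v, w, i + 1 + m + j + 1) := by
        rw [paramsOf, hlen, hk, Encodable.encodek, Option.getD_some]
      have hX : ∀ i < k, stageOf ((List.range k).map f) i = X i := fun i hi => by
        rw [stageOf_map_range f hi, hXdef]
      have h := (segmentCond_iff hp).1 (hf k) m hm (X m) (hX m (by omega)).symm
      rw [hlen, ← hj] at h
      rw [hX 0 (by omega), hX i (by omega), hX (i + 1) (by omega), hX j (by omega)] at h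
      rw [← hm, ← hj]
      exact h (by omega) (by omega) (by omega)
    exact ⟨X, (key 0 ([], []) [] 0 0).1, fun i τ v w => (key i ([], []) τ v w).2.1,
      fun i r τ => (key i r τ 0 0).2.2⟩

theorem pi11_tkrAll : Pi11 TKRall := by
  classical
  refine ⟨fun kb l => decide (IsKB kb ∧ ¬ SegmentCond kb l), ?_, ?_⟩
  · have h : PrimrecPred fun x : KB × List ℕ => IsKB x.1 ∧ ¬ SegmentCond x.1 x.2 :=
      (isKB_primrec.comp Primrec.fst).and segmentCond_primrec.not
    exact Primrec.to_comp (h.decide.of_eq fun _ => by congr)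
  · intro kb
    rw [tkrAll_iff, exists_codesChase_iff]
    push Not
    simp only [decide_eq_true_eq, exists_and_left, forall_const, forall_and]

end ChaseTermination

namespace ChaseTermination

/-! ### Simulating transition systems on trees by rule sets with an emergency brake -/

open Relation

/-- A graph rewriting rule: labelled edges `(p, x, y)` between variables to be matched, labelled
edges to be created, the variables denoting new nodes, and a flag telling whether the rule
is a recurring one. Variable `0` denotes the current and `2` the next configuration. -/
structure GRule where
  body : List (ℕ × ℕ × ℕ)
  head : List (ℕ × ℕ × ℕ)
  new : List ℕ
  q : Bool

/-- The edges are listed in the order of a tree search starting from the variables `K`. -/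
def treeOrdered : List ℕ → List (ℕ × ℕ × ℕ) → Prop
  | _, [] => True
  | K, e :: l => e.2.1 ∈ K ∧ e.2.2 ∉ K ∧ treeOrdered (e.2.2 :: K) l

instance decidableTreeOrdered : ∀ K l, Decidable (treeOrdered K l)
  | _, [] => inferInstanceAs (Decidable True)
  | K, e :: l =>
    have := decidableTreeOrdered (e.2.2 :: K) l
    inferInstanceAs (Decidable (e.2.1 ∈ K ∧ e.2.2 ∉ K ∧ treeOrdered (e.2.2 :: K) l))

namespace GRule

/-- The node variables of the body. -/
def vars (r : GRule) : List ℕ := 0 :: r.body.map fun e => e.2.2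

/-- Syntactic well-formedness of a rule over the labels `0, …, P - 1`. -/
def WF (P : ℕ) (r : GRule) : Prop :=
  treeOrdered [0] r.body ∧ (∀ e ∈ r.body, e.1 < P ∧ 4 ≤ e.2.2 ∧ e.2.2 ∉ r.new) ∧
  (∀ e ∈ r.head, e.1 < P ∧ e.2.1 ∈ r.new ∧ (e.2.2 ∈ r.new ∨ e.2.2 ∈ r.vars)) ∧
  2 ∈ r.new ∧ 0 ∉ r.new ∧ 1 ∉ r.new ∧ 3 ∉ r.new

instance (P : ℕ) (r : GRule) : Decidable (r.WF P) := by
  unfold WF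
  infer_instance

end GRule

/-- The assignment `ν` maps all given edges to edges. -/
def EdgeSat {V : Type} (Ch : ℕ → V → V → Prop) (l : List (ℕ × ℕ × ℕ)) (ν : ℕ → V) : Prop :=
  ∀ e ∈ l, Ch e.1 (ν e.2.1) (ν e.2.2)

/-- The term representing arbitrary nodes once a brake has been pulled. -/
def star : GroundTerm := Sum.inl 0

/-- The predicate stating that a configuration is overseen by a brake. -/
def cfP : ℕ := 0

/-- The predicate relating a new brake to the previous one. -/
def nextP : ℕ := 1

/-- The predicate relating a new configuration to the previous one. -/
def prevP : ℕ := 2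

/-- The predicate for edges with label `p`. -/
def edgeP (p : ℕ) : ℕ := p + 3

def edgeAtom (e : ℕ × ℕ × ℕ) : Atom := (edgeP e.1, [Sum.inl e.2.1, Sum.inl e.2.2])

def junkAtoms (P x : ℕ) : List Atom :=
  (List.range (P + 1)).map fun p => (p + 2, [Sum.inr star, Sum.inl x])

/-- The existential rule for a graph rewriting rule. -/
def GRule.toRule (P : ℕ) (r : GRule) : Rule :=
  ((cfP, [Sum.inl 0, Sum.inl 1]) :: r.body.map edgeAtom,
    (prevP, [Sum.inl 2, Sum.inl 0]) :: (r.head.map edgeAtom ++ r.new.flatMap (junkAtoms P) ++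
      if r.q then [(cfP, [Sum.inl 2, Sum.inl 3]), (nextP, [Sum.inl 3, Sum.inl 1])]
      else [(cfP, [Sum.inl 2, Sum.inl 1])]))

/-- The rule that pulls the brake. -/
def brakeRule : Rule :=
  ([(cfP, [Sum.inl 0, Sum.inl 1])],
    [(cfP, [Sum.inr star, Sum.inl 1]), (nextP, [Sum.inl 1, Sum.inl 1])])

/-- All edges into `x` from the junk node are present. -/
def Junk (P : ℕ) (F : Set Fact) (x : GroundTerm) : Prop :=
  ∀ p < P + 1, ((p + 2, [star, x]) : Fact) ∈ F

theorem Junk.mono {P : ℕ} {F G : Set Fact} {x : GroundTerm} (h : Junk P F x) (hFG : F ⊆ G) :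
    Junk P G x := fun p hp => hFG (h p hp)

theorem Junk.edge {P : ℕ} {F : Set Fact} {x : GroundTerm} (h : Junk P F x) {p : ℕ} (hp : p < P) :
    ((edgeP p, [star, x]) : Fact) ∈ F := h (p + 1) (by omega)

theorem Junk.prev {P : ℕ} {F : Set Fact} {x : GroundTerm} (h : Junk P F x) :
    ((prevP, [star, x]) : Fact) ∈ F := h 0 (by omega)

theorem treeOrdered.induction {Q : ℕ → Prop} {l : List (ℕ × ℕ × ℕ)} : ∀ {K : List ℕ},
    treeOrdered K l → (∀ v ∈ K, Q v) → (∀ e ∈ l, Q e.2.1 → Q e.2.2) →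
    ∀ e ∈ l, Q e.2.1 ∧ Q e.2.2 := by
  induction l with
  | nil => simp
  | cons a l ih =>
    intro K h hK hl e he
    have h2 := hl a (by simp) (hK _ h.1)
    rcases List.mem_cons.1 he with rfl | he
    · exact ⟨hK _ h.1, h2⟩
    · refine ih h.2.2 ?_ (fun e he => hl e (by simp [he])) e he
      intro v hv
      rcases List.mem_cons.1 hv with rfl | hv
      · exact h2
      · exact hK v hv

namespace GRule

variable {P : ℕ} {r : GRule}

theorem loaded_toRule_iff {σ : ℕ → GroundTerm} {F : Set Fact} :
    loaded (r.toRule P, σ) F ↔ ((cfP, [σ 0, σ 1]) : Fact) ∈ F ∧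
      ∀ e ∈ r.body, ((edgeP e.1, [σ e.2.1, σ e.2.2]) : Fact) ∈ F := by
  unfold loaded toRule
  rw [List.forall_mem_cons, List.forall_mem_map]
  rfl

theorem mem_head_iff {σ : ℕ → GroundTerm} {f : Fact} :
    (∃ a ∈ (r.toRule P).2, f = applyA σ a) ↔ f = (prevP, [σ 2, σ 0]) ∨
      (∃ e ∈ r.head, f = (edgeP e.1, [σ e.2.1, σ e.2.2])) ∨
      (∃ x ∈ r.new, ∃ p < P + 1, f = (p + 2, [star, σ x])) ∨
      (r.q = true ∧ (f = (cfP, [σ 2, σ 3]) ∨ f = (nextP, [σ 3, σ 1]))) ∨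
      (r.q = false ∧ f = (cfP, [σ 2, σ 1])) := by
  unfold toRule
  simp only [List.mem_cons, List.mem_append, List.mem_map, List.mem_flatMap, junkAtoms,
    List.mem_range, or_and_right, exists_or, exists_eq_left, or_assoc]
  refine or_congr Iff.rfl (or_congr ?_ (or_congr ?_ ?_))
  · constructor
    · rintro ⟨_, ⟨e, he, rfl⟩, rfl⟩
      exact ⟨e, he, rfl⟩
    · rintro ⟨e, he, rfl⟩
      exact ⟨_, ⟨e, he, rfl⟩, rfl⟩
  · constructor
    · rintro ⟨_, ⟨x, hx, p, hp, rfl⟩, rfl⟩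
      exact ⟨x, hx, p, hp, rfl⟩
    · rintro ⟨x, hx, p, hp, rfl⟩
      exact ⟨_, ⟨x, hx, p, hp, rfl⟩, rfl⟩
  · cases r.q <;> simp [applyA, applyT]

theorem body_vars (h : r.WF P) {e : ℕ × ℕ × ℕ} (he : e ∈ r.body) :
    e.2.1 ∈ r.vars ∧ e.2.2 ∈ r.vars := by
  refine treeOrdered.induction (Q := fun v => v ∈ r.vars) h.1 ?_ ?_ e he
  · simp [vars]
  · intro e he _
    exact List.mem_cons_of_mem _ (List.mem_map_of_mem he)

theorem bodyVar_iff (h : r.WF P) {v : ℕ} : bodyVar (r.toRule P) v ↔ v = 1 ∨ v ∈ r.vars := by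
  constructor
  · rintro ⟨a, ha, hv⟩
    rcases List.mem_cons.1 ha with rfl | ha
    · simp only [atomHasVar, List.mem_cons, Sum.inl.injEq, List.not_mem_nil, or_false] at hv
      rcases hv with rfl | rfl
      · right
        simp [vars]
      · left
        rfl
    · obtain ⟨e, he, rfl⟩ := List.mem_map.1 ha
      simp only [edgeAtom, atomHasVar, List.mem_cons, Sum.inl.injEq, List.not_mem_nil,
        or_false] at hv
      rcases hv with rfl | rfl
      · exact Or.inr (body_vars h he).1
      · exact Or.inr (body_vars h he).2
  · rintro (rfl | hv)
    · exact ⟨_, List.mem_cons_self, by simp [atomHasVar]⟩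
    · rcases List.mem_cons.1 hv with rfl | hv
      · exact ⟨_, List.mem_cons_self, by simp [atomHasVar]⟩
      · obtain ⟨e, he, rfl⟩ := List.mem_map.1 hv
        exact ⟨_, List.mem_cons_of_mem _ (List.mem_map_of_mem he), by simp [atomHasVar, edgeAtom]⟩

theorem vars_not_mem_new (h : r.WF P) {v : ℕ} (hv : v ∈ r.vars) :
    v ∉ r.new ∧ v ≠ 1 ∧ v ≠ 3 := by
  rcases List.mem_cons.1 hv with rfl | hv
  · exact ⟨h.2.2.2.2.1, by simp, by simp⟩
  · obtain ⟨e, he, rfl⟩ := List.mem_map.1 hv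
    have := h.2.1 e he
    exact ⟨this.2.2, by omega, by omega⟩

/-- The existential variables of a rule. -/
def ex (r : GRule) (v : ℕ) : Prop := v ∈ r.new ∨ (r.q = true ∧ v = 3)

theorem not_bodyVar_of_ex (h : r.WF P) {v : ℕ} (hv : r.ex v) : ¬ bodyVar (r.toRule P) v := by
  rw [bodyVar_iff h]
  rintro (rfl | hb)
  · rcases hv with hv | hv
    · exact h.2.2.2.2.2.1 hv
    · simp at hv
  · have := vars_not_mem_new h hb
    rcases hv with hv | hv
    · exact this.1 hv
    · exact this.2.2 hv.2

theorem existVar_iff (h : r.WF P) {v : ℕ} : existVar (r.toRule P) v ↔ r.ex v := by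
  constructor
  · rintro ⟨⟨a, ha, hv⟩, hb⟩
    rw [bodyVar_iff h, not_or] at hb
    have h0 : v ≠ 0 := fun h => hb.2 (by simp [h, vars])
    have h2 : v = 2 → r.ex v := by
      rintro rfl
      exact Or.inl h.2.2.2.1
    simp only [toRule, List.mem_cons, List.mem_append, List.mem_map, List.mem_flatMap] at ha
    rcases ha with rfl | (⟨e, he, rfl⟩ | ⟨x, hx, hp⟩) | ha
    · simp only [atomHasVar, List.mem_cons, Sum.inl.injEq, List.not_mem_nil, or_false] at hv
      grind
    · simp only [edgeAtom, atomHasVar, List.mem_cons, Sum.inl.injEq, List.not_mem_nil,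
        or_false] at hv
      have := h.2.2.1 e he
      rcases hv with rfl | rfl
      · exact Or.inl this.2.1
      · exact Or.inl (this.2.2.resolve_right hb.2)
    · obtain ⟨p, -, rfl⟩ := List.mem_map.1 hp
      simp only [atomHasVar, List.mem_cons, Sum.inl.injEq, List.not_mem_nil, or_false,
        reduceCtorEq, false_or] at hv
      exact Or.inl (hv ▸ hx)
    · split at ha
      · simp only [List.mem_cons, List.not_mem_nil, or_false] at ha
        rcases ha with rfl | rfl <;>
        · simp only [atomHasVar, List.mem_cons, Sum.inl.injEq, List.not_mem_nil, or_false] at hv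
          rcases hv with rfl | rfl <;> first | exact h2 rfl | exact Or.inr ⟨‹_›, rfl⟩ | simp at hb
      · simp only [List.mem_cons, List.not_mem_nil, or_false] at ha
        subst ha
        simp only [atomHasVar, List.mem_cons, Sum.inl.injEq, List.not_mem_nil, or_false] at hv
        grind
  · intro hv
    refine ⟨?_, not_bodyVar_of_ex h hv⟩
    rcases hv with hv | ⟨hq, rfl⟩
    · refine ⟨(2, [Sum.inr star, Sum.inl v]), ?_, by simp [atomHasVar]⟩
      simp only [toRule, List.mem_cons, List.mem_append, List.mem_flatMap, junkAtoms, List.mem_map]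
      exact Or.inr (Or.inl (Or.inr ⟨v, hv, 0, by simp, rfl⟩))
    · refine ⟨(nextP, [Sum.inl 3, Sum.inl 1]), ?_, by simp [atomHasVar]⟩
      simp [toRule, hq]

theorem isRule_toRule : IsRule (r.toRule P) := by
  refine ⟨by simp [toRule], fun a ha => ?_⟩
  simp only [toRule, List.mem_append, List.mem_cons, List.mem_map, List.mem_flatMap, junkAtoms,
    List.mem_range] at ha
  have hcf : ∀ (p x y : ℕ), atomNullFree (p, [Sum.inl x, Sum.inl y]) := by
    intro p x y t ht n
    simp only [List.mem_cons, List.not_mem_nil, or_false] at ht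
    rcases ht with rfl | rfl <;> simp
  rcases ha with (rfl | ⟨e, -, rfl⟩) | rfl | (⟨e, -, rfl⟩ | ⟨x, -, p, -, rfl⟩) | ha
  · exact hcf _ _ _
  · exact hcf _ _ _
  · exact hcf _ _ _
  · exact hcf _ _ _
  · intro t ht n
    simp only [List.mem_cons, List.not_mem_nil, or_false] at ht
    rcases ht with rfl | rfl <;> simp [star]
  · split at ha
    · simp only [List.mem_cons, List.not_mem_nil, or_false] at ha
      rcases ha with rfl | rfl <;> exact hcf _ _ _
    · simp only [List.mem_cons, List.not_mem_nil, or_false] at ha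
      subst ha
      exact hcf _ _ _

end GRule

theorem isRule_brakeRule : IsRule brakeRule := by
  refine ⟨by simp [brakeRule], fun a ha t ht n => ?_⟩
  simp only [brakeRule, List.cons_append, List.nil_append, List.mem_cons, List.not_mem_nil,
    or_false] at ha
  rcases ha with rfl | rfl | rfl <;>
  · simp only [List.mem_cons, List.not_mem_nil, or_false] at ht
    rcases ht with rfl | rfl <;> simp [star]

theorem loaded_brakeRule_iff {σ : ℕ → GroundTerm} {F : Set Fact} :
    loaded (brakeRule, σ) F ↔ ((cfP, [σ 0, σ 1]) : Fact) ∈ F := by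
  simp [loaded, brakeRule, applyA, applyT]

theorem mem_head_brakeRule_iff {σ : ℕ → GroundTerm} {f : Fact} :
    (∃ a ∈ brakeRule.2, f = applyA σ a) ↔ f = (cfP, [star, σ 1]) ∨ f = (nextP, [σ 1, σ 1]) := by
  simp [brakeRule, applyA, applyT]

theorem not_existVar_brakeRule (v : ℕ) : ¬ existVar brakeRule v := by
  rintro ⟨⟨a, ha, hv⟩, hb⟩
  refine hb ⟨_, List.mem_cons_self, ?_⟩
  simp only [brakeRule, List.mem_cons, List.not_mem_nil, or_false] at ha
  rcases ha with rfl | rfl <;> simp [atomHasVar] at hv <;> simp [atomHasVar, hv]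

theorem obsolete_iff_head {r : Rule} {σ : ℕ → GroundTerm} {F : Set Fact} :
    obsolete (r, σ) F ↔ ∃ σ', agreesOnBody (r, σ) σ' ∧
      ∀ f, (∃ a ∈ r.2, f = applyA σ' a) → f ∈ F := by
  refine exists_congr fun σ' => and_congr Iff.rfl ?_
  constructor
  · rintro h f ⟨a, ha, rfl⟩
    exact h a ha
  · intro h a ha
    exact h _ ⟨a, ha, rfl⟩

end ChaseTermination

namespace ChaseTermination
open Relation

/-- A transition system whose states are the roots of graphs over `V` with labelled child
relation `Ch`, transitions being given by graph rewriting rules. -/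
structure RewriteSystem (V : Type) where
  Ch : ℕ → V → V → Prop
  P : ℕ
  rules : List GRule
  wf : ∀ r ∈ rules, r.WF P
  /-- Every match of a body can be extended to the new nodes. -/
  sound : ∀ r ∈ rules, ∀ ν, EdgeSat Ch r.body ν →
    ∃ ν', (∀ v ∉ r.new, ν' v = ν v) ∧ EdgeSat Ch r.head ν'
  /-- All children of new nodes are listed in the head. -/
  complete : ∀ r ∈ rules, ∀ ν, EdgeSat Ch r.body ν → EdgeSat Ch r.head ν →
    ∀ i ∈ r.new, ∀ p b, Ch p (ν i) b → ∃ j, (p, i, j) ∈ r.head ∧ ν j = b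

namespace RewriteSystem

variable {V : Type} (S : RewriteSystem V)

/-- Transitions by recurring (`q = true`) or other (`q = false`) rules. -/
def Trans (q : Bool) (x y : V) : Prop :=
  ∃ r ∈ S.rules, r.q = q ∧ ∃ ν, EdgeSat S.Ch r.body ν ∧ EdgeSat S.Ch r.head ν ∧ ν 0 = x ∧ ν 2 = y

/-- A run segment ending with its first recurring transition. -/
def Seg (x y : V) : Prop := ∃ z, ReflTransGen (S.Trans false) x z ∧ S.Trans true z y

def ruleSet : RuleSet := brakeRule :: S.rules.map (GRule.toRule S.P)

theorem brakeRule_mem : brakeRule ∈ S.ruleSet := List.mem_cons_self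

theorem toRule_mem {r : GRule} (hr : r ∈ S.rules) : r.toRule S.P ∈ S.ruleSet :=
  List.mem_cons_of_mem _ (List.mem_map_of_mem hr)

theorem isRuleSet_ruleSet : IsRuleSet S.ruleSet := by
  intro r hr
  rcases List.mem_cons.1 hr with rfl | hr
  · exact isRule_brakeRule
  · obtain ⟨r, -, rfl⟩ := List.mem_map.1 hr
    exact GRule.isRule_toRule

end RewriteSystem

/-- Facts without semantic content: terms in use are junk children. -/
structure JunkInv (P : ℕ) (F : Set Fact) : Prop where
  star : Junk P F star
  edge : ∀ p x y, ((edgeP p, [x, y]) : Fact) ∈ F → Junk P F x ∧ Junk P F y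
  cf : ∀ t w, ((cfP, [t, w]) : Fact) ∈ F → Junk P F t

/-- Adding the output of a rule preserves the junk invariant. -/
theorem JunkInv.union {P : ℕ} {F : Set Fact} (h : JunkInv P F) {r : GRule} (hr : r.WF P)
    {σ σ' : ℕ → GroundTerm} (hv : ∀ v ∈ r.vars, Junk P F (σ' v)) :
    JunkInv P (F ∪ outputOf (r.toRule P, σ) σ') := by
  have hmem : ∀ f, f ∈ outputOf (r.toRule P, σ) σ' ↔ _ := fun f => GRule.mem_head_iff
  have hsub : F ⊆ F ∪ outputOf (r.toRule P, σ) σ' := Set.subset_union_left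
  have hnew : ∀ v ∈ r.new, Junk P (F ∪ outputOf (r.toRule P, σ) σ') (σ' v) := by
    intro v hv p hp
    exact Or.inr ((hmem _).2 (Or.inr (Or.inr (Or.inl ⟨v, hv, p, hp, rfl⟩))))
  have hold : ∀ v ∈ r.vars, Junk P (F ∪ outputOf (r.toRule P, σ) σ') (σ' v) := fun v h =>
    (hv v h).mono hsub
  refine ⟨h.star.mono hsub, ?_, ?_⟩
  · rintro p x y (hf | hf)
    · exact ⟨(h.edge p x y hf).1.mono hsub, (h.edge p x y hf).2.mono hsub⟩
    · rw [hmem] at hf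
      rcases hf with hf | ⟨e, he, hf⟩ | ⟨v, hv, q, hq, hf⟩ | ⟨-, hf | hf⟩ | ⟨-, hf⟩
      · simp [edgeP, prevP] at hf
      · simp only [Prod.mk.injEq, List.cons.injEq, and_true] at hf
        obtain ⟨-, rfl, rfl⟩ := hf
        exact ⟨hnew _ (hr.2.2.1 e he).2.1, (hr.2.2.1 e he).2.2.elim (hnew _) (hold _)⟩
      · simp only [Prod.mk.injEq, List.cons.injEq, and_true] at hf
        obtain ⟨-, rfl, rfl⟩ := hf
        exact ⟨h.star.mono hsub, hnew _ hv⟩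
      · simp [edgeP, cfP] at hf
      · simp [edgeP, nextP] at hf
      · simp [edgeP, cfP] at hf
  · rintro t w (hf | hf)
    · exact (h.cf t w hf).mono hsub
    · rw [hmem] at hf
      rcases hf with hf | ⟨e, he, hf⟩ | ⟨v, hv, q, hq, hf⟩ | ⟨-, hf | hf⟩ | ⟨-, hf⟩
      · simp [cfP, prevP] at hf
      · simp [edgeP, cfP] at hf
      · simp [cfP] at hf
      · simp only [Prod.mk.injEq, List.cons.injEq, and_true, true_and] at hf
        exact hf.1 ▸ hnew _ hr.2.2.2.1
      · simp [cfP, nextP] at hf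
      · simp only [Prod.mk.injEq, List.cons.injEq, and_true, true_and] at hf
        exact hf.1 ▸ hnew _ hr.2.2.2.1

theorem JunkInv.union_brake {P : ℕ} {F : Set Fact} (h : JunkInv P F) {σ σ' : ℕ → GroundTerm} :
    JunkInv P (F ∪ outputOf (brakeRule, σ) σ') := by
  have hmem : ∀ f, f ∈ outputOf (brakeRule, σ) σ' ↔ _ := fun f => mem_head_brakeRule_iff
  have hsub : F ⊆ F ∪ outputOf (brakeRule, σ) σ' := Set.subset_union_left
  refine ⟨h.star.mono hsub, ?_, ?_⟩
  · rintro p x y (hf | hf)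
    · exact ⟨(h.edge p x y hf).1.mono hsub, (h.edge p x y hf).2.mono hsub⟩
    · rw [hmem] at hf
      simp [edgeP, cfP, nextP] at hf
  · rintro t w (hf | hf)
    · exact (h.cf t w hf).mono hsub
    · rw [hmem] at hf
      simp only [Prod.mk.injEq, List.cons.injEq, and_true, true_and, cfP, nextP, zero_ne_one,
        false_and, or_false] at hf
      exact hf.1 ▸ h.star.mono hsub

theorem JunkInv.vars {P : ℕ} {F : Set Fact} (h : JunkInv P F) {r : GRule}
    {σ : ℕ → GroundTerm} (hl : loaded (r.toRule P, σ) F) : ∀ v ∈ r.vars, Junk P F (σ v) := by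
  rw [GRule.loaded_toRule_iff] at hl
  intro v hv
  rcases List.mem_cons.1 hv with rfl | hv
  · exact h.cf _ _ hl.1
  · obtain ⟨e, he, rfl⟩ := List.mem_map.1 hv
    exact (h.edge _ _ _ (hl.2 e he)).2

/-- Once the brake `w` is pulled, all triggers overseen by `w` are obsolete. -/
theorem JunkInv.obsolete {V : Type} {S : RewriteSystem V} {F : Set Fact} (h : JunkInv S.P F)
    {R : Rule} {σ : ℕ → GroundTerm} (hR : R ∈ S.ruleSet) (hl : loaded (R, σ) F)
    (h1 : ((cfP, [ChaseTermination.star, σ 1]) : Fact) ∈ F)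
    (h2 : ((nextP, [σ 1, σ 1]) : Fact) ∈ F) : obsolete (R, σ) F := by
  rw [obsolete_iff_head]
  rcases List.mem_cons.1 hR with rfl | hR
  · refine ⟨σ, fun _ _ => rfl, fun f hf => ?_⟩
    rw [mem_head_brakeRule_iff] at hf
    rcases hf with rfl | rfl
    · exact h1
    · exact h2
  · obtain ⟨r, hr, rfl⟩ := List.mem_map.1 hR
    have hwf := S.wf r hr
    have hv := h.vars hl
    let σ' : ℕ → GroundTerm := fun v =>
      if v ∈ r.new then ChaseTermination.star else if v = 3 then σ 1 else σ v
    have hnew : ∀ v ∈ r.new, σ' v = ChaseTermination.star := fun v hv => if_pos hv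
    have hold : ∀ v ∈ r.vars, σ' v = σ v := fun v hv => by
      have := GRule.vars_not_mem_new hwf hv
      simp only [σ', if_neg this.1, if_neg this.2.2]
    have hσ1 : σ' 1 = σ 1 := by simp [σ', hwf.2.2.2.2.2.1]
    have hσ3 : σ' 3 = σ 1 := by simp [σ', hwf.2.2.2.2.2.2]
    refine ⟨σ', ?_, fun f hf => ?_⟩
    · intro v hv
      rcases (GRule.bodyVar_iff hwf).1 hv with rfl | hv
      · exact hσ1
      · exact hold v hv
    · have h0 : (0 : ℕ) ∈ r.vars := by simp [GRule.vars]
      rw [GRule.mem_head_iff, hnew 2 hwf.2.2.2.1, hold 0 h0, hσ1, hσ3] at hf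
      rcases hf with rfl | ⟨e, he, rfl⟩ | ⟨v, hv, p, hp, rfl⟩ | ⟨-, rfl | rfl⟩ | ⟨-, rfl⟩
      · exact (hv 0 h0).prev
      · have he' := hwf.2.2.1 e he
        rw [hnew _ he'.2.1]
        rcases he'.2.2 with hn | hn
        · rw [hnew _ hn]
          exact h.star.edge he'.1
        · rw [hold _ hn]
          exact (hv _ hn).edge he'.1
      · rw [hnew v hv]
        exact h.star p hp
      · exact h1
      · exact h2
      · exact h1

theorem exists_update {V : Type} (val : GroundTerm → V) (E : ℕ → Prop) (σ : ℕ → GroundTerm)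
    (ν : ℕ → V) (hinj : ∀ v w, E v → E w → σ v = σ w → v = w) :
    ∃ val' : GroundTerm → V, (∀ v, E v → val' (σ v) = ν v) ∧
      ∀ u, (∀ v, E v → σ v ≠ u) → val' u = val u := by
  classical
  refine ⟨fun u => if h : ∃ v, E v ∧ σ v = u then ν h.choose else val u, ?_, ?_⟩
  · intro v hv
    have h : ∃ v', E v' ∧ σ v' = σ v := ⟨v, hv, rfl⟩
    simp only [dif_pos h]
    rw [hinj _ _ h.choose_spec.1 hv h.choose_spec.2]
  · intro u hu
    exact dif_neg fun ⟨v, hv, h⟩ => hu v hv h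

/-! ### From derivations to runs -/

/-- The facts `F` correctly describe configurations via `val`. -/
structure SimInv {V : Type} (S : RewriteSystem V) (F : Set Fact) (val : GroundTerm → V) :
    Prop where
  junk : JunkInv S.P F
  edge : ∀ p x y, ((edgeP p, [x, y]) : Fact) ∈ F → x ≠ star → S.Ch p (val x) (val y) ∧ y ≠ star
  cf : ∀ t w, ((cfP, [t, w]) : Fact) ∈ F → t ≠ star →
    ReflTransGen (S.Trans false) (val w) (val t)
  next : ∀ w' w, ((nextP, [w', w]) : Fact) ∈ F → w' = w ∨ S.Seg (val w) (val w')
  braked : ∀ w, ((cfP, [star, w]) : Fact) ∈ F → ((nextP, [w, w]) : Fact) ∈ F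

theorem mem_termsOf_left {F : Set Fact} {p : ℕ} {x y : GroundTerm}
    (h : ((p, [x, y]) : Fact) ∈ F) : x ∈ termsOf F := ⟨_, h, by simp⟩

theorem mem_termsOf_right {F : Set Fact} {p : ℕ} {x y : GroundTerm}
    (h : ((p, [x, y]) : Fact) ∈ F) : y ∈ termsOf F := ⟨_, h, by simp⟩

theorem SimInv.exists_step {V : Type} {S : RewriteSystem V} {F : Set Fact}
    {val : GroundTerm → V} (h : SimInv S F val) {tr : Trigger} {σ' : ℕ → GroundTerm}
    (hact : Active S.ruleSet F tr) (hext : properExt tr F σ') :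
    ∃ val' : GroundTerm → V, SimInv S (F ∪ outputOf tr σ') val' ∧
      ∀ u ∈ termsOf F, val' u = val u := by
  obtain ⟨R, σ⟩ := tr
  obtain ⟨hR, hl, hno⟩ := hact
  have hsub : F ⊆ F ∪ outputOf (R, σ) σ' := Set.subset_union_left
  have hag : ∀ v, bodyVar R v → σ' v = σ v := hext.1
  rcases List.mem_cons.1 hR with rfl | hR
  · have hσ1 : σ' 1 = σ 1 := hag 1 ⟨_, List.mem_cons_self, by simp [atomHasVar]⟩
    have hmem : ∀ f, f ∈ outputOf (brakeRule, σ) σ' ↔ _ := fun f => mem_head_brakeRule_iff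
    refine ⟨val, ⟨h.junk.union_brake, ?_, ?_, ?_, ?_⟩, fun _ _ => rfl⟩
    · rintro p x y (hf | hf)
      · exact h.edge p x y hf
      · rw [hmem] at hf
        simp [edgeP, cfP, nextP] at hf
    · rintro t w (hf | hf) ht
      · exact h.cf t w hf ht
      · rw [hmem] at hf
        simp [cfP, nextP, ht] at hf
    · rintro t w (hf | hf)
      · exact h.next t w hf
      · rw [hmem] at hf
        simp only [cfP, nextP, Prod.mk.injEq, one_ne_zero, false_and, List.cons.injEq, and_true,
          true_and, false_or] at hf
        exact Or.inl (hf.1.trans hf.2.symm)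
    · rintro w (hf | hf)
      · exact hsub (h.braked w hf)
      · rw [hmem] at hf
        simp only [cfP, nextP, Prod.mk.injEq, List.cons.injEq, and_true, true_and, zero_ne_one,
          false_and, or_false] at hf
        subst hf
        exact Or.inr ((hmem _).2 (Or.inr rfl))
  · obtain ⟨r, hr, rfl⟩ := List.mem_map.1 hR
    have hwf := S.wf r hr
    have hl' : loaded (r.toRule S.P, σ') F := by
      intro a ha
      have := hl a ha
      rwa [applyA_congr_iff.2 fun v hv => (hag v ⟨a, ha, hv⟩ : σ' v = σ v)]
    have hlj := h.junk.vars hl'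
    rw [GRule.loaded_toRule_iff] at hl'
    have hσ1 : σ' 1 = σ 1 := hag 1 ((GRule.bodyVar_iff hwf).2 (Or.inl rfl))
    have h0 : σ' 0 ≠ star := by
      intro h0
      rw [h0, hσ1] at hl'
      exact hno (h.junk.obsolete (S.toRule_mem hr) hl hl'.1 (h.braked _ hl'.1))
    have hns : ∀ e ∈ r.body, σ' e.2.1 ≠ star ∧ σ' e.2.2 ≠ star := by
      refine treeOrdered.induction (Q := fun v => σ' v ≠ star) hwf.1 ?_ ?_
      · simpa using h0
      · intro e he hx
        exact (h.edge _ _ _ (hl'.2 e he) hx).2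
    have hnsv : ∀ v ∈ r.vars, σ' v ≠ star := by
      intro v hv
      rcases List.mem_cons.1 hv with rfl | hv
      · exact h0
      · obtain ⟨e, he, rfl⟩ := List.mem_map.1 hv
        exact (hns e he).2
    have hterm : ∀ v ∈ r.vars, σ' v ∈ termsOf F := by
      intro v hv
      rcases List.mem_cons.1 hv with rfl | hv
      · exact mem_termsOf_left hl'.1
      · obtain ⟨e, he, rfl⟩ := List.mem_map.1 hv
        exact mem_termsOf_right (hl'.2 e he)
    have hbody : EdgeSat S.Ch r.body (fun v => val (σ' v)) := fun e he =>
      (h.edge _ _ _ (hl'.2 e he) (hns e he).1).1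
    obtain ⟨ν, hν, hsat⟩ := S.sound r hr _ hbody
    have hfresh : ∀ v, r.ex v → ∃ n : ℕ, σ' v = Sum.inr n ∧
        (Sum.inr n : GroundTerm) ∉ termsOf F := fun v hv =>
      hext.2.1 v ((GRule.existVar_iff hwf).2 hv)
    obtain ⟨val', hv1, hv2⟩ := exists_update val r.ex σ' (fun v => if v = 3 then ν 2 else ν v)
      (fun v w hv hw => hext.2.2 v w ((GRule.existVar_iff hwf).2 hv)
        ((GRule.existVar_iff hwf).2 hw))
    have hvF : ∀ u ∈ termsOf F, val' u = val u := by
      intro u hu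
      refine hv2 u fun v hv hvu => ?_
      obtain ⟨n, hn, hnF⟩ := hfresh v hv
      rw [← hvu, hn] at hu
      exact hnF hu
    have hvnew : ∀ v ∈ r.new, val' (σ' v) = ν v := by
      intro v hv
      rw [hv1 v (Or.inl hv), if_neg]
      rintro rfl
      exact hwf.2.2.2.2.2.2 hv
    have hvold : ∀ v ∈ r.vars, val' (σ' v) = ν v := by
      intro v hv
      rw [hvF _ (hterm v hv), hν v (GRule.vars_not_mem_new hwf hv).1]
    have hnsnew : ∀ v ∈ r.new, σ' v ≠ star := by
      intro v hv
      obtain ⟨n, hn, -⟩ := hfresh v (Or.inl hv)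
      simp [hn, star]
    have hmem : ∀ f, f ∈ outputOf (r.toRule S.P, σ) σ' ↔ _ := fun f => GRule.mem_head_iff
    have h0v : (0 : ℕ) ∈ r.vars := by simp [GRule.vars]
    have hw1 : val' (σ' 1) = val (σ' 1) := hvF _ (mem_termsOf_right hl'.1)
    have hreach : ReflTransGen (S.Trans false) (val (σ' 1)) (val (σ' 0)) :=
      h.cf _ _ hl'.1 h0
    have hstep : S.Trans r.q (val (σ' 0)) (ν 2) := by
      refine ⟨r, hr, rfl, ν, ?_, hsat, hν 0 (GRule.vars_not_mem_new hwf h0v).1, rfl⟩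
      intro e he
      have hm := GRule.body_vars hwf he
      rw [hν _ (GRule.vars_not_mem_new hwf hm.1).1, hν _ (GRule.vars_not_mem_new hwf hm.2).1]
      exact hbody e he
    refine ⟨val', ⟨h.junk.union hwf hlj, ?_, ?_, ?_, ?_⟩, hvF⟩
    · rintro p x y (hf | hf) hx
      · rw [hvF x (mem_termsOf_left hf), hvF y (mem_termsOf_right hf)]
        exact h.edge p x y hf hx
      · rw [hmem] at hf
        rcases hf with hf | ⟨e, he, hf⟩ | ⟨v, hv, q, hq, hf⟩ | ⟨-, hf | hf⟩ | ⟨-, hf⟩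
        · simp [edgeP, prevP] at hf
        · simp only [edgeP, Prod.mk.injEq, List.cons.injEq, and_true, Nat.add_right_cancel_iff]
            at hf
          obtain ⟨rfl, rfl, rfl⟩ := hf
          have he' := hwf.2.2.1 e he
          rw [hvnew _ he'.2.1, he'.2.2.elim (hvnew _) (hvold _)]
          exact ⟨hsat e he, he'.2.2.elim (hnsnew _) (hnsv _)⟩
        · simp [hx] at hf
        · simp [edgeP, cfP] at hf
        · simp [edgeP, nextP] at hf
        · simp [edgeP, cfP] at hf
    · rintro t w (hf | hf) ht
      · rw [hvF t (mem_termsOf_left hf), hvF w (mem_termsOf_right hf)]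
        exact h.cf t w hf ht
      · rw [hmem] at hf
        rcases hf with hf | ⟨e, he, hf⟩ | ⟨v, hv, q, hq, hf⟩ | ⟨hq, hf | hf⟩ | ⟨hq, hf⟩
        · simp [cfP, prevP] at hf
        · simp [edgeP, cfP] at hf
        · simp [cfP] at hf
        · simp only [Prod.mk.injEq, List.cons.injEq, and_true, true_and] at hf
          obtain ⟨rfl, rfl⟩ := hf
          rw [hvnew _ hwf.2.2.2.1, hv1 3 (Or.inr ⟨hq, rfl⟩), if_pos rfl]
        · simp [cfP, nextP] at hf
        · simp only [Prod.mk.injEq, List.cons.injEq, and_true, true_and] at hf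
          obtain ⟨rfl, rfl⟩ := hf
          rw [hvnew _ hwf.2.2.2.1, hw1]
          exact hreach.tail (hq ▸ hstep)
    · rintro t w (hf | hf)
      · rw [hvF t (mem_termsOf_left hf), hvF w (mem_termsOf_right hf)]
        exact h.next t w hf
      · rw [hmem] at hf
        rcases hf with hf | ⟨e, he, hf⟩ | ⟨v, hv, q, hq, hf⟩ | ⟨hq, hf | hf⟩ | ⟨hq, hf⟩
        · simp [nextP, prevP] at hf
        · simp [edgeP, nextP] at hf
        · have : (1 : ℕ) = q + 2 := congrArg Prod.fst hf
          omega
        · simp [cfP, nextP] at hf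
        · simp only [Prod.mk.injEq, List.cons.injEq, and_true, true_and] at hf
          obtain ⟨rfl, rfl⟩ := hf
          right
          rw [hv1 3 (Or.inr ⟨hq, rfl⟩), if_pos rfl, hw1]
          exact ⟨_, hreach, hq ▸ hstep⟩
        · simp [cfP, nextP] at hf
    · rintro w (hf | hf)
      · exact hsub (h.braked w hf)
      · rw [hmem] at hf
        have h2s := hnsnew 2 hwf.2.2.2.1
        rcases hf with hf | ⟨e, he, hf⟩ | ⟨v, hv, q, hq, hf⟩ | ⟨hq, hf | hf⟩ | ⟨hq, hf⟩
        · simp [cfP, prevP] at hf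
        · simp [edgeP, cfP] at hf
        · simp [cfP] at hf
        · simp only [Prod.mk.injEq, List.cons.injEq, and_true, true_and] at hf
          exact absurd hf.1.symm h2s
        · simp [cfP, nextP] at hf
        · simp only [Prod.mk.injEq, List.cons.injEq, and_true, true_and] at hf
          exact absurd hf.1.symm h2s

end ChaseTermination

namespace ChaseTermination
open Relation

namespace RewriteSystem

variable {V : Type} {S : RewriteSystem V} {R : Rule}

theorem exists_cf_of_loaded (hR : R ∈ S.ruleSet) {σ : ℕ → GroundTerm} {F : Set Fact}
    (hl : loaded (R, σ) F) : ((cfP, [σ 0, σ 1]) : Fact) ∈ F := by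
  rcases List.mem_cons.1 hR with rfl | hR
  · exact loaded_brakeRule_iff.1 hl
  · obtain ⟨r, hr, rfl⟩ := List.mem_map.1 hR
    exact (GRule.loaded_toRule_iff.1 hl).1

theorem bodyVar_one (hR : R ∈ S.ruleSet) : bodyVar R 1 := by
  rcases List.mem_cons.1 hR with rfl | hR
  · exact ⟨_, List.mem_cons_self, by simp [atomHasVar]⟩
  · obtain ⟨r, hr, rfl⟩ := List.mem_map.1 hR
    exact (GRule.bodyVar_iff (S.wf r hr)).2 (Or.inl rfl)

theorem cf_output (hR : R ∈ S.ruleSet) {σ σ' : ℕ → GroundTerm} {t w : GroundTerm}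
    (hf : ((cfP, [t, w]) : Fact) ∈ outputOf (R, σ) σ') :
    w = σ' 1 ∨ ((nextP, [w, σ' 1]) : Fact) ∈ outputOf (R, σ) σ' := by
  rcases List.mem_cons.1 hR with rfl | hR
  · have := mem_head_brakeRule_iff.1 hf
    simp [cfP, nextP] at this
    exact Or.inl this.2
  · obtain ⟨r, hr, rfl⟩ := List.mem_map.1 hR
    have h := GRule.mem_head_iff.1 hf
    rcases h with hf | ⟨e, he, hf⟩ | ⟨v, hv, q, hq, hf⟩ | ⟨hq, hf | hf⟩ | ⟨hq, hf⟩
    · simp [cfP, prevP] at hf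
    · simp [edgeP, cfP] at hf
    · simp [cfP] at hf
    · right
      simp only [Prod.mk.injEq, List.cons.injEq, and_true, true_and] at hf
      rw [hf.2]
      exact GRule.mem_head_iff.2 (Or.inr (Or.inr (Or.inr (Or.inl ⟨hq, Or.inr rfl⟩))))
    · simp [cfP, nextP] at hf
    · simp only [Prod.mk.injEq, List.cons.injEq, and_true, true_and] at hf
      exact Or.inl hf.2

theorem next_output (hR : R ∈ S.ruleSet) {σ σ' : ℕ → GroundTerm} {w' w : GroundTerm}
    (hf : ((nextP, [w', w]) : Fact) ∈ outputOf (R, σ) σ') :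
    w = σ' 1 ∧ (w' = w ∨ w' = σ' 3) := by
  rcases List.mem_cons.1 hR with rfl | hR
  · have := mem_head_brakeRule_iff.1 hf
    simp [cfP, nextP] at this
    exact ⟨this.2, Or.inl (this.1.trans this.2.symm)⟩
  · obtain ⟨r, hr, rfl⟩ := List.mem_map.1 hR
    have h := GRule.mem_head_iff.1 hf
    rcases h with hf | ⟨e, he, hf⟩ | ⟨v, hv, q, hq, hf⟩ | ⟨hq, hf | hf⟩ | ⟨hq, hf⟩
    · simp [nextP, prevP] at hf
    · simp [edgeP, nextP] at hf
    · have : (1 : ℕ) = q + 2 := congrArg Prod.fst hf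
      omega
    · simp [cfP, nextP] at hf
    · simp only [Prod.mk.injEq, List.cons.injEq, and_true, true_and] at hf
      exact ⟨hf.2, Or.inr hf.1⟩
    · simp [cfP, nextP] at hf

end RewriteSystem

/-- König's lemma in the form needed: if infinitely many objects are placed at nodes
reachable from `a`, but only finitely many at each node, and the graph is finitely branching,
then there is an infinite path. -/
theorem exists_path_of_infinite {α : Type*} {r : α → α → Prop} {β : ℕ → α} {a : α}
    (ha : {j | ReflTransGen r a (β j)}.Infinite) (hfib : ∀ x, {j | β j = x}.Finite)
    (hbr : ∀ x, {y | r x y}.Finite) : ∃ ω : ℕ → α, ω 0 = a ∧ ∀ i, r (ω i) (ω (i + 1)) := by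
  have step : ∀ x : {x // {j | ReflTransGen r x (β j)}.Infinite},
      ∃ y : {x // {j | ReflTransGen r x (β j)}.Infinite}, r x.1 y.1 := by
    rintro ⟨x, hx⟩
    by_contra! hno
    refine hx (((hfib x).union ((hbr x).biUnion (t := fun y => {j | ReflTransGen r y (β j)})
      fun y hy => ?_)).subset ?_)
    · by_contra hinf
      exact hno ⟨y, hinf⟩ hy
    · intro j hj
      rcases ReflTransGen.cases_head hj with h | ⟨y, hxy, hy⟩
      · exact Or.inl h.symm
      · right
        simp only [Set.mem_iUnion]
        exact ⟨y, hxy, hy⟩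
  choose f hf using step
  refine ⟨fun i => (f^[i] ⟨a, ha⟩).1, rfl, fun i => ?_⟩
  show r (f^[i] ⟨a, ha⟩).1 (f^[i + 1] ⟨a, ha⟩).1
  rw [Function.iterate_succ_apply']
  exact hf _

theorem Chase.fact_mono {S : RuleSet} {D : Set Fact} (c : Chase S D) : Monotone c.fact := by
  refine monotone_nat_of_le_succ fun i => ?_
  by_cases h : (i : ℕ∞) < c.len
  · rw [c.succ i h]
    exact Set.subset_union_left
  · rw [c.stall i h]

/-- An infinite fair derivation yields an infinite run through infinitely many recurring
transitions. -/
theorem RewriteSystem.exists_run_of_chase {V : Type} {S : RewriteSystem V} {D : Set Fact}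
    (c : Chase S.ruleSet D) (hinf : IsInfinite c) (hfair : Fair c) {val : GroundTerm → V}
    (h0 : SimInv S D val) {w0 : GroundTerm}
    (hw0 : ∀ t w, ((cfP, [t, w]) : Fact) ∈ D → w = w0)
    (hnext : ∀ w' w, ((nextP, [w', w]) : Fact) ∉ D) (hw0D : w0 ∈ termsOf D) :
    ∃ ρ : ℕ → V, ρ 0 = val w0 ∧ ∀ i, S.Seg (ρ i) (ρ (i + 1)) := by
  classical
  have hlt : ∀ i : ℕ, (i : ℕ∞) < c.len := fun i => by rw [hinf]; exact ENat.natCast_lt_top i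
  have hstep : ∀ i (v : {v // SimInv S (c.fact i) v}), ∃ v' : {v // SimInv S (c.fact (i + 1)) v},
      ∀ u ∈ termsOf (c.fact i), v'.1 u = v.1 u := by
    rintro i ⟨v, hv⟩
    obtain ⟨v', h1, h2⟩ := hv.exists_step (c.activeAt i (hlt i)) (c.extOk i (hlt i))
    rw [← c.succ i (hlt i)] at h1
    exact ⟨⟨v', h1⟩, h2⟩
  choose next hnx using hstep
  let vals : ∀ i, {v // SimInv S (c.fact i) v} := fun i =>
    Nat.rec ⟨val, by rw [c.init]; exact h0⟩ (fun i v => next i v) i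
  have hmonoT : ∀ i j, i ≤ j → termsOf (c.fact i) ⊆ termsOf (c.fact j) := by
    rintro i j hij u ⟨f, hf, hu⟩
    exact ⟨f, c.fact_mono hij hf, hu⟩
  have hvals : ∀ i j, i ≤ j → ∀ u ∈ termsOf (c.fact i), (vals j).1 u = (vals i).1 u := by
    intro i j hij
    induction j, hij using Nat.le_induction with
    | base => exact fun _ _ => rfl
    | succ j hij ih =>
      intro u hu
      rw [← ih u hu]
      exact hnx j (vals j) u (hmonoT i j hij hu)
  let gval : GroundTerm → V := fun u =>
    if h : ∃ i, u ∈ termsOf (c.fact i) then (vals h.choose).1 u else val u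
  have hg : ∀ i, ∀ u ∈ termsOf (c.fact i), gval u = (vals i).1 u := by
    intro i u hu
    have h : ∃ i, u ∈ termsOf (c.fact i) := ⟨i, hu⟩
    simp only [gval, dif_pos h]
    rcases le_total i h.choose with hle | hle
    · exact hvals _ _ hle u hu
    · exact (hvals _ _ hle u h.choose_spec).symm
  let β : ℕ → GroundTerm := fun i => (c.trig i).2 1
  have hβ : ∀ i, c.ext i 1 = β i := fun i =>
    (c.extOk i (hlt i)).1 1 (RewriteSystem.bodyVar_one (c.activeAt i (hlt i)).1)
  have hcf : ∀ i, ((cfP, [(c.trig i).2 0, β i]) : Fact) ∈ c.fact i := fun i =>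
    RewriteSystem.exists_cf_of_loaded (c.activeAt i (hlt i)).1 (c.activeAt i (hlt i)).2.1
  let Child : GroundTerm → GroundTerm → Prop := fun w w' =>
    w' ≠ w ∧ ∃ i, ((nextP, [w', w]) : Fact) ∈ c.fact i
  have hreach : ∀ i t w, ((cfP, [t, w]) : Fact) ∈ c.fact i → ReflTransGen Child w0 w := by
    intro i
    induction i with
    | zero =>
      intro t w h
      rw [c.init] at h
      rw [hw0 t w h]
    | succ i ih =>
      intro t w h
      have h' := h
      rw [c.succ i (hlt i)] at h'
      rcases h' with h' | h'
      · exact ih t w h'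
      · have hi := ih _ _ (hcf i)
        rcases RewriteSystem.cf_output (c.activeAt i (hlt i)).1 h' with h2 | h2
        · rw [h2, hβ]
          exact hi
        · rw [hβ] at h2
          by_cases hw : w = β i
          · rw [hw]
            exact hi
          · refine hi.tail ⟨hw, i + 1, ?_⟩
            rw [c.succ i (hlt i)]
            exact Or.inr h2
  have hchild : ∀ i w' w, ((nextP, [w', w]) : Fact) ∈ c.fact i → w' ≠ w →
      ∃ j, β j = w ∧ c.ext j 3 = w' := by
    intro i
    induction i with
    | zero =>
      intro w' w h
      rw [c.init] at h
      exact absurd h (hnext _ _)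
    | succ i ih =>
      intro w' w h hne
      rw [c.succ i (hlt i)] at h
      rcases h with h | h
      · exact ih _ _ h hne
      · obtain ⟨h1, h2⟩ := RewriteSystem.next_output (c.activeAt i (hlt i)).1 h
        exact ⟨i, by rw [h1, hβ], (h2.resolve_left hne).symm⟩
  have hfib : ∀ w, {j | β j = w}.Finite := by
    intro w
    rcases Set.eq_empty_or_nonempty {j | β j = w} with he | ⟨j0, hj0⟩
    · rw [he]
      exact Set.finite_empty
    · obtain ⟨j, -, hj⟩ := hfair (brakeRule, (c.trig j0).2) S.brakeRule_mem j0
        (loaded_brakeRule_iff.2 (hcf j0))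
      obtain ⟨σ', hag, hh⟩ := obsolete_iff_head.1 hj
      have h1 : σ' 1 = w :=
        (hag 1 (RewriteSystem.bodyVar_one S.brakeRule_mem)).trans hj0
      have hs := hh _ (mem_head_brakeRule_iff.2 (Or.inl rfl))
      rw [h1] at hs
      refine (Set.finite_Iio j).subset fun i hi => ?_
      by_contra hij
      have hji : j ≤ i := not_lt.1 hij
      have hs' := c.fact_mono hji hs
      have hact := c.activeAt i (hlt i)
      have hi' : (c.trig i).2 1 = w := hi
      refine hact.2.2 ((vals i).2.junk.obsolete hact.1 hact.2.1 ?_ ?_)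
      · rw [hi']
        exact hs'
      · rw [hi']
        exact (vals i).2.braked w hs'
  obtain ⟨ω, hω0, hω⟩ := exists_path_of_infinite (r := Child) (β := β) (a := w0)
    (by
      have : {j | ReflTransGen Child w0 (β j)} = Set.univ :=
        Set.eq_univ_of_forall fun j => hreach j _ _ (hcf j)
      rw [this]
      exact Set.infinite_univ) hfib
    (fun w => ((hfib w).image fun j => c.ext j 3).subset (by
      rintro w' ⟨hne, i, hi⟩
      exact hchild i w' w hi hne))
  refine ⟨fun i => gval (ω i), ?_, fun i => ?_⟩
  · simp only [hω0]
    exact hg 0 w0 (by rw [c.init]; exact hw0D)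
  · obtain ⟨hne, j, hj⟩ := hω i
    simp only
    rw [hg j _ (mem_termsOf_right hj), hg j _ (mem_termsOf_left hj)]
    exact ((vals j).2.next _ _ hj).resolve_left hne

end ChaseTermination

namespace ChaseTermination
open Relation

/-! ### From runs to derivations -/

theorem exists_path_of_transGen {α : Type} {r : α → α → Prop} {a b : α} (h : TransGen r a b) :
    ∃ (p : ℕ → α) (k : ℕ), p 0 = a ∧ p (k + 1) = b ∧ ∀ i ≤ k, r (p i) (p (i + 1)) := by
  induction h using TransGen.head_induction_on with
  | @single a h =>
    refine ⟨fun i => if i = 0 then a else b, 0, rfl, rfl, fun i hi => ?_⟩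
    obtain rfl : i = 0 := by omega
    simpa using h
  | @head a _ h _ ih =>
    obtain ⟨p, k, h0, hk, hp⟩ := ih
    refine ⟨fun i => Nat.casesOn i a p, k + 1, rfl, hk, fun i hi => ?_⟩
    cases i with
    | zero =>
      rw [← h0] at h
      exact h
    | succ i => exact hp i (by omega)

/-- Infinitely many nonempty finite paths can be concatenated. -/
theorem exists_concat_of_transGen {α : Type} {r : α → α → Prop} {g : ℕ → α}
    (h : ∀ n, TransGen r (g n) (g (n + 1))) :
    ∃ f : ℕ → α, f 0 = g 0 ∧ (∀ i, r (f i) (f (i + 1))) ∧ ∀ n, ∃ m ≥ n, f m = g n := by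
  choose p k h0 hk hp using fun n => exists_path_of_transGen (h n)
  let step : ℕ × ℕ → ℕ × ℕ := fun s => if s.2 < k s.1 then (s.1, s.2 + 1) else (s.1 + 1, 0)
  let st : ℕ → ℕ × ℕ := fun i => step^[i] (0, 0)
  have hst : ∀ i, st (i + 1) = step (st i) := fun i => Function.iterate_succ_apply' _ _ _
  have hle : ∀ i, (st i).2 ≤ k (st i).1 := by
    intro i
    induction i with
    | zero => exact Nat.zero_le _
    | succ i ih =>
      rw [hst]
      simp only [step]
      split
      · simp only
        omega
      · exact Nat.zero_le _
  have hrun : ∀ n i j, st i = (n, 0) → j ≤ k n → st (i + j) = (n, j) := by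
    intro n i j hi
    induction j with
    | zero => exact fun _ => hi
    | succ j ih =>
      intro hj
      rw [← Nat.add_assoc, hst, ih (by omega)]
      exact if_pos (by simp only; omega)
  refine ⟨fun i => p (st i).1 (st i).2, h0 0, fun i => ?_, fun n => ?_⟩
  · have hi := hle i
    simp only [hst]
    by_cases hlt : (st i).2 < k (st i).1
    · simp only [step, if_pos hlt]
      exact hp _ _ hi
    · have heq : (st i).2 = k (st i).1 := by omega
      simp only [step, if_neg hlt]
      rw [h0, ← hk, ← heq]
      exact hp _ _ hi
  · have : ∃ m ≥ n, st m = (n, 0) := by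
      induction n with
      | zero => exact ⟨0, le_rfl, rfl⟩
      | succ n ih =>
        obtain ⟨m, hm, hs⟩ := ih
        refine ⟨m + k n + 1, by omega, ?_⟩
        rw [hst, hrun n m (k n) hs le_rfl]
        simp [step]
    obtain ⟨m, hm, hs⟩ := this
    exact ⟨m, hm, by simp only [hs]; exact h0 n⟩

theorem exists_chase_of_steps {R : RuleSet} {f : ℕ → Set Fact}
    (h : ∀ i, ChaseStep R (f i) (f (i + 1))) :
    ∃ c : Chase R (f 0), IsInfinite c ∧ c.fact = f := by
  choose tr hact ext hext hf using h
  exact ⟨{ len := ⊤, fact := f, trig := tr, ext := ext, init := rfl, activeAt := fun i _ => hact i,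
           extOk := fun i _ => hext i, succ := fun i _ => hf i,
           stall := fun i hi => absurd (ENat.natCast_lt_top i) hi }, rfl, rfl⟩

namespace RewriteSystem

variable {V : Type} (S : RewriteSystem V)

/-- The fact set `F` allows for simulating a run from the configuration `x`, which is
represented by the term `t` and overseen by the brake `w`. All other brakes are pulled. -/
structure Live (F : Set Fact) (x : V) (t w : GroundTerm) : Prop where
  finite : F.Finite
  junk : JunkInv S.P F
  cf : ((cfP, [t, w]) : Fact) ∈ F
  prev : ∀ z, ((prevP, [z, t]) : Fact) ∈ F → z = star
  unbraked : ((cfP, [star, w]) : Fact) ∉ F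
  next : ∀ w', ((nextP, [w', w]) : Fact) ∉ F
  dead : ∀ u v, ((cfP, [u, v]) : Fact) ∈ F → v ≠ w →
    ((cfP, [star, v]) : Fact) ∈ F ∧ ((nextP, [v, v]) : Fact) ∈ F
  full : ∃ (val : GroundTerm → V) (L : Set GroundTerm), L ⊆ termsOf F ∧ t ∈ L ∧ val t = x ∧
    ∀ u ∈ L, ∀ p b, S.Ch p (val u) b →
      ∃ u' ∈ L, val u' = b ∧ ((edgeP p, [u, u']) : Fact) ∈ F

variable {S}

theorem exists_match {F : Set Fact} {val : GroundTerm → V} {L : Set GroundTerm}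
    (hL : ∀ u ∈ L, ∀ p b, S.Ch p (val u) b →
      ∃ u' ∈ L, val u' = b ∧ ((edgeP p, [u, u']) : Fact) ∈ F) {ν : ℕ → V} :
    ∀ (l : List (ℕ × ℕ × ℕ)) (K : List ℕ) (σ : ℕ → GroundTerm), treeOrdered K l →
      (∀ v ∈ K, σ v ∈ L ∧ val (σ v) = ν v) → EdgeSat S.Ch l ν →
      ∃ σ' : ℕ → GroundTerm, (∀ v ∈ K, σ' v = σ v) ∧ ∀ e ∈ l, σ' e.2.2 ∈ L ∧
        val (σ' e.2.2) = ν e.2.2 ∧ ((edgeP e.1, [σ' e.2.1, σ' e.2.2]) : Fact) ∈ F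
  | [], _, σ, _, _, _ => ⟨σ, fun _ _ => rfl, by simp⟩
  | e :: l, K, σ, ht, hσ, hs => by
    obtain ⟨h1, h2, h3⟩ := ht
    have hc := hs e List.mem_cons_self
    rw [← (hσ _ h1).2] at hc
    obtain ⟨u, hu, huv, huF⟩ := hL _ (hσ _ h1).1 _ _ hc
    have hK : ∀ v ∈ K, Function.update σ e.2.2 u v = σ v := fun v hv =>
      Function.update_of_ne (fun h : v = e.2.2 => h2 (h ▸ hv)) _ _
    obtain ⟨σ', ha, hb⟩ := exists_match hL l (e.2.2 :: K) (Function.update σ e.2.2 u) h3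
      (by
        intro v hv
        rcases List.mem_cons.1 hv with rfl | hv
        · simp [hu, huv]
        · rw [hK v hv]
          exact hσ v hv)
      (fun e he => hs e (List.mem_cons_of_mem _ he))
    have hu' : σ' e.2.2 = u := by
      rw [ha _ List.mem_cons_self, Function.update_self]
    refine ⟨σ', fun v hv => (ha v (List.mem_cons_of_mem _ hv)).trans (hK v hv), fun d hd => ?_⟩
    rcases List.mem_cons.1 hd with rfl | hd
    · rw [hu', ha _ (List.mem_cons_of_mem _ h1), hK _ h1]
      exact ⟨hu, huv, huF⟩
    · exact hb d hd

theorem finite_outputOf (t : Trigger) (σ : ℕ → GroundTerm) : (outputOf t σ).Finite := by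
  refine ((List.finite_toSet t.1.2).image (applyA σ)).subset ?_
  rintro f ⟨a, ha, rfl⟩
  exact ⟨a, ha, rfl⟩

theorem exists_fresh {F : Set Fact} (hF : F.Finite) :
    ∃ N : ℕ, ∀ n, N ≤ n → (Sum.inr n : GroundTerm) ∉ termsOf F := by
  have hfin : (termsOf F).Finite := by
    refine (hF.biUnion fun f _ => List.finite_toSet f.2).subset ?_
    rintro g ⟨f, hf, hg⟩
    simp only [Set.mem_iUnion]
    exact ⟨f, hf, hg⟩
  obtain ⟨N, hN⟩ := (hfin.preimage (f := (Sum.inr : ℕ → GroundTerm))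
    Sum.inr_injective.injOn).bddAbove
  exact ⟨N + 1, fun n hn h => by have := hN h; omega⟩

/-- Applying a graph rewriting rule. -/
theorem Live.exists_trigger {F : Set Fact} {x : V} {t w : GroundTerm} (h : S.Live F x t w)
    {r : GRule} (hr : r ∈ S.rules) {ν : ℕ → V} (hb : EdgeSat S.Ch r.body ν)
    (hh : EdgeSat S.Ch r.head ν) (h0 : ν 0 = x) :
    ∃ σ : ℕ → GroundTerm, σ 0 = t ∧ σ 1 = w ∧ Active S.ruleSet F (r.toRule S.P, σ) ∧
      properExt (r.toRule S.P, σ) F σ ∧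
      (∀ v, v ∈ r.new ∨ v = 3 → (∃ n, σ v = Sum.inr n) ∧ σ v ∉ termsOf F) ∧
      ∃ (val : GroundTerm → V) (L : Set GroundTerm),
        L ⊆ termsOf (F ∪ outputOf (r.toRule S.P, σ) σ) ∧ σ 2 ∈ L ∧ val (σ 2) = ν 2 ∧
        ∀ u ∈ L, ∀ p b, S.Ch p (val u) b → ∃ u' ∈ L, val u' = b ∧
          ((edgeP p, [u, u']) : Fact) ∈ F ∪ outputOf (r.toRule S.P, σ) σ := by
  classical
  obtain ⟨val, L, hLF, htL, htx, hL⟩ := h.full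
  have hwf := S.wf r hr
  obtain ⟨τ, hτ0, hτ⟩ := exists_match hL r.body [0] (fun _ => t) hwf.1 (by
    intro v hv
    obtain rfl := List.mem_singleton.1 hv
    exact ⟨htL, htx.trans h0.symm⟩) hb
  have hτ0 : τ 0 = t := hτ0 0 (by simp)
  obtain ⟨N, hN⟩ := exists_fresh h.finite
  let σ : ℕ → GroundTerm := fun v =>
    if v ∈ r.new ∨ v = 3 then Sum.inr (N + v) else if v = 1 then w else τ v
  have hnew : ∀ v, v ∈ r.new ∨ v = 3 → σ v = Sum.inr (N + v) := fun v hv => if_pos hv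
  have hvars : ∀ v ∈ r.vars, σ v = τ v := by
    intro v hv
    have := GRule.vars_not_mem_new hwf hv
    simp [σ, this.1, this.2.1, this.2.2]
  have hσ0 : σ 0 = t := (hvars 0 (by simp [GRule.vars])).trans hτ0
  have hσ1 : σ 1 = w := by simp [σ, hwf.2.2.2.2.2.1]
  have hfresh : ∀ v, v ∈ r.new ∨ v = 3 → (∃ n, σ v = Sum.inr n) ∧ σ v ∉ termsOf F := by
    intro v hv
    rw [hnew v hv]
    exact ⟨⟨_, rfl⟩, hN _ (by omega)⟩
  have hvL : ∀ v ∈ r.vars, σ v ∈ L ∧ val (σ v) = ν v := by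
    intro v hv
    rw [hvars v hv]
    rcases List.mem_cons.1 hv with rfl | hv
    · rw [hτ0, htx, h0]
      exact ⟨htL, rfl⟩
    · obtain ⟨e, he, rfl⟩ := List.mem_map.1 hv
      exact ⟨(hτ e he).1, (hτ e he).2.1⟩
  have hload : loaded (r.toRule S.P, σ) F := by
    rw [GRule.loaded_toRule_iff, hσ0, hσ1]
    refine ⟨h.cf, fun e he => ?_⟩
    have := GRule.body_vars hwf he
    rw [hvars _ this.1, hvars _ this.2]
    exact (hτ e he).2.2
  have hex : ∀ v, r.ex v → v ∈ r.new ∨ v = 3 := fun v hv => hv.imp id fun h => h.2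
  have hinj : ∀ v v', v ∈ r.new ∨ v = 3 → v' ∈ r.new ∨ v' = 3 → σ v = σ v' → v = v' := by
    intro v v' hv hv' he
    rw [hnew v hv, hnew v' hv'] at he
    have := Sum.inr_injective he
    omega
  refine ⟨σ, hσ0, hσ1, ⟨S.toRule_mem hr, hload, ?_⟩, ⟨fun _ _ => rfl, ?_, ?_⟩, hfresh, ?_⟩
  · rw [obsolete_iff_head]
    rintro ⟨σ', hag, hF⟩
    have h0' : σ' 0 = t := (hag 0 ((GRule.bodyVar_iff hwf).2 (by simp [GRule.vars]))).trans hσ0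
    have h1' : σ' 1 = w := (hag 1 ((GRule.bodyVar_iff hwf).2 (Or.inl rfl))).trans hσ1
    have hp := hF _ (GRule.mem_head_iff.2 (Or.inl rfl))
    rw [h0'] at hp
    have h2 := h.prev _ hp
    cases hq : r.q
    · have hc := hF _ (GRule.mem_head_iff.2 (Or.inr (Or.inr (Or.inr (Or.inr ⟨hq, rfl⟩)))))
      rw [h2, h1'] at hc
      exact h.unbraked hc
    · have hc := hF _ (GRule.mem_head_iff.2
        (Or.inr (Or.inr (Or.inr (Or.inl ⟨hq, Or.inr rfl⟩)))))
      rw [h1'] at hc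
      exact h.next _ hc
  · intro v hv
    obtain ⟨⟨n, hn⟩, hnF⟩ := hfresh v (hex v ((GRule.existVar_iff hwf).1 hv))
    exact ⟨n, hn, hn ▸ hnF⟩
  · intro v v' hv hv'
    exact hinj v v' (hex v ((GRule.existVar_iff hwf).1 hv)) (hex v' ((GRule.existVar_iff hwf).1 hv'))
  · obtain ⟨val', hv1, hv2⟩ := exists_update val (· ∈ r.new) σ ν
      (fun v v' hv hv' => hinj v v' (Or.inl hv) (Or.inl hv'))
    have hold : ∀ u ∈ L, val' u = val u := fun u hu => hv2 u fun v hv hvu =>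
      (hfresh v (Or.inl hv)).2 (hvu ▸ hLF hu)
    have hsub : F ⊆ F ∪ outputOf (r.toRule S.P, σ) σ := Set.subset_union_left
    refine ⟨val', L ∪ σ '' {v | v ∈ r.new}, ?_, Or.inr ⟨2, hwf.2.2.2.1, rfl⟩,
      hv1 2 hwf.2.2.2.1, ?_⟩
    · rintro u (hu | ⟨v, hv, rfl⟩)
      · obtain ⟨f, hf, hu⟩ := hLF hu
        exact ⟨f, hsub hf, hu⟩
      · refine mem_termsOf_right (p := 0 + 2) (x := star) (Or.inr ?_)
        exact GRule.mem_head_iff.2 (Or.inr (Or.inr (Or.inl ⟨v, hv, 0, by omega, rfl⟩)))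
    · rintro u (hu | ⟨v, hv, rfl⟩) p b hc
      · rw [hold u hu] at hc
        obtain ⟨u', hu', hb', he⟩ := hL u hu p b hc
        exact ⟨u', Or.inl hu', (hold u' hu').trans hb', hsub he⟩
      · rw [hv1 v hv] at hc
        obtain ⟨j, hj, hjb⟩ := S.complete r hr ν hb hh v hv p b hc
        have hmem : ((edgeP p, [σ v, σ j]) : Fact) ∈ outputOf (r.toRule S.P, σ) σ :=
          GRule.mem_head_iff.2 (Or.inr (Or.inl ⟨_, hj, rfl⟩))
        refine ⟨σ j, ?_, ?_, Or.inr hmem⟩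
        · rcases (hwf.2.2.1 _ hj).2.2 with hn | hn
          · exact Or.inr ⟨j, hn, rfl⟩
          · exact Or.inl (hvL j hn).1
        · rw [← hjb]
          rcases (hwf.2.2.1 _ hj).2.2 with hn | hn
          · exact hv1 j hn
          · rw [hold _ (hvL j hn).1]
            exact (hvL j hn).2

theorem Live.exists_step {F : Set Fact} {x y : V} {t w : GroundTerm} (h : S.Live F x t w)
    (hxy : S.Trans false x y) : ∃ F' t', ChaseStep S.ruleSet F F' ∧ S.Live F' y t' w := by
  obtain ⟨r, hr, hq, ν, hb, hh, h0, rfl⟩ := hxy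
  obtain ⟨σ, hσ0, hσ1, hact, hext, hfresh, hfull⟩ := h.exists_trigger hr hb hh h0
  have hwf := S.wf r hr
  have hmem : ∀ f, f ∈ outputOf (r.toRule S.P, σ) σ ↔ _ := fun f => GRule.mem_head_iff
  have hsub : F ⊆ F ∪ outputOf (r.toRule S.P, σ) σ := Set.subset_union_left
  obtain ⟨⟨n2, hn2⟩, h2F⟩ := hfresh 2 (Or.inl hwf.2.2.2.1)
  have htF := mem_termsOf_left h.cf
  have h2s : σ 2 ≠ star := by simp [hn2, star]
  refine ⟨_, σ 2, ⟨_, hact, σ, hext, rfl⟩, h.finite.union (finite_outputOf _ _),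
    h.junk.union hwf (h.junk.vars hact.2.1), ?_, ?_, ?_, ?_, ?_, hfull⟩
  · refine Or.inr ((hmem _).2 (Or.inr (Or.inr (Or.inr (Or.inr ⟨hq, ?_⟩)))))
    rw [hσ1]
  · rintro z (hz | hz)
    · exact absurd (mem_termsOf_right hz) h2F
    · rw [hmem] at hz
      rcases hz with hf | ⟨e, he, hf⟩ | ⟨v, hv, p, hp, hf⟩ | ⟨hq', hf⟩ | ⟨-, hf⟩
      · simp only [Prod.mk.injEq, List.cons.injEq, and_true, true_and] at hf
        rw [hf.2, hσ0] at h2F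
        exact absurd htF h2F
      · simp [edgeP, prevP] at hf
      · simp only [Prod.mk.injEq, List.cons.injEq] at hf
        exact hf.2.1
      · simp [hq] at hq'
      · simp [cfP, prevP] at hf
  · rintro (hz | hz)
    · exact h.unbraked hz
    · rw [hmem] at hz
      rcases hz with hf | ⟨e, he, hf⟩ | ⟨v, hv, p, hp, hf⟩ | ⟨hq', hf⟩ | ⟨-, hf⟩
      · simp [cfP, prevP] at hf
      · simp [edgeP, cfP] at hf
      · simp [cfP] at hf
      · simp [hq] at hq'
      · simp [h2s.symm] at hf
  · rintro w' (hz | hz)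
    · exact h.next _ hz
    · rw [hmem] at hz
      rcases hz with hf | ⟨e, he, hf⟩ | ⟨v, hv, p, hp, hf⟩ | ⟨hq', hf⟩ | ⟨-, hf⟩
      · simp [nextP, prevP] at hf
      · simp [edgeP, nextP] at hf
      · have : (1 : ℕ) = p + 2 := congrArg Prod.fst hf
        omega
      · simp [hq] at hq'
      · simp [nextP, cfP] at hf
  · rintro u v (hz | hz) hvw
    · exact ⟨hsub (h.dead u v hz hvw).1, hsub (h.dead u v hz hvw).2⟩
    · rw [hmem] at hz
      rcases hz with hf | ⟨e, he, hf⟩ | ⟨v, hv, p, hp, hf⟩ | ⟨hq', hf⟩ | ⟨-, hf⟩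
      · simp [cfP, prevP] at hf
      · simp [edgeP, cfP] at hf
      · simp [cfP] at hf
      · simp [hq] at hq'
      · simp [hσ1, hvw] at hf

theorem Live.exists_recurring_step {F : Set Fact} {x y : V} {t w : GroundTerm}
    (h : S.Live F x t w) (hxy : S.Trans true x y) :
    ∃ F' t' w', TransGen (ChaseStep S.ruleSet) F F' ∧ S.Live F' y t' w' ∧ w' ≠ w := by
  obtain ⟨r, hr, hq, ν, hb, hh, h0, rfl⟩ := hxy
  obtain ⟨σ, hσ0, hσ1, hact, hext, hfresh, val, L, hL1, hL2, hL3, hL4⟩ :=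
    h.exists_trigger hr hb hh h0
  have hwf := S.wf r hr
  have hmem : ∀ f, f ∈ outputOf (r.toRule S.P, σ) σ ↔ _ := fun f => GRule.mem_head_iff
  have hmem' : ∀ f, f ∈ outputOf (brakeRule, σ) σ ↔ _ := fun f => mem_head_brakeRule_iff
  set F1 := F ∪ outputOf (r.toRule S.P, σ) σ with hF1
  have hsub : F ⊆ F1 := Set.subset_union_left
  have hsub' : F1 ⊆ F1 ∪ outputOf (brakeRule, σ) σ := Set.subset_union_left
  obtain ⟨⟨n2, hn2⟩, h2F⟩ := hfresh 2 (Or.inl hwf.2.2.2.1)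
  obtain ⟨⟨n3, hn3⟩, h3F⟩ := hfresh 3 (Or.inr rfl)
  have htF := mem_termsOf_left h.cf
  have hwF := mem_termsOf_right h.cf
  have h2s : σ 2 ≠ star := by simp [hn2, star]
  have h3w : σ 3 ≠ w := fun h => h3F (h ▸ hwF)
  have hstar : ∀ v, ((cfP, [star, v]) : Fact) ∈ F1 → ((cfP, [star, v]) : Fact) ∈ F := by
    rintro v (hz | hz)
    · exact hz
    · rw [hmem] at hz
      rcases hz with hf | ⟨e, he, hf⟩ | ⟨v, hv, p, hp, hf⟩ | ⟨-, hf | hf⟩ | ⟨hq', hf⟩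
      · simp [cfP, prevP] at hf
      · simp [edgeP, cfP] at hf
      · simp [cfP] at hf
      · simp [h2s.symm] at hf
      · simp [cfP, nextP] at hf
      · simp [hq] at hq'
  have hact' : Active S.ruleSet F1 (brakeRule, σ) := by
    refine ⟨S.brakeRule_mem, loaded_brakeRule_iff.2 ?_, ?_⟩
    · rw [hσ0, hσ1]
      exact hsub h.cf
    · rw [obsolete_iff_head]
      rintro ⟨σ', hag, hF⟩
      have h1' : σ' 1 = w := (hag 1 ⟨_, List.mem_cons_self, by simp [atomHasVar]⟩).trans hσ1
      have := hF _ (mem_head_brakeRule_iff.2 (Or.inl rfl))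
      rw [h1'] at this
      exact h.unbraked (hstar _ this)
  have hext' : properExt (brakeRule, σ) F1 σ :=
    ⟨fun _ _ => rfl, fun v hv => absurd hv (not_existVar_brakeRule v),
      fun v _ hv => absurd hv (not_existVar_brakeRule v)⟩
  refine ⟨F1 ∪ outputOf (brakeRule, σ) σ, σ 2, σ 3,
    (TransGen.single ⟨_, hact, σ, hext, rfl⟩).tail ⟨_, hact', σ, hext', rfl⟩,
    ⟨(h.finite.union (finite_outputOf _ _)).union (finite_outputOf _ _),
      (h.junk.union hwf (h.junk.vars hact.2.1)).union_brake, ?_, ?_, ?_, ?_, ?_, ?_⟩, h3w⟩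
  · exact hsub' (Or.inr ((hmem _).2 (Or.inr (Or.inr (Or.inr (Or.inl ⟨hq, Or.inl rfl⟩))))))
  · rintro z ((hz | hz) | hz)
    · exact absurd (mem_termsOf_right hz) h2F
    · rw [hmem] at hz
      rcases hz with hf | ⟨e, he, hf⟩ | ⟨v, hv, p, hp, hf⟩ | ⟨-, hf | hf⟩ | ⟨hq', hf⟩
      · simp only [Prod.mk.injEq, List.cons.injEq, and_true, true_and] at hf
        rw [hf.2, hσ0] at h2F
        exact absurd htF h2F
      · simp [edgeP, prevP] at hf
      · simp only [Prod.mk.injEq, List.cons.injEq] at hf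
        exact hf.2.1
      · simp [cfP, prevP] at hf
      · simp [nextP, prevP] at hf
      · simp [cfP, prevP] at hf
    · rw [hmem'] at hz
      simp [cfP, nextP, prevP] at hz
  · rintro (hz | hz)
    · exact h3F (mem_termsOf_right (hstar _ hz))
    · rw [hmem', hσ1] at hz
      simp [cfP, nextP, h3w] at hz
  · rintro w' ((hz | hz) | hz)
    · exact h3F (mem_termsOf_right hz)
    · rw [hmem] at hz
      rcases hz with hf | ⟨e, he, hf⟩ | ⟨v, hv, p, hp, hf⟩ | ⟨-, hf | hf⟩ | ⟨hq', hf⟩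
      · simp [nextP, prevP] at hf
      · simp [edgeP, nextP] at hf
      · have : (1 : ℕ) = p + 2 := congrArg Prod.fst hf
        omega
      · simp [cfP, nextP] at hf
      · simp [hσ1, h3w] at hf
      · simp [hq] at hq'
    · rw [hmem', hσ1] at hz
      simp [cfP, nextP, h3w] at hz
  · have hw : ((cfP, [star, w]) : Fact) ∈ F1 ∪ outputOf (brakeRule, σ) σ ∧
        ((nextP, [w, w]) : Fact) ∈ F1 ∪ outputOf (brakeRule, σ) σ := by
      constructor
      · exact Or.inr ((hmem' _).2 (Or.inl (by rw [hσ1])))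
      · exact Or.inr ((hmem' _).2 (Or.inr (by rw [hσ1])))
    intro u v hz hv3
    by_cases hvw : v = w
    · exact hvw ▸ hw
    · rcases hz with (hz | hz) | hz
      · exact ⟨hsub' (hsub (h.dead u v hz hvw).1), hsub' (hsub (h.dead u v hz hvw).2)⟩
      · rw [hmem] at hz
        rcases hz with hf | ⟨e, he, hf⟩ | ⟨v, hv, p, hp, hf⟩ | ⟨-, hf | hf⟩ | ⟨hq', hf⟩
        · simp [cfP, prevP] at hf
        · simp [edgeP, cfP] at hf
        · simp [cfP] at hf
        · simp [hv3] at hf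
        · simp [cfP, nextP] at hf
        · simp [hq] at hq'
      · rw [hmem', hσ1] at hz
        simp [cfP, nextP, hvw] at hz
  · refine ⟨val, L, ?_, hL2, hL3, fun u hu p b hc => ?_⟩
    · intro u hu
      obtain ⟨f, hf, huf⟩ := hL1 hu
      exact ⟨f, hsub' hf, huf⟩
    · obtain ⟨u', h1, h2, h3⟩ := hL4 u hu p b hc
      exact ⟨u', h1, h2, hsub' h3⟩

theorem Live.exists_seg {F : Set Fact} {x y : V} {t w : GroundTerm}
    (h : S.Live F x t w) (hxy : S.Seg x y) :
    ∃ F' t' w', TransGen (ChaseStep S.ruleSet) F F' ∧ S.Live F' y t' w' ∧ w' ≠ w := by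
  obtain ⟨z, hxz, hzy⟩ := hxy
  induction hxz using ReflTransGen.head_induction_on generalizing F t with
  | refl => exact h.exists_recurring_step hzy
  | head hab _ ih =>
    obtain ⟨F1, t1, hs, h1⟩ := h.exists_step hab
    obtain ⟨F', t', w', h2, h3, h4⟩ := ih h1
    exact ⟨F', t', w', h2.head hs, h3, h4⟩

/-- An infinite run through infinitely many recurring transitions yields an infinite fair
derivation. -/
theorem Live.exists_chase {D : Set Fact} {ρ : ℕ → V} {t w : GroundTerm}
    (h : S.Live D (ρ 0) t w) (hρ : ∀ i, S.Seg (ρ i) (ρ (i + 1))) :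
    ∃ c : Chase S.ruleSet D, IsInfinite c ∧ Fair c := by
  let X : ℕ → Type := fun n =>
    {s : Set Fact × GroundTerm × GroundTerm // S.Live s.1 (ρ n) s.2.1 s.2.2}
  have hX : ∀ n (s : X n), ∃ s' : X (n + 1),
      TransGen (ChaseStep S.ruleSet) s.1.1 s'.1.1 ∧ s'.1.2.2 ≠ s.1.2.2 := by
    rintro n ⟨⟨F, t, w⟩, hs⟩
    obtain ⟨F', t', w', h1, h2, h3⟩ := hs.exists_seg (hρ n)
    exact ⟨⟨⟨F', t', w'⟩, h2⟩, h1, h3⟩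
  choose next hstep hne using hX
  let s : ∀ n, X n := fun n => Nat.rec ⟨⟨D, t, w⟩, h⟩ (fun n s => next n s) n
  obtain ⟨f, hf0, hf, hfG⟩ := exists_concat_of_transGen (g := fun n => (s n).1.1)
    fun n => hstep n (s n)
  have hf0 : f 0 = D := hf0
  subst hf0
  obtain ⟨c, hinf, hc⟩ := exists_chase_of_steps hf
  refine ⟨c, hinf, ?_⟩
  rintro ⟨R, σ⟩ hR i hl
  obtain ⟨m, hm, n, hmn, hw⟩ : ∃ m, i ≤ m ∧ ∃ n, c.fact m = (s n).1.1 ∧ (s n).1.2.2 ≠ σ 1 := by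
    obtain ⟨m1, hm1, h1⟩ := hfG i
    obtain ⟨m2, hm2, h2⟩ := hfG (i + 1)
    by_cases hw : (s i).1.2.2 = σ 1
    · exact ⟨m2, by omega, i + 1, by rw [hc, h2], fun h' => hne i (s i) (h'.trans hw.symm)⟩
    · exact ⟨m1, hm1, i, by rw [hc, h1], hw⟩
  have hl' : loaded (R, σ) (c.fact m) := fun a ha => c.fact_mono hm (hl a ha)
  refine ⟨m, hm, ?_⟩
  rw [hmn] at hl' ⊢
  have hd := (s n).2.dead _ _ (exists_cf_of_loaded hR hl') hw.symm
  exact (s n).2.junk.obsolete hR hl' hd.1 hd.2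

end RewriteSystem

end ChaseTermination

namespace ChaseTermination
open Relation

/-- The constant denoting node `i` of the initial graph. -/
def node (i : ℕ) : GroundTerm := Sum.inl (i + 2)

/-- The brake of the database. -/
def initialBrake : GroundTerm := Sum.inl 1

/-- The database for a finite graph on the nodes `0, …, N - 1` with start configuration `t`. -/
def graphDb (P : ℕ) (edges : List (ℕ × ℕ × ℕ)) (N t : ℕ) : Database :=
  (cfP, [node t, initialBrake]) ::
    (edges.map (fun e => (edgeP e.1, [node e.2.1, node e.2.2])) ++
      (List.range (N + 2)).flatMap fun i =>
        (List.range (P + 1)).map fun p => (p + 2, [star, Sum.inl i]))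

theorem mem_graphDb {P : ℕ} {edges : List (ℕ × ℕ × ℕ)} {N t : ℕ} {f : Fact} :
    f ∈ dbSet (graphDb P edges N t) ↔ f = (cfP, [node t, initialBrake]) ∨
      (∃ e ∈ edges, f = (edgeP e.1, [node e.2.1, node e.2.2])) ∨
      ∃ i < N + 2, ∃ p < P + 1, f = (p + 2, [star, Sum.inl i]) := by
  simp [dbSet, graphDb, eq_comm]

theorem isDatabase_graphDb {P : ℕ} {edges : List (ℕ × ℕ × ℕ)} {N t : ℕ} :
    IsDatabase (graphDb P edges N t) := by
  intro f hf u hu n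
  rcases mem_graphDb.1 hf with rfl | ⟨e, -, rfl⟩ | ⟨i, -, p, -, rfl⟩ <;>
  · simp only [List.mem_cons, List.not_mem_nil, or_false] at hu
    rcases hu with rfl | rfl <;> simp [node, initialBrake, star]

theorem junk_graphDb {P : ℕ} {edges : List (ℕ × ℕ × ℕ)} {N t i : ℕ} (hi : i < N + 2) :
    Junk P (dbSet (graphDb P edges N t)) (Sum.inl i) := fun p hp =>
  mem_graphDb.2 (Or.inr (Or.inr ⟨i, hi, p, hp, rfl⟩))

namespace RewriteSystem

variable {V : Type} (S : RewriteSystem V)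

/-- The chase of the database of a finite graph that is correctly labelled by `val` is
universally terminating iff no run visits infinitely many recurring transitions. -/
theorem tkrAll_graphDb_iff {edges : List (ℕ × ℕ × ℕ)} {N t : ℕ} (val : ℕ → V)
    (hsound : ∀ e ∈ edges,
      e.1 < S.P ∧ e.2.1 < N ∧ e.2.2 < N ∧ S.Ch e.1 (val e.2.1) (val e.2.2))
    (hcomplete : ∀ i < N, ∀ p b, S.Ch p (val i) b → ∃ j, (p, i, j) ∈ edges ∧ val j = b)
    (ht : t < N) :
    TKRall (S.ruleSet, graphDb S.P edges N t) ↔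
      ¬ ∃ ρ : ℕ → V, ρ 0 = val t ∧ ∀ i, S.Seg (ρ i) (ρ (i + 1)) := by
  set D := dbSet (graphDb S.P edges N t) with hD
  let gval : GroundTerm → V := Sum.elim (fun k => if k < 2 then val t else val (k - 2))
    fun _ => val t
  have hnode : ∀ i, gval (node i) = val i := by
    intro i
    simp [gval, node]
  have hns : ∀ i, node i ≠ star := by
    intro i
    simp [node, star]
  have hbs : initialBrake ≠ star := by simp [initialBrake, star]
  have hcf : ∀ u w, ((cfP, [u, w]) : Fact) ∈ D → u = node t ∧ w = initialBrake := by
    intro u w hf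
    rcases mem_graphDb.1 hf with hf | ⟨e, -, hf⟩ | ⟨i, -, p, -, hf⟩
    · simpa using hf
    · simp [edgeP, cfP] at hf
    · simp [cfP] at hf
  have hnext : ∀ w' w, ((nextP, [w', w]) : Fact) ∉ D := by
    intro w' w hf
    rcases mem_graphDb.1 hf with hf | ⟨e, -, hf⟩ | ⟨i, -, p, -, hf⟩
    · simp [cfP, nextP] at hf
    · simp [edgeP, nextP] at hf
    · have : (1 : ℕ) = p + 2 := congrArg Prod.fst hf
      omega
  have hedge : ∀ p x y, ((edgeP p, [x, y]) : Fact) ∈ D → x ≠ star →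
      ∃ e ∈ edges, p = e.1 ∧ x = node e.2.1 ∧ y = node e.2.2 := by
    intro p x y hf hx
    rcases mem_graphDb.1 hf with hf | ⟨e, he, hf⟩ | ⟨i, -, p, -, hf⟩
    · simp [edgeP, cfP] at hf
    · simp only [edgeP, Prod.mk.injEq, List.cons.injEq, and_true, Nat.add_right_cancel_iff] at hf
      exact ⟨e, he, hf⟩
    · simp [hx] at hf
  have hjunk : JunkInv S.P D := by
    refine ⟨junk_graphDb (by omega), fun p x y hf => ?_, fun u w hf => ?_⟩
    · rcases mem_graphDb.1 hf with hf | ⟨e, he, hf⟩ | ⟨i, hi, p, -, hf⟩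
      · simp [edgeP, cfP] at hf
      · simp only [Prod.mk.injEq, List.cons.injEq, and_true] at hf
        obtain ⟨-, rfl, rfl⟩ := hf
        have := hsound e he
        exact ⟨junk_graphDb (by omega), junk_graphDb (by omega)⟩
      · simp only [Prod.mk.injEq, List.cons.injEq, and_true] at hf
        obtain ⟨-, rfl, rfl⟩ := hf
        exact ⟨junk_graphDb (by omega), junk_graphDb hi⟩
    · rw [(hcf u w hf).1]
      exact junk_graphDb (by omega)
  have hmem0 : ((cfP, [node t, initialBrake]) : Fact) ∈ D := mem_graphDb.2 (Or.inl rfl)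
  have hgb : gval initialBrake = val t := by simp [gval, initialBrake]
  refine (and_iff_right ⟨S.isRuleSet_ruleSet, isDatabase_graphDb⟩).trans (not_congr ⟨?_, ?_⟩)
  · rintro ⟨c, hinf, hfair⟩
    rw [← hgb]
    refine exists_run_of_chase c hinf hfair (val := gval) (w0 := initialBrake)
      ⟨hjunk, ?_, ?_, fun w' w h => absurd h (hnext w' w), ?_⟩
      (fun u w h => (hcf u w h).2) hnext (mem_termsOf_right hmem0)
    · intro p x y hf hx
      obtain ⟨e, he, rfl, rfl, rfl⟩ := hedge p x y hf hx
      rw [hnode, hnode]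
      exact ⟨(hsound e he).2.2.2, hns _⟩
    · intro u w hf _
      obtain ⟨rfl, rfl⟩ := hcf u w hf
      rw [hgb, hnode]
    · intro w hf
      exact absurd (hcf _ _ hf).1.symm (hns _)
  · rintro ⟨ρ, h0, hρ⟩
    refine Live.exists_chase (S := S) (t := node t) (w := initialBrake) ⟨List.finite_toSet _,
      hjunk, hmem0, ?_, fun h => hns t (hcf _ _ h).1.symm, fun w' => hnext w' _,
      fun u v h hv => absurd (hcf u v h).2 hv, gval, node '' {i | i < N}, ?_, ⟨t, ht, rfl⟩, ?_, ?_⟩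
      hρ
    · intro z hf
      rcases mem_graphDb.1 hf with hf | ⟨e, -, hf⟩ | ⟨i, -, p, -, hf⟩
      · simp [cfP, prevP] at hf
      · simp [edgeP, prevP] at hf
      · simp only [Prod.mk.injEq, List.cons.injEq] at hf
        exact hf.2.1
    · rintro _ ⟨i, hi, rfl⟩
      have hi : i < N := hi
      exact mem_termsOf_right (junk_graphDb (P := S.P) (show i + 2 < N + 2 by omega) 0 (by omega))
    · rw [hnode, h0]
    · rintro _ ⟨i, hi, rfl⟩ p b hc
      rw [hnode] at hc
      obtain ⟨j, hj, hb⟩ := hcomplete i hi p b hc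
      have := hsound _ hj
      exact ⟨node j, ⟨j, this.2.2.1, rfl⟩, (hnode j).trans hb,
        mem_graphDb.2 (Or.inr (Or.inl ⟨_, hj, rfl⟩))⟩

end RewriteSystem

end ChaseTermination

namespace ChaseTermination
open Relation Turing.ToPartrec

/-! ### Running a partial recursive function on guessed inputs -/

/-- The nodes of the graphs describing computations: data, and configurations evaluating a code,
returning a value to a continuation, or guessing the first argument of a function. -/
inductive Val : Type
  | nat : ℕ → Val
  | list : List ℕ → Val
  | code : Code → Val
  | cont : Cont → Val
  | norm : Code → Cont → List ℕ → Val
  | ret : Cont → List ℕ → Val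
  | guess : ℕ → ℕ → Val

open Val in
/-- The labelled child relation on nodes. -/
inductive Child (c₀ : Code) : ℕ → Val → Val → Prop
  | isZero : Child c₀ 0 (nat 0) (nat 0)
  | pred (n) : Child c₀ 1 (nat (n + 1)) (nat n)
  | headNil : Child c₀ 2 (list []) (nat 0)
  | headCons (h t) : Child c₀ 2 (list (h :: t)) (nat h)
  | tailNil : Child c₀ 3 (list []) (list [])
  | tailCons (h t) : Child c₀ 3 (list (h :: t)) (list t)
  | nonemptyTail (h t) : Child c₀ 4 (list (h :: t)) (list t)
  | codeZero : Child c₀ 5 (code .zero') (nat 0)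
  | codeSucc : Child c₀ 6 (code .succ) (list [])
  | codeTail : Child c₀ 7 (code .tail) (nat 0)
  | codeCons₁ (f g) : Child c₀ 8 (code (.cons f g)) (code f)
  | codeCons₂ (f g) : Child c₀ 9 (code (.cons f g)) (code g)
  | codeComp₁ (f g) : Child c₀ 10 (code (.comp f g)) (code f)
  | codeComp₂ (f g) : Child c₀ 11 (code (.comp f g)) (code g)
  | codeCase₁ (f g) : Child c₀ 12 (code (.case f g)) (code f)
  | codeCase₂ (f g) : Child c₀ 13 (code (.case f g)) (code g)
  | codeFix (f) : Child c₀ 14 (code (.fix f)) (code f)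
  | haltZero : Child c₀ 15 (cont .halt) (nat 0)
  | haltNil : Child c₀ 16 (cont .halt) (list [])
  | haltCode : Child c₀ 17 (cont .halt) (code c₀)
  | cons₁Code (f v k) : Child c₀ 18 (cont (.cons₁ f v k)) (code f)
  | cons₁List (f v k) : Child c₀ 19 (cont (.cons₁ f v k)) (list v)
  | cons₁Cont (f v k) : Child c₀ 20 (cont (.cons₁ f v k)) (cont k)
  | cons₂List (v k) : Child c₀ 21 (cont (.cons₂ v k)) (list v)
  | cons₂Cont (v k) : Child c₀ 22 (cont (.cons₂ v k)) (cont k)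
  | compCode (f k) : Child c₀ 23 (cont (.comp f k)) (code f)
  | compCont (f k) : Child c₀ 24 (cont (.comp f k)) (cont k)
  | fixCode (f k) : Child c₀ 25 (cont (.fix f k)) (code f)
  | fixCont (f k) : Child c₀ 26 (cont (.fix f k)) (cont k)
  | normCode (c k v) : Child c₀ 27 (norm c k v) (code c)
  | normCont (c k v) : Child c₀ 28 (norm c k v) (cont k)
  | normList (c k v) : Child c₀ 29 (norm c k v) (list v)
  | retCont (k v) : Child c₀ 30 (ret k v) (cont k)
  | retList (k v) : Child c₀ 31 (ret k v) (list v)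
  | guessNat (n s) : Child c₀ 32 (guess n s) (nat n)
  | guessState (n s) : Child c₀ 33 (guess n s) (nat s)
  | guessHalt (n s) : Child c₀ 34 (guess n s) (cont .halt)

theorem Child.head (c₀ : Code) (l : List ℕ) : Child c₀ 2 (.list l) (.nat l.headI) := by
  cases l <;> constructor

theorem Child.tail (c₀ : Code) (l : List ℕ) : Child c₀ 3 (.list l) (.list l.tail) := by
  cases l <;> constructor

/-- The node assigned to a variable by a list of nodes. -/
def asg (l : List Val) (i : ℕ) : Val := l.getD i (.nat 0)

/-- A graph rewriting rule with a parametrization of its matches. -/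
structure Move (c₀ : Code) where
  rule : GRule
  Param : Type
  nodes : Param → List Val
  exists_of_body : ∀ ν, EdgeSat (Child c₀) rule.body ν →
      ∃ a, ∀ v ∈ rule.vars, ν v = asg (nodes a) v := by
    intro ν h
    simp only [EdgeSat, List.forall_mem_cons, List.not_mem_nil, false_imp_iff, implies_true,
      and_true, GRule.vars, List.map_cons, List.map_nil] at h ⊢
    try generalize ν 0 = x0 at h ⊢
    try generalize ν 2 = x2 at h ⊢
    try generalize ν 4 = x4 at h ⊢
    try generalize ν 5 = x5 at h ⊢
    try generalize ν 6 = x6 at h ⊢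
    try generalize ν 7 = x7 at h ⊢
    try generalize ν 8 = x8 at h ⊢
    try generalize ν 9 = x9 at h ⊢
    try generalize ν 10 = x10 at h ⊢
    try generalize ν 11 = x11 at h ⊢
    casesm* _ ∧ _, Child _ _ _ _
    all_goals first
      | (refine ⟨(?_, ?_, ?_, ?_, ?_), ?_⟩; on_goal 6 => and_intros <;> rfl)
      | (refine ⟨(?_, ?_, ?_, ?_), ?_⟩; on_goal 5 => and_intros <;> rfl)
      | (refine ⟨(?_, ?_, ?_, ⟨?_, ?_⟩), ?_⟩; on_goal 6 => and_intros <;> rfl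
         rfl)
      | (refine ⟨(?_, ?_, ?_), ?_⟩; on_goal 4 => and_intros <;> rfl)
      | (refine ⟨(?_, ?_, ⟨?_, ?_⟩), ?_⟩; on_goal 5 => and_intros <;> rfl
         rfl)
      | (refine ⟨(?_, ?_), ?_⟩; on_goal 3 => and_intros <;> rfl)
  exists_of_head : ∀ ν, EdgeSat (Child c₀) rule.body ν → EdgeSat (Child c₀) rule.head ν →
      ∃ a, ∀ v, v ∈ rule.vars ∨ v ∈ rule.new → ν v = asg (nodes a) v := by
    intro ν h h'
    simp only [EdgeSat, List.forall_mem_cons, List.not_mem_nil, false_imp_iff, implies_true,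
      and_true, GRule.vars, List.map_cons, List.map_nil, or_imp, forall_and] at h h' ⊢
    try generalize ν 0 = x0 at h h' ⊢
    try generalize ν 2 = x2 at h h' ⊢
    try generalize ν 4 = x4 at h h' ⊢
    try generalize ν 5 = x5 at h h' ⊢
    try generalize ν 6 = x6 at h h' ⊢
    try generalize ν 7 = x7 at h h' ⊢
    try generalize ν 8 = x8 at h h' ⊢
    try generalize ν 9 = x9 at h h' ⊢
    try generalize ν 10 = x10 at h h' ⊢
    try generalize ν 11 = x11 at h h' ⊢
    casesm* _ ∧ _, Child _ _ _ _
    all_goals first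
      | (refine ⟨(?_, ?_, ?_, ?_, ?_), ?_⟩; on_goal 6 => and_intros <;> rfl)
      | (refine ⟨(?_, ?_, ?_, ?_), ?_⟩; on_goal 5 => and_intros <;> rfl)
      | (refine ⟨(?_, ?_, ?_, ⟨?_, ?_⟩), ?_⟩; on_goal 6 => and_intros <;> rfl
         rfl)
      | (refine ⟨(?_, ?_, ?_), ?_⟩; on_goal 4 => and_intros <;> rfl)
      | (refine ⟨(?_, ?_, ⟨?_, ?_⟩), ?_⟩; on_goal 5 => and_intros <;> rfl
         rfl)
      | (refine ⟨(?_, ?_), ?_⟩; on_goal 3 => and_intros <;> rfl)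
  body : ∀ a, EdgeSat (Child c₀) rule.body (asg (nodes a)) := by
    intro a
    simp only [EdgeSat, List.forall_mem_cons, List.not_mem_nil, false_imp_iff, implies_true,
      and_true]
    and_intros <;> first | constructor | exact Child.head _ _ | exact Child.tail _ _
  head : ∀ a, EdgeSat (Child c₀) rule.head (asg (nodes a)) := by
    intro a
    simp only [EdgeSat, List.forall_mem_cons, List.not_mem_nil, false_imp_iff, implies_true,
      and_true]
    and_intros <;> first | constructor | exact Child.head _ _ | exact Child.tail _ _
  complete : ∀ a, ∀ i ∈ rule.new, ∀ p b, Child c₀ p (asg (nodes a) i) b →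
      ∃ j, (p, i, j) ∈ rule.head ∧ asg (nodes a) j = b := by
    intro a i hi p b hc
    simp only [List.mem_cons, List.not_mem_nil, or_false] at hi
    (try casesm* _ ∨ _) <;> subst i <;> cases hc <;> exact ⟨_, by simp; rfl, rfl⟩
  wf : rule.WF 35 := by decide

namespace Move

variable (c₀ : Code)

def evalZero : Move c₀ where
  rule := ⟨[(27, 0, 4), (28, 0, 5), (29, 0, 6), (5, 4, 7)],
    [(30, 2, 5), (31, 2, 8), (2, 8, 7), (3, 8, 6), (4, 8, 6)], [2, 8], false⟩
  Param := Cont × List ℕ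
  nodes := fun (k, v) => [.norm .zero' k v, .nat 0, .ret k (0 :: v), .nat 0, .code .zero',
    .cont k, .list v, .nat 0, .list (0 :: v)]

def evalSucc : Move c₀ where
  rule := ⟨[(27, 0, 4), (28, 0, 5), (29, 0, 6), (6, 4, 7), (2, 6, 8)],
    [(30, 2, 5), (31, 2, 9), (2, 9, 10), (3, 9, 7), (4, 9, 7), (1, 10, 8)], [2, 9, 10], false⟩
  Param := Cont × List ℕ
  nodes := fun (k, v) => [.norm .succ k v, .nat 0, .ret k [v.headI + 1], .nat 0, .code .succ,
    .cont k, .list v, .list [], .nat v.headI, .list [v.headI + 1], .nat (v.headI + 1)]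

def evalTail : Move c₀ where
  rule := ⟨[(27, 0, 4), (28, 0, 5), (29, 0, 6), (7, 4, 7), (3, 6, 8)],
    [(30, 2, 5), (31, 2, 8)], [2], false⟩
  Param := Cont × List ℕ
  nodes := fun (k, v) => [.norm .tail k v, .nat 0, .ret k v.tail, .nat 0, .code .tail, .cont k,
    .list v, .nat 0, .list v.tail]

def evalCons : Move c₀ where
  rule := ⟨[(27, 0, 4), (28, 0, 5), (29, 0, 6), (8, 4, 7), (9, 4, 8)],
    [(27, 2, 7), (28, 2, 9), (29, 2, 6), (18, 9, 8), (19, 9, 6), (20, 9, 5)], [2, 9], false⟩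
  Param := Code × Code × Cont × List ℕ
  nodes := fun (f, g, k, v) => [.norm (.cons f g) k v, .nat 0, .norm f (.cons₁ g v k) v, .nat 0,
    .code (.cons f g), .cont k, .list v, .code f, .code g, .cont (.cons₁ g v k)]

def evalComp : Move c₀ where
  rule := ⟨[(27, 0, 4), (28, 0, 5), (29, 0, 6), (10, 4, 7), (11, 4, 8)],
    [(27, 2, 8), (28, 2, 9), (29, 2, 6), (23, 9, 7), (24, 9, 5)], [2, 9], false⟩
  Param := Code × Code × Cont × List ℕ
  nodes := fun (f, g, k, v) => [.norm (.comp f g) k v, .nat 0, .norm g (.comp f k) v, .nat 0,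
    .code (.comp f g), .cont k, .list v, .code f, .code g, .cont (.comp f k)]

def evalCaseZero : Move c₀ where
  rule := ⟨[(27, 0, 4), (28, 0, 5), (29, 0, 6), (12, 4, 7), (2, 6, 8), (0, 8, 9), (3, 6, 10)],
    [(27, 2, 7), (28, 2, 5), (29, 2, 10)], [2], false⟩
  Param := Code × Code × Cont × {v : List ℕ // v.headI = 0}
  nodes := fun (f, g, k, ⟨v, _⟩) => [.norm (.case f g) k v, .nat 0, .norm f k v.tail, .nat 0,
    .code (.case f g), .cont k, .list v, .code f, .nat 0, .nat 0, .list v.tail]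
  body := by
    rintro ⟨f, g, k, v, hv⟩
    simp only [EdgeSat, List.forall_mem_cons, List.not_mem_nil, false_imp_iff, implies_true,
      and_true]
    cases v <;> and_intros <;> first | constructor | (cases hv; constructor)

def evalCaseSucc : Move c₀ where
  rule := ⟨[(27, 0, 4), (28, 0, 5), (29, 0, 6), (13, 4, 7), (2, 6, 8), (1, 8, 9), (3, 6, 10)],
    [(27, 2, 7), (28, 2, 5), (29, 2, 11), (2, 11, 9), (3, 11, 10), (4, 11, 10)], [2, 11], false⟩
  Param := Code × Code × Cont × ℕ × List ℕ
  nodes := fun (f, g, k, y, t) => [.norm (.case f g) k ((y + 1) :: t), .nat 0,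
    .norm g k (y :: t), .nat 0, .code (.case f g), .cont k, .list ((y + 1) :: t), .code g,
    .nat (y + 1), .nat y, .list t, .list (y :: t)]

def evalFix : Move c₀ where
  rule := ⟨[(27, 0, 4), (28, 0, 5), (29, 0, 6), (14, 4, 7)],
    [(27, 2, 7), (28, 2, 8), (29, 2, 6), (25, 8, 7), (26, 8, 5)], [2, 8], false⟩
  Param := Code × Cont × List ℕ
  nodes := fun (f, k, v) => [.norm (.fix f) k v, .nat 0, .norm f (.fix f k) v, .nat 0,
    .code (.fix f), .cont k, .list v, .code f, .cont (.fix f k)]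

def retCons₁ : Move c₀ where
  rule := ⟨[(30, 0, 4), (31, 0, 5), (18, 4, 6), (19, 4, 7), (20, 4, 8)],
    [(27, 2, 6), (28, 2, 9), (29, 2, 7), (21, 9, 5), (22, 9, 8)], [2, 9], false⟩
  Param := Code × List ℕ × Cont × List ℕ
  nodes := fun (g, u, k, v) => [.ret (.cons₁ g u k) v, .nat 0, .norm g (.cons₂ v k) u, .nat 0,
    .cont (.cons₁ g u k), .list v, .code g, .list u, .cont k, .cont (.cons₂ v k)]

def retCons₂ : Move c₀ where
  rule := ⟨[(30, 0, 4), (31, 0, 5), (21, 4, 6), (22, 4, 7), (2, 6, 8)],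
    [(30, 2, 7), (31, 2, 9), (2, 9, 8), (3, 9, 5), (4, 9, 5)], [2, 9], false⟩
  Param := List ℕ × Cont × List ℕ
  nodes := fun (u, k, v) => [.ret (.cons₂ u k) v, .nat 0, .ret k (u.headI :: v), .nat 0,
    .cont (.cons₂ u k), .list v, .list u, .cont k, .nat u.headI, .list (u.headI :: v)]

def retComp : Move c₀ where
  rule := ⟨[(30, 0, 4), (31, 0, 5), (23, 4, 6), (24, 4, 7)],
    [(27, 2, 6), (28, 2, 7), (29, 2, 5)], [2], false⟩
  Param := Code × Cont × List ℕ
  nodes := fun (f, k, v) => [.ret (.comp f k) v, .nat 0, .norm f k v, .nat 0, .cont (.comp f k),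
    .list v, .code f, .cont k]

def retFixZero : Move c₀ where
  rule := ⟨[(30, 0, 4), (31, 0, 5), (26, 4, 6), (2, 5, 7), (0, 7, 8), (3, 5, 9)],
    [(30, 2, 6), (31, 2, 9)], [2], false⟩
  Param := Code × Cont × {v : List ℕ // v.headI = 0}
  nodes := fun (f, k, ⟨v, _⟩) => [.ret (.fix f k) v, .nat 0, .ret k v.tail, .nat 0,
    .cont (.fix f k), .list v, .cont k, .nat 0, .nat 0, .list v.tail]
  body := by
    rintro ⟨f, k, v, hv⟩
    simp only [EdgeSat, List.forall_mem_cons, List.not_mem_nil, false_imp_iff, implies_true,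
      and_true]
    cases v <;> and_intros <;> first | constructor | (cases hv; constructor)

def retFixSucc : Move c₀ where
  rule := ⟨[(30, 0, 4), (31, 0, 5), (25, 4, 6), (2, 5, 7), (1, 7, 8), (3, 5, 9)],
    [(27, 2, 6), (28, 2, 4), (29, 2, 9)], [2], false⟩
  Param := Code × Cont × ℕ × List ℕ
  nodes := fun (f, k, y, t) => [.ret (.fix f k) ((y + 1) :: t), .nat 0, .norm f (.fix f k) t,
    .nat 0, .cont (.fix f k), .list ((y + 1) :: t), .code f, .nat (y + 1), .nat y, .list t]

def guessInc : Move c₀ where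
  rule := ⟨[(32, 0, 4), (33, 0, 5), (34, 0, 6)],
    [(32, 2, 7), (33, 2, 5), (34, 2, 6), (1, 7, 4)], [2, 7], false⟩
  Param := ℕ × ℕ
  nodes := fun (n, s) => [.guess n s, .nat 0, .guess (n + 1) s, .nat 0, .nat n, .nat s,
    .cont .halt, .nat (n + 1)]

def guessRun : Move c₀ where
  rule := ⟨[(32, 0, 4), (33, 0, 5), (34, 0, 6), (16, 6, 7), (17, 6, 8)],
    [(27, 2, 8), (28, 2, 6), (29, 2, 9), (2, 9, 4), (3, 9, 10), (4, 9, 10), (2, 10, 5),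
    (3, 10, 7), (4, 10, 7)], [2, 9, 10], false⟩
  Param := ℕ × ℕ
  nodes := fun (n, s) => [.guess n s, .nat 0, .norm c₀ .halt [n, s], .nat 0, .nat n, .nat s,
    .cont .halt, .list [], .code c₀, .list [n, s], .list [s]]

def retHalt : Move c₀ where
  rule := ⟨[(30, 0, 4), (31, 0, 5), (15, 4, 6), (2, 5, 7), (1, 7, 8)],
    [(32, 2, 6), (33, 2, 8), (34, 2, 4)], [2], true⟩
  Param := ℕ × List ℕ
  nodes := fun (s, t) => [.ret .halt ((s + 1) :: t), .nat 0, .guess 0 s, .nat 0, .cont .halt,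
    .list ((s + 1) :: t), .nat 0, .nat (s + 1), .nat s]

end Move

end ChaseTermination

namespace ChaseTermination
open Relation Turing.ToPartrec

namespace Move

variable (c₀ : Code)

def all : List (Move c₀) :=
  [evalZero c₀, evalSucc c₀, evalTail c₀, evalCons c₀, evalComp c₀, evalCaseZero c₀,
    evalCaseSucc c₀, evalFix c₀, retCons₁ c₀, retCons₂ c₀, retComp c₀, retFixZero c₀,
    retFixSucc c₀, guessInc c₀, guessRun c₀, retHalt c₀]

end Move

/-- The rewriting system that runs `c₀` on guessed inputs. -/
def machine (c₀ : Code) : RewriteSystem Val where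
  Ch := Child c₀
  P := 35
  rules := (Move.all c₀).map Move.rule
  wf := by
    intro r hr
    obtain ⟨m, -, rfl⟩ := List.mem_map.1 hr
    exact m.wf
  sound := by
    intro r hr ν hν
    obtain ⟨m, -, rfl⟩ := List.mem_map.1 hr
    obtain ⟨a, ha⟩ := m.exists_of_body ν hν
    refine ⟨fun v => if v ∈ m.rule.new then asg (m.nodes a) v else ν v, fun v hv => if_neg hv,
      fun e he => ?_⟩
    obtain ⟨-, h₁, h₂⟩ := m.wf.2.2.1 e he
    have h : (if e.2.2 ∈ m.rule.new then asg (m.nodes a) e.2.2 else ν e.2.2) =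
        asg (m.nodes a) e.2.2 := by
      split_ifs with h
      · rfl
      · exact ha _ (h₂.resolve_left h)
    simpa only [if_pos h₁, h] using m.head a e he
  complete := by
    intro r hr ν hν hν' i hi p b hb
    obtain ⟨m, -, rfl⟩ := List.mem_map.1 hr
    obtain ⟨a, ha⟩ := m.exists_of_head ν hν hν'
    rw [ha i (Or.inr hi)] at hb
    obtain ⟨j, hj, rfl⟩ := m.complete a i hi p b hb
    exact ⟨j, hj, ha j (m.wf.2.2.1 _ hj).2.2.symm⟩

theorem machine_trans_iff {c₀ : Code} {q : Bool} {x y : Val} : (machine c₀).Trans q x y ↔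
    ∃ m ∈ Move.all c₀, m.rule.q = q ∧
      ∃ a, asg (m.nodes a) 0 = x ∧ asg (m.nodes a) 2 = y := by
  constructor
  · rintro ⟨r, hr, hq, ν, h, h', rfl, rfl⟩
    obtain ⟨m, hm, rfl⟩ := List.mem_map.1 hr
    obtain ⟨a, ha⟩ := m.exists_of_head ν h h'
    refine ⟨m, hm, hq, a, (ha 0 (Or.inl List.mem_cons_self)).symm, (ha 2 (Or.inr ?_)).symm⟩
    simp only [Move.all, List.mem_cons, List.not_mem_nil, or_false] at hm
    casesm* _ ∨ _ <;> subst m <;> exact List.mem_cons_self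
  · rintro ⟨m, hm, hq, a, rfl, rfl⟩
    exact ⟨m.rule, List.mem_map_of_mem hm, hq, asg (m.nodes a), m.body a, m.head a, rfl, rfl⟩

theorem machine_trans_true {c₀ : Code} {x y : Val} :
    (machine c₀).Trans true x y ↔ ∃ s t, x = .ret .halt ((s + 1) :: t) ∧ y = .guess 0 s := by
  rw [machine_trans_iff]
  simp only [Move.all, List.exists_mem_cons_iff, Move.evalZero, Move.evalSucc, Move.evalTail,
    Move.evalCons, Move.evalComp, Move.evalCaseZero, Move.evalCaseSucc, Move.evalFix,
    Move.retCons₁, Move.retCons₂, Move.retComp, Move.retFixZero, Move.retFixSucc, Move.guessInc,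
    Move.guessRun, Move.retHalt, Bool.false_eq_true, false_and, false_or, List.not_mem_nil,
    exists_false, or_false, true_and, Prod.exists]
  exact ⟨fun ⟨s, t, h, h'⟩ => ⟨s, t, h.symm, h'.symm⟩, fun ⟨s, t, h, h'⟩ => ⟨s, t, h.symm, h'.symm⟩⟩

/-- The final configuration reached from a node. -/
def Val.run : Val → Part Cfg
  | .norm c k v => StateTransition.eval step (stepNormal c k v)
  | .ret k v => StateTransition.eval step (.ret k v)
  | _ => Part.none

theorem run_ret (k : Cont) (v : List ℕ) :
    (Val.ret k v).run = StateTransition.eval step (stepRet k v) :=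
  StateTransition.reaches_eval (ReflTransGen.single rfl)

theorem machine_trans_false {c₀ : Code} {x y : Val} (h : (machine c₀).Trans false x y) :
    (∃ n s, x = .guess n s ∧ (y = .guess (n + 1) s ∨ y = .norm c₀ .halt [n, s])) ∨
      ((∀ n s, x ≠ .guess n s) ∧ (∀ n s, y ≠ .guess n s) ∧ y.run = x.run) := by
  obtain ⟨m, hm, hq, a, rfl, rfl⟩ := machine_trans_iff.1 h
  simp only [Move.all, List.mem_cons, List.not_mem_nil, or_false] at hm
  obtain rfl | rfl | rfl | rfl | rfl | rfl | rfl | rfl | rfl | rfl | rfl | rfl | rfl | rfl | rfl |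
    rfl := hm
  · exact Or.inr ⟨nofun, nofun, rfl⟩
  · exact Or.inr ⟨nofun, nofun, rfl⟩
  · exact Or.inr ⟨nofun, nofun, rfl⟩
  · exact Or.inr ⟨nofun, nofun, rfl⟩
  · exact Or.inr ⟨nofun, nofun, rfl⟩
  · obtain ⟨f, g, k, v, hv⟩ := a
    refine Or.inr ⟨nofun, nofun, ?_⟩
    change StateTransition.eval step (stepNormal f k v.tail) = StateTransition.eval step
      (v.headI.rec (stepNormal f k v.tail) fun y _ => stepNormal g k (y :: v.tail))
    rw [hv]
    rfl
  · exact Or.inr ⟨nofun, nofun, rfl⟩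
  · exact Or.inr ⟨nofun, nofun, rfl⟩
  · obtain ⟨g, u, k, v⟩ := a
    exact Or.inr ⟨nofun, nofun, (run_ret (.cons₁ g u k) v).symm⟩
  · obtain ⟨u, k, v⟩ := a
    exact Or.inr ⟨nofun, nofun, (run_ret k _).trans (run_ret (.cons₂ u k) v).symm⟩
  · obtain ⟨f, k, v⟩ := a
    exact Or.inr ⟨nofun, nofun, (run_ret (.comp f k) v).symm⟩
  · obtain ⟨f, k, v, hv⟩ := a
    refine Or.inr ⟨nofun, nofun, ((run_ret (.fix f k) v).trans ?_).symm⟩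
    refine Eq.trans ?_ (run_ret _ _).symm
    exact congrArg _ (if_pos hv)
  · obtain ⟨f, k, y, t⟩ := a
    refine Or.inr ⟨nofun, nofun, ((run_ret (.fix f k) _).trans ?_).symm⟩
    exact congrArg _ (if_neg (Nat.succ_ne_zero y))
  · exact Or.inl ⟨a.1, a.2, rfl, Or.inl rfl⟩
  · exact Or.inl ⟨a.1, a.2, rfl, Or.inr rfl⟩
  · exact absurd hq (by simp [Move.retHalt])

section Forward

variable {c₀ : Code}

theorem Move.trans {m : Move c₀} (hm : m ∈ Move.all c₀) (a : m.Param) :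
    (machine c₀).Trans m.rule.q (asg (m.nodes a) 0) (asg (m.nodes a) 2) :=
  machine_trans_iff.2 ⟨m, hm, rfl, a, rfl, rfl⟩

theorem machine_eval (c : Code) : ∀ {v l : List ℕ}, l ∈ c.eval v → ∀ k,
    ReflTransGen ((machine c₀).Trans false) (.norm c k v) (.ret k l) := by
  induction c with
  | zero' =>
    intro v l h k
    obtain rfl := Part.mem_some_iff.1 h
    exact .single (Move.trans (m := .evalZero c₀) (by simp [Move.all]) (k, v))
  | succ =>
    intro v l h k
    obtain rfl := Part.mem_some_iff.1 h
    exact .single (Move.trans (m := .evalSucc c₀) (by simp [Move.all]) (k, v))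
  | tail =>
    intro v l h k
    obtain rfl := Part.mem_some_iff.1 h
    exact .single (Move.trans (m := .evalTail c₀) (by simp [Move.all]) (k, v))
  | cons f g hf hg =>
    intro v l h k
    simp only [Code.cons_eval, Part.bind_eq_bind, Part.pure_eq_some, Part.mem_bind_iff,
      Part.mem_some_iff] at h
    obtain ⟨u, hu, w, hw, rfl⟩ := h
    refine .head (Move.trans (m := .evalCons c₀) (by simp [Move.all]) (f, g, k, v)) ?_
    refine (hf hu _).trans ?_
    refine .head (Move.trans (m := .retCons₁ c₀) (by simp [Move.all]) (g, v, k, u)) ?_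
    refine (hg hw _).trans ?_
    exact .single (Move.trans (m := .retCons₂ c₀) (by simp [Move.all]) (u, k, w))
  | comp f g hf hg =>
    intro v l h k
    rw [Code.comp_eval] at h
    obtain ⟨u, hu, hl⟩ := Part.mem_bind_iff.1 h
    refine .head (Move.trans (m := .evalComp c₀) (by simp [Move.all]) (f, g, k, v)) ?_
    refine (hg hu _).trans ?_
    refine .head (Move.trans (m := .retComp c₀) (by simp [Move.all]) (f, k, u)) ?_
    exact hf hl _
  | case f g hf hg =>
    intro v l h k
    rw [Code.case_eval] at h
    rcases v with _ | ⟨_ | y, t⟩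
    · exact .head (Move.trans (m := .evalCaseZero c₀) (by simp [Move.all]) (f, g, k, ⟨[], rfl⟩))
        (hf h _)
    · exact .head (Move.trans (m := .evalCaseZero c₀) (by simp [Move.all])
        (f, g, k, ⟨0 :: t, rfl⟩)) (hf h _)
    · exact .head (Move.trans (m := .evalCaseSucc c₀) (by simp [Move.all]) (f, g, k, y, t))
        (hg h _)
  | fix f hf =>
    intro v l h k
    refine .head (Move.trans (m := .evalFix c₀) (by simp [Move.all]) (f, k, v)) ?_
    rw [Code.fix_eval] at h
    refine PFun.fixInduction' (C := fun v => ReflTransGen ((machine c₀).Trans false)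
      (.norm f (.fix f k) v) (.ret k l)) h ?_ ?_
    · intro v hv
      obtain ⟨w, hw, h⟩ := (Part.mem_map_iff _).1 hv
      split_ifs at h with h0
      obtain rfl := Sum.inl.inj h
      exact (hf hw _).tail
        (Move.trans (m := .retFixZero c₀) (by simp [Move.all]) (f, k, ⟨w, h0⟩))
    · intro v v' _ hv ih
      obtain ⟨w, hw, h⟩ := (Part.mem_map_iff _).1 hv
      split_ifs at h with h0
      obtain rfl := Sum.inr.inj h
      obtain ⟨y, t, rfl⟩ : ∃ y t, w = (y + 1) :: t := by
        rcases w with _ | ⟨_ | y, t⟩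
        · exact absurd rfl h0
        · exact absurd rfl h0
        · exact ⟨y, t, rfl⟩
      exact ((hf hw _).tail
        (Move.trans (m := .retFixSucc c₀) (by simp [Move.all]) (f, k, y, t))).trans ih

end Forward

theorem machine_seg_iff {c₀ : Code} {g : ℕ → ℕ → ℕ} (hg : ∀ n s, c₀.eval [n, s] = .some [g n s])
    {s : ℕ} {y : Val} :
    (machine c₀).Seg (.guess 0 s) y ↔ ∃ n s', y = .guess 0 s' ∧ g n s = s' + 1 := by
  constructor
  · rintro ⟨z, hz, h⟩
    obtain ⟨s', t, rfl, rfl⟩ := machine_trans_true.1 h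
    have key : ∀ z, ReflTransGen ((machine c₀).Trans false) (.guess 0 s) z →
        (∃ n, z = .guess n s) ∨ (∀ n s, z ≠ .guess n s) ∧ ∃ n, z.run = .some (.halt [g n s]) := by
      intro z hz
      induction hz with
      | refl => exact Or.inl ⟨0, rfl⟩
      | tail _ hstep ih =>
        obtain ⟨n, s₁, rfl, h⟩ | ⟨hx, hy, h⟩ := machine_trans_false hstep
        · obtain ⟨n', h'⟩ | ⟨h', -⟩ := ih
          · obtain ⟨-, rfl⟩ := Val.guess.inj h'
            rcases h with rfl | rfl
            · exact Or.inl ⟨_, rfl⟩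
            · refine Or.inr ⟨nofun, n, (stepNormal_eval _ _).trans ?_⟩
              rw [hg]
              rfl
          · exact absurd rfl (h' _ _)
        · obtain ⟨n', h'⟩ | ⟨-, n, hn⟩ := ih
          · exact absurd h' (hx _ _)
          · exact Or.inr ⟨hy, n, h.trans hn⟩
    obtain ⟨n, h⟩ | ⟨-, n, h⟩ := key _ hz
    · cases h
    · refine ⟨n, s', rfl, ?_⟩
      rw [run_ret, stepRet_eval, Cont.eval, map_pure] at h
      have := Part.some_inj.1 h
      injection this with this
      injection this with this
      exact this.symm
  · rintro ⟨n, s', rfl, h⟩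
    refine ⟨.ret .halt [s' + 1], ?_, machine_trans_true.2 ⟨s', [], rfl, rfl⟩⟩
    have h₁ : ∀ n, ReflTransGen ((machine c₀).Trans false) (.guess 0 s) (.guess n s) := by
      intro n
      induction n with
      | zero => rfl
      | succ n ih =>
        exact ih.tail (Move.trans (m := .guessInc c₀) (by simp [Move.all]) (n, s))
    refine ((h₁ n).tail
      (Move.trans (m := .guessRun c₀) (by simp [Move.all]) (n, s))).trans (machine_eval c₀ ?_ _)
    rw [hg, h]
    exact Part.mem_some _

end ChaseTermination

namespace ChaseTermination
open Relation Turing.ToPartrec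

/-- Every binary computable function is computed by a code. -/
theorem exists_code_of_computable₂ {g : ℕ → ℕ → ℕ} (hg : Computable₂ g) :
    ∃ c : Code, ∀ n s, c.eval [n, s] = .some [g n s] := by
  have h := (Nat.Partrec'.part_iff₂ (f := fun n s => Part.some (g n s))).2 hg.partrec₂
  obtain ⟨c, hc⟩ := Code.exists_code h
  refine ⟨c, fun n s => ?_⟩
  have := hc ⟨[n, s], rfl⟩
  simpa [List.Vector.head, List.Vector.tail] using this

/-- Non-membership in a `Π¹₁` set is the existence of an infinite path in a computable graph with
guessed transitions. -/
theorem Pi11.exists_path {q : ℕ → Prop} (hq : Pi11 q) : ∃ (g : ℕ → ℕ → ℕ) (s₀ : ℕ → ℕ),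
    Computable₂ g ∧ Computable s₀ ∧
      ∀ a, q a ↔ ¬∃ s : ℕ → ℕ, s 0 = s₀ a ∧ ∀ i, ∃ n, g n (s i) = s (i + 1) + 1 := by
  obtain ⟨R, hR, hq⟩ := hq
  let D : ℕ → ℕ × List ℕ := Denumerable.ofNat (ℕ × List ℕ)
  have hD : Computable D := Computable.ofNat _
  refine ⟨fun n s => bif R (D s).1 (D s).2 then 0 else
      Encodable.encode ((D s).1, (D s).2 ++ [n]) + 1,
    fun a => Encodable.encode (a, ([] : List ℕ)), ?_, ?_, fun a => ?_⟩
  · have h₁ : Computable fun p : ℕ × ℕ => D p.2 := hD.comp Computable.snd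
    have h₂ := Computable.fst.comp h₁
    have h₃ := Computable.snd.comp h₁
    refine Computable.cond (hR.comp h₂ h₃) (Computable.const 0) (Computable.succ.comp
      (Computable.encode.comp (h₂.pair (Computable.list_append.comp h₃ ?_))))
    exact Computable.list_cons.comp Computable.fst (Computable.const [])
  · exact Computable.encode.comp (Computable.id.pair (Computable.const []))
  · have hDe : ∀ x, D (Encodable.encode x) = x := Denumerable.ofNat_encode
    rw [hq, ← not_iff_not, not_not, not_forall]
    constructor
    · rintro ⟨f, hf⟩
      simp only [not_exists, Bool.not_eq_true] at hf
      refine ⟨fun i => Encodable.encode (a, (List.range i).map f), rfl, fun i => ⟨f i, ?_⟩⟩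
      simp only [hDe, hf, cond_false, List.range_succ, List.map_append, List.map_cons,
        List.map_nil]
    · rintro ⟨s, h0, hs⟩
      choose f hf using hs
      have key : ∀ i, s i = Encodable.encode (a, (List.range i).map f) := by
        intro i
        induction i with
        | zero => exact h0
        | succ i ih =>
          have h := hf i
          rw [ih] at h
          simp only [hDe] at h
          cases hb : R a ((List.range i).map f)
          · rw [hb, cond_false] at h
            rw [← Nat.succ.inj h, List.range_succ, List.map_append, List.map_cons, List.map_nil]
          · rw [hb, cond_true] at h
            exact absurd h (Nat.succ_ne_zero _).symm
      refine ⟨f, fun ⟨k, hk⟩ => ?_⟩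
      have h := hf k
      rw [key k] at h
      simp only [hDe, hk, cond_true] at h
      exact absurd h (Nat.succ_ne_zero _).symm

end ChaseTermination

namespace ChaseTermination
open Relation Turing.ToPartrec

/-- The codes occurring in a code. -/
def subcodes : Code → List Code
  | .cons f g => .cons f g :: (subcodes f ++ subcodes g)
  | .comp f g => .comp f g :: (subcodes f ++ subcodes g)
  | .case f g => .case f g :: (subcodes f ++ subcodes g)
  | .fix f => .fix f :: subcodes f
  | c => [c]

theorem mem_subcodes_self (c : Code) : c ∈ subcodes c := by
  cases c <;> simp [subcodes]

theorem subcodes_subset {c d : Code} (h : d ∈ subcodes c) : subcodes d ⊆ subcodes c := by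
  induction c with
  | zero' => simp only [subcodes, List.mem_singleton] at h; simp [h]
  | succ => simp only [subcodes, List.mem_singleton] at h; simp [h]
  | tail => simp only [subcodes, List.mem_singleton] at h; simp [h]
  | fix f hf =>
    rcases List.mem_cons.1 h with rfl | h
    · exact fun _ => id
    · exact fun x hx => List.mem_cons_of_mem _ (hf h hx)
  | _ f g hf hg =>
    rcases List.mem_cons.1 h with rfl | h
    · exact fun _ => id
    · rcases List.mem_append.1 h with h | h
      · exact fun x hx => List.mem_cons_of_mem _ (List.mem_append_left _ (hf h hx))
      · exact fun x hx => List.mem_cons_of_mem _ (List.mem_append_right _ (hg h hx))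

/-- The nodes shared by all initial graphs. -/
def fixedNodes (c₀ : Code) : List Val :=
  .nat 0 :: .cont .halt :: .list [] :: (subcodes c₀).map .code

theorem Child.label_lt {c₀ : Code} {p : ℕ} {x y : Val} (h : Child c₀ p x y) : p < 35 := by
  cases h <;> decide

theorem Child.mem_fixedNodes {c₀ : Code} {p : ℕ} {x y : Val} (h : Child c₀ p x y)
    (hx : x ∈ fixedNodes c₀) : y ∈ fixedNodes c₀ := by
  have key : ∀ {c d : Code}, Val.code c ∈ fixedNodes c₀ → d ∈ subcodes c →
      Val.code d ∈ fixedNodes c₀ := by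
    intro c d hc hd
    simp only [fixedNodes, List.mem_cons, reduceCtorEq, List.mem_map, Val.code.injEq,
      exists_eq_right, false_or] at hc ⊢
    exact subcodes_subset hc hd
  have hf := fun c => mem_subcodes_self c
  cases h
  case codeCons₁ | codeCons₂ | codeComp₁ | codeComp₂ | codeCase₁ | codeCase₂ | codeFix =>
    exact key hx (by simp [subcodes, hf])
  all_goals simp_all [fixedNodes]

theorem exists_fixedEdges (c₀ : Code) : ∃ E : List (ℕ × ℕ × ℕ), ∀ e, e ∈ E ↔
    e.2.1 < (fixedNodes c₀).length ∧ e.2.2 < (fixedNodes c₀).length ∧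
      Child c₀ e.1 (asg (fixedNodes c₀) e.2.1) (asg (fixedNodes c₀) e.2.2) := by
  have hfin : {e : ℕ × ℕ × ℕ | e.2.1 < (fixedNodes c₀).length ∧
      e.2.2 < (fixedNodes c₀).length ∧
      Child c₀ e.1 (asg (fixedNodes c₀) e.2.1) (asg (fixedNodes c₀) e.2.2)}.Finite :=
    ((Set.finite_Iio 35).prod ((Set.finite_Iio _).prod (Set.finite_Iio _))).subset
      fun e he => ⟨he.2.2.label_lt, he.1, he.2.1⟩
  exact ⟨hfin.toFinset.toList, fun e => by simp⟩

/-- The labels and edges of the numerals up to `s` and the guessing configuration for `s`, where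
`K` nodes are used otherwise. -/
def stateEdges (K s : ℕ) : List (ℕ × ℕ × ℕ) :=
  [(32, K, K + 1), (33, K, s + (K + 1)), (34, K, 1), (0, K + 1, K + 1)] ++
    (List.range s).map fun j => (1, j + (K + 2), j + (K + 1))

theorem tkrAll_machine_iff {c₀ : Code} {g : ℕ → ℕ → ℕ}
    (hg : ∀ n s, c₀.eval [n, s] = .some [g n s]) {E : List (ℕ × ℕ × ℕ)}
    (hE : ∀ e, e ∈ E ↔ e.2.1 < (fixedNodes c₀).length ∧ e.2.2 < (fixedNodes c₀).length ∧
      Child c₀ e.1 (asg (fixedNodes c₀) e.2.1) (asg (fixedNodes c₀) e.2.2)) (s : ℕ) :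
    TKRall ((machine c₀).ruleSet, graphDb 35 (E ++ stateEdges (fixedNodes c₀).length s)
        (s + ((fixedNodes c₀).length + 2)) (fixedNodes c₀).length) ↔
      ¬∃ ρ : ℕ → ℕ, ρ 0 = s ∧ ∀ i, ∃ n, g n (ρ i) = ρ (i + 1) + 1 := by
  set K := (fixedNodes c₀).length with hK
  have hK1 : 1 < K := by simp [hK, fixedNodes]
  let val : ℕ → Val := fun i =>
    if i < K then asg (fixedNodes c₀) i else if i = K then .guess 0 s else .nat (i - (K + 1))
  have val_lt : ∀ {i}, i < K → val i = asg (fixedNodes c₀) i := fun h => if_pos h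
  have val_K : val K = .guess 0 s := by simp [val]
  have val_nat : ∀ j, val (j + (K + 1)) = .nat j := by
    intro j
    simp only [val]
    rw [if_neg (by omega), if_neg (by omega), Nat.add_sub_cancel]
  have val_one : val 1 = .cont .halt := val_lt hK1
  have hP : ∀ {p}, p < 35 → p < (machine c₀).P := id
  refine ((machine c₀).tkrAll_graphDb_iff val ?_ ?_ (by omega)).trans (not_congr ?_)
  · intro e he
    rcases List.mem_append.1 he with he | he
    · obtain ⟨h₁, h₂, h₃⟩ := (hE e).1 he
      exact ⟨h₃.label_lt, by omega, by omega, by rwa [val_lt h₁, val_lt h₂]⟩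
    · have h0 : val (K + 1) = .nat 0 := by simpa using val_nat 0
      simp only [stateEdges, List.cons_append, List.nil_append, List.mem_cons, List.mem_map,
        List.mem_range] at he
      obtain rfl | rfl | rfl | rfl | ⟨j, hj, rfl⟩ := he
      · refine ⟨hP (by simp only; omega), by simp only; omega, by simp only; omega, ?_⟩
        simp only [val_K, h0]
        exact .guessNat _ _
      · refine ⟨hP (by simp only; omega), by simp only; omega, by simp only; omega, ?_⟩
        simp only [val_K, val_nat]
        exact .guessState _ _
      · refine ⟨hP (by simp only; omega), by simp only; omega, by simp only; omega, ?_⟩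
        simp only [val_K, val_one]
        exact .guessHalt _ _
      · refine ⟨hP (by simp only; omega), by simp only; omega, by simp only; omega, ?_⟩
        simp only [h0]
        exact .isZero
      · refine ⟨hP (by simp only; omega), by simp only; omega, by simp only; omega, ?_⟩
        have h1 := val_nat (j + 1)
        rw [show j + 1 + (K + 1) = j + (K + 2) by omega] at h1
        simp only [h1, val_nat]
        exact .pred _
  · intro i hi p b hb
    rcases lt_trichotomy i K with h | rfl | h
    · rw [val_lt h] at hb
      have hmem : asg (fixedNodes c₀) i ∈ fixedNodes c₀ := by
        rw [asg, List.getD_eq_getElem _ _ h]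
        exact List.getElem_mem h
      obtain ⟨j, hj, rfl⟩ := List.getElem_of_mem (Child.mem_fixedNodes hb hmem)
      have hj' : asg (fixedNodes c₀) j = (fixedNodes c₀)[j] := List.getD_eq_getElem _ _ hj
      exact ⟨j, List.mem_append_left _ ((hE _).2 ⟨h, hj, by rwa [hj']⟩),
        (val_lt hj).trans hj'⟩
    · rw [val_K] at hb
      cases hb
      · exact ⟨K + 1, by simp [stateEdges], by simpa using val_nat 0⟩
      · exact ⟨s + (K + 1), by simp [stateEdges], val_nat s⟩
      · exact ⟨1, by simp [stateEdges], val_one⟩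
    · obtain ⟨j, rfl⟩ : ∃ j, i = j + (K + 1) := ⟨i - (K + 1), by omega⟩
      rw [val_nat] at hb
      cases hb
      · exact ⟨K + 1, by simp [stateEdges], by simpa using val_nat 0⟩
      · rename_i m
        refine ⟨m + (K + 1), List.mem_append_right _ (List.mem_append_right _
          (List.mem_map.2 ⟨m, List.mem_range.2 (by omega), ?_⟩)), val_nat m⟩
        simp only [Prod.mk.injEq, and_true, true_and]
        omega
  · rw [val_K]
    constructor
    · rintro ⟨ρ, h0, hρ⟩
      have h : ∀ i, ∃ s', ρ i = .guess 0 s' := by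
        intro i
        cases i with
        | zero => exact ⟨s, h0⟩
        | succ i =>
          induction i with
          | zero =>
            have := hρ 0
            rw [h0, machine_seg_iff hg] at this
            obtain ⟨n, s', h, -⟩ := this
            exact ⟨s', h⟩
          | succ i ih =>
            obtain ⟨s', hs'⟩ := ih
            have := hρ (i + 1)
            rw [hs', machine_seg_iff hg] at this
            obtain ⟨n, s', h, -⟩ := this
            exact ⟨s', h⟩
      choose σ hσ using h
      refine ⟨σ, ?_, fun i => ?_⟩
      · have := (hσ 0).symm.trans h0
        exact (Val.guess.inj this).2
      · have := hρ i
        rw [hσ i, machine_seg_iff hg, hσ (i + 1)] at this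
        obtain ⟨n, s', h, h'⟩ := this
        exact ⟨n, by rw [h', (Val.guess.inj h).2]⟩
    · rintro ⟨σ, rfl, hσ⟩
      refine ⟨fun i => .guess 0 (σ i), rfl, fun i => (machine_seg_iff hg).2 ?_⟩
      obtain ⟨n, hn⟩ := hσ i
      exact ⟨n, _, rfl, hn⟩

theorem primrec_graphDb {P t : ℕ} {edges : ℕ → List (ℕ × ℕ × ℕ)} {N : ℕ → ℕ}
    (hE : Primrec edges) (hN : Primrec N) : Primrec fun s => graphDb P (edges s) (N s) t := by
  have hnode : Primrec node := Primrec.sumInl.comp (Primrec.nat_add.comp .id (.const 2))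
  have hsingle : ∀ {α β : Type} [Primcodable α] [Primcodable β] {f : α → β}, Primrec f →
      Primrec fun a => [f a] := fun hf => Primrec.list_cons.comp hf (.const [])
  refine Primrec.list_cons.comp (.const _) (Primrec.list_append.comp ?_ ?_)
  · refine Primrec.list_map hE (Primrec.pair ?_ ?_)
    · exact Primrec.nat_add.comp (Primrec.fst.comp .snd) (.const 3)
    · exact Primrec.list_cons.comp (hnode.comp (Primrec.fst.comp (Primrec.snd.comp .snd)))
        (hsingle (hnode.comp (Primrec.snd.comp (Primrec.snd.comp .snd))))
  · refine Primrec.list_flatMap (Primrec.list_range.comp (Primrec.nat_add.comp hN (.const 2))) ?_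
    refine Primrec.list_map (.const _) (Primrec.pair ?_ ?_)
    · exact Primrec.nat_add.comp .snd (.const 2)
    · exact Primrec.list_cons.comp (.const _)
        (hsingle (Primrec.sumInl.comp (Primrec.snd.comp .fst)))

theorem primrec_stateEdges (K : ℕ) : Primrec (stateEdges K) := by
  have hadd : ∀ {α : Type} [Primcodable α] {f : α → ℕ} (n : ℕ), Primrec f →
      Primrec fun a => f a + n := fun n hf => Primrec.nat_add.comp hf (.const n)
  refine Primrec.list_append.comp ?_ ?_
  · exact Primrec.list_cons.comp (.const _) (Primrec.list_cons.comp
      ((Primrec.const _).pair ((Primrec.const _).pair (hadd _ .id))) (.const _))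
  · exact Primrec.list_map .list_range
      ((Primrec.const _).pair ((hadd _ .snd).pair (hadd _ .snd)))

theorem pi11Hard_tkrAll : Pi11Hard TKRall := by
  intro q hq
  obtain ⟨g, s₀, hg, hs₀, hq⟩ := hq.exists_path
  obtain ⟨c₀, hc₀⟩ := exists_code_of_computable₂ hg
  obtain ⟨E, hE⟩ := exists_fixedEdges c₀
  have h := ((primrec_graphDb (P := 35) (t := (fixedNodes c₀).length)
    (Primrec.list_append.comp (.const E) (primrec_stateEdges (fixedNodes c₀).length))
    (Primrec.nat_add.comp .id (.const ((fixedNodes c₀).length + 2)))).to_comp).comp hs₀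
  refine ⟨_, (Computable.const (machine c₀).ruleSet).pair h, fun a => ?_⟩
  rw [hq]
  exact (tkrAll_machine_iff hc₀ hE (s₀ a)).symm

end ChaseTermination

namespace ChaseTermination

/-- The class `TKR∀` of all knowledge bases whose restricted chase sequences
are all finite is `Π¹₁`-complete. -/
theorem TKRall_Pi11Complete : Pi11Complete TKRall := ⟨pi11_tkrAll, pi11Hard_tkrAll⟩

end ChaseTermination
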